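/- arXiv:2402.08497 — 5 statements merged into one kernel-verified Lean document; each statement's English description precedes it below -/
import Mathlib

section
/- Let F be a finite field with |F| = q, let n ≥ 2 with (n,q) ≠ (2,2), let G = GL_n(F) and S = SL_n(F). Let g ∈ G \ Z(G) and set C = g^S. Then there exists t ∈ S with t² = 1 and t ≠ 1, with moreover t ∉ Z(S) whenever n ≠ 2, and there exist elements x₁,…,x₆ ∈ C and y₁,…,y₆ ∈ C⁻¹ such that x₁y₁x₂y₂x₃y₃x₄y₄x₅y₅x₆y₆ = t. -/
/-- The subgroup `SL_n(F)` of `GL_n(F)`, as the range of the natural embedding. -/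
def SLsub (n : ℕ) (F : Type*) [Field F] : Subgroup (GL (Fin n) F) :=
  (Matrix.SpecialLinearGroup.toGL (n := Fin n) (R := F)).range

/-- The `S`-conjugacy class `g^S` of an element `g` of a group `G`, for `S` a subgroup. -/
def conjClassBy {G : Type*} [Group G] (S : Subgroup G) (g : G) : Set G :=
  {c | ∃ s ∈ S, c = s * g * s⁻¹}

section Involutions

open Pointwise Matrix

section ConjQuot

variable {G : Type*} [Group G] {S : Subgroup G} {g : G}

/-- The set `C * C⁻¹` for `C` the `S`-conjugacy class of `g`. -/
def conjQuot (S : Subgroup G) (g : G) : Set G :=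
  conjClassBy S g * (conjClassBy S g)⁻¹

theorem mem_conjQuot {d : G} :
    d ∈ conjQuot S g ↔ ∃ s ∈ S, ∃ r ∈ S, d = s * g * s⁻¹ * (r * g * r⁻¹)⁻¹ := by
  constructor
  · rintro ⟨_, ⟨s, hs, rfl⟩, y, ⟨r, hr, hy⟩, rfl⟩
    exact ⟨s, hs, r, hr, by rw [← hy, inv_inv]⟩
  · rintro ⟨s, hs, r, hr, rfl⟩
    exact Set.mul_mem_mul ⟨s, hs, rfl⟩ (Set.inv_mem_inv.2 ⟨r, hr, rfl⟩)

theorem one_mem_conjQuot : (1 : G) ∈ conjQuot S g :=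
  mem_conjQuot.2 ⟨1, S.one_mem, 1, S.one_mem, by simp⟩

theorem commutator_mem_conjQuot {s : G} (hs : s ∈ S) : s * g * s⁻¹ * g⁻¹ ∈ conjQuot S g :=
  mem_conjQuot.2 ⟨s, hs, 1, S.one_mem, by simp⟩

theorem conjQuot_inv : (conjQuot S g)⁻¹ = conjQuot S g := by
  simp [conjQuot]

theorem conj_mem_conjQuot {s d : G} (hs : s ∈ S) (hd : d ∈ conjQuot S g) :
    s * d * s⁻¹ ∈ conjQuot S g := by
  obtain ⟨a, ha, b, hb, rfl⟩ := mem_conjQuot.1 hd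
  exact mem_conjQuot.2 ⟨s * a, S.mul_mem hs ha, s * b, S.mul_mem hs hb, by group⟩

theorem conj_mem_conjQuot_pow {s : G} (hs : s ∈ S) {k : ℕ} :
    ∀ {d : G}, d ∈ conjQuot S g ^ k → s * d * s⁻¹ ∈ conjQuot S g ^ k := by
  induction k with
  | zero => intro d hd; simp_all
  | succ k ih =>
    intro d hd
    rw [pow_succ] at hd ⊢
    obtain ⟨a, ha, b, hb, rfl⟩ := hd
    exact ⟨_, ih ha, _, conj_mem_conjQuot hs hb, by group⟩

theorem conjQuot_pow_subset {k l : ℕ} (h : k ≤ l) : conjQuot S g ^ k ⊆ conjQuot S g ^ l :=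
  Set.pow_subset_pow_right one_mem_conjQuot h

theorem conj_mem_conjQuot_conj [hS : S.Normal] (p : G) {d : G} (hd : d ∈ conjQuot S g) :
    p * d * p⁻¹ ∈ conjQuot S (p * g * p⁻¹) := by
  obtain ⟨a, ha, b, hb, rfl⟩ := mem_conjQuot.1 hd
  exact mem_conjQuot.2 ⟨p * a * p⁻¹, hS.conj_mem a ha p, p * b * p⁻¹, hS.conj_mem b hb p, by group⟩

theorem exists_prod_eq_of_mem_conjQuot_pow_six {t : G} (ht : t ∈ conjQuot S g ^ 6) :
    ∃ x y : Fin 6 → G, (∀ i, x i ∈ conjClassBy S g) ∧ (∀ i, y i ∈ (conjClassBy S g)⁻¹) ∧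
      x 0 * y 0 * (x 1 * y 1) * (x 2 * y 2) * (x 3 * y 3) * (x 4 * y 4) * (x 5 * y 5) = t := by
  obtain ⟨f, rfl⟩ := Set.mem_pow.1 ht
  choose x hx y hy hxy using fun i => Set.mem_mul.1 (f i).2
  exact ⟨x, y, hx, hy, by simp [hxy, List.ofFn_succ, mul_assoc]⟩

end ConjQuot

section SL

variable {F : Type*} [Field F] {n : ℕ}

theorem mem_SLsub {s : GL (Fin n) F} : s ∈ SLsub n F ↔ s.val.det = 1 := by
  constructor
  · rintro ⟨m, rfl⟩
    exact m.2
  · intro h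
    exact ⟨⟨s.val, h⟩, Units.ext rfl⟩

instance SLsub_normal : (SLsub n F).Normal where
  conj_mem s hs p := by
    rw [mem_SLsub] at hs ⊢
    rw [← hs]
    exact det_units_conj p s.val

theorem conjQuot_pow_subset_SLsub {g : GL (Fin n) F} {k : ℕ} :
    conjQuot (SLsub n F) g ^ k ⊆ SLsub n F := by
  suffices h : conjQuot (SLsub n F) g ⊆ (SLsub n F).toSubmonoid from Submonoid.pow_subset h
  intro d hd
  obtain ⟨a, ha, b, hb, rfl⟩ := mem_conjQuot.1 hd
  have : a * g * a⁻¹ * (b * g * b⁻¹)⁻¹ = a * (g * (a⁻¹ * b) * g⁻¹) * b⁻¹ := by group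
  rw [this]
  exact (SLsub n F).mul_mem ((SLsub n F).mul_mem ha (SLsub_normal.conj_mem _
    ((SLsub n F).mul_mem ((SLsub n F).inv_mem ha) hb) g)) ((SLsub n F).inv_mem hb)

end SL

section Transvection

variable {F : Type*} [Field F] {n : ℕ}

/-- The transvection `1 + v φ` for a vector `v` and a row vector `φ` annihilating `v`. -/
def transvec (v φ : Fin n → F) (h : φ ⬝ᵥ v = 0) : GL (Fin n) F where
  val := 1 + vecMulVec v φ
  inv := 1 - vecMulVec v φ
  val_inv := by simp [add_mul, mul_sub, vecMulVec_mul_vecMulVec, h]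
  inv_val := by simp [sub_mul, mul_add, vecMulVec_mul_vecMulVec, h]

theorem transvec_mem_SLsub (v φ : Fin n → F) (h : φ ⬝ᵥ v = 0) : transvec v φ h ∈ SLsub n F := by
  rw [mem_SLsub]
  change (1 + vecMulVec v φ).det = 1
  rw [vecMulVec_eq Unit, det_one_add_replicateCol_mul_replicateRow, h, add_zero]

theorem transvec_inv (v φ : Fin n → F) (h : φ ⬝ᵥ v = 0) :
    (transvec v φ h)⁻¹ = transvec v (-φ) (by simp [h]) :=
  Units.ext (by
    change 1 - vecMulVec v φ = 1 + vecMulVec v (-φ)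
    rw [vecMulVec_neg, sub_eq_add_neg])

theorem transvec_conj (g : GL (Fin n) F) (v φ : Fin n → F) (h : φ ⬝ᵥ v = 0) :
    g * transvec v φ h * g⁻¹ = transvec (g.val *ᵥ v) (φ ᵥ* g⁻¹.val)
      (by rw [dotProduct_mulVec, vecMul_vecMul]; simp [h, ← Units.val_mul, -coe_units_inv]) :=
  Units.ext (by
    change g.val * (1 + vecMulVec v φ) * g⁻¹.val = 1 + vecMulVec (g.val *ᵥ v) (φ ᵥ* g⁻¹.val)
    rw [mul_add, add_mul, mul_one, ← Units.val_mul, mul_inv_cancel, Units.val_one,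
      mul_vecMulVec, vecMulVec_mul])

theorem transvec_conj_transvec (v φ w ψ : Fin n → F) (h : φ ⬝ᵥ v = 0) (h' : ψ ⬝ᵥ w = 0) :
    transvec w ψ h' * transvec v φ h * (transvec w ψ h')⁻¹ =
      transvec (v + (ψ ⬝ᵥ v) • w) (φ - (φ ⬝ᵥ w) • ψ)
      (by simp [h, h', sub_dotProduct, dotProduct_add]; ring) := by
  rw [transvec_conj]
  congr 1
  · change (1 + vecMulVec w ψ) *ᵥ v = _
    simp [add_mulVec, vecMulVec_mulVec]
  · change φ ᵥ* (1 - vecMulVec w ψ) = _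
    simp [vecMul_sub, vecMul_vecMulVec]

end Transvection

section GeneralRank

variable {F : Type*} [Field F] {n : ℕ}

theorem transvec_mem_conjQuot_sq (g : GL (Fin n) F) (a φ χ : Fin n → F)
    (hφa : φ ⬝ᵥ a = 0) (hφb : φ ⬝ᵥ (g.val *ᵥ a) = 0)
    (hχa : χ ⬝ᵥ a = 1) (hχb : χ ⬝ᵥ (g.val *ᵥ a) = 0) :
    transvec (g.val *ᵥ a) (-φ) (by simp [hφb]) ∈ conjQuot (SLsub n F) g ^ 2 := by
  set b := g.val *ᵥ a with hb
  set u := transvec a φ hφa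
  set s := transvec b χ hχb
  have hh : u * g * u⁻¹ * g⁻¹ ∈ conjQuot (SLsub n F) g :=
    commutator_mem_conjQuot (transvec_mem_SLsub _ _ _)
  have hψb : (φ ᵥ* g⁻¹.val) ⬝ᵥ b = 0 := by
    rw [hb, dotProduct_mulVec, vecMul_vecMul, ← Units.val_mul]
    simp [hφa]
  have hu : g * u⁻¹ * g⁻¹ = transvec b (-(φ ᵥ* g⁻¹.val))
      (by rw [neg_dotProduct, hψb, neg_zero]) := by
    simp only [u]
    rw [transvec_inv, transvec_conj]
    congr 1
    rw [neg_vecMul]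
  have hval : (u * g * u⁻¹ * g⁻¹).val =
      (1 + vecMulVec a φ) * (1 - vecMulVec b (φ ᵥ* g⁻¹.val)) := by
    rw [mul_assoc u, mul_assoc u, hu, Units.val_mul]
    change _ * (1 + vecMulVec b _) = _
    rw [vecMulVec_neg, ← sub_eq_add_neg]
    rfl
  generalize φ ᵥ* g⁻¹.val = ψ at hψb hval
  generalize u * g * u⁻¹ * g⁻¹ = h at hh hval
  have key : transvec b (-φ) (by simp [hφb]) = h * (s * h⁻¹ * s⁻¹) := by
    rw [← mul_assoc, eq_mul_inv_iff_mul_eq, ← mul_assoc, eq_mul_inv_iff_mul_eq]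
    refine Units.ext ?_
    simp only [Units.val_mul, hval]
    change (1 + vecMulVec b (-φ)) * (1 + vecMulVec b χ) * _ = _ * (1 + vecMulVec b χ)
    simp [mul_add, add_mul, mul_sub, sub_mul, vecMulVec_mul_vecMulVec, hφa, hφb, hχa, hχb, hψb]
    abel
  rw [key, pow_two]
  refine Set.mul_mem_mul hh (conj_mem_conjQuot (transvec_mem_SLsub _ _ _) ?_)
  rw [← Set.mem_inv, conjQuot_inv]
  exact hh

theorem exists_minor_ne_zero {g : GL (Fin n) F} (hg : g ∉ Subgroup.center (GL (Fin n) F)) :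
    ∃ (v : Fin n → F) (i j : Fin n), v i * (g.val *ᵥ v) j - v j * (g.val *ᵥ v) i ≠ 0 := by
  by_contra! H
  apply hg
  have hoff : ∀ i j, i ≠ j → g.val j i = 0 := by
    intro i j hij
    simpa [hij.symm, Pi.single_apply] using H (Pi.single i 1) i j
  have hdiag : ∀ i j, g.val i i = g.val j j := by
    intro i j
    by_cases hij : i = j
    · rw [hij]
    have := H (Pi.single i 1 + Pi.single j 1) i j
    simp [mulVec_add, hij, Ne.symm hij, hoff i j hij, hoff j i (Ne.symm hij)] at this
    exact (sub_eq_zero.1 this).symm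
  rw [GeneralLinearGroup.mem_center_iff_val_mem_range_scalar]
  rcases isEmpty_or_nonempty (Fin n) with hn | ⟨⟨i₀⟩⟩
  · exact ⟨0, Subsingleton.elim _ _⟩
  refine ⟨g.val i₀ i₀, ?_⟩
  ext i j
  by_cases hij : i = j
  · subst hij
    simp [hdiag i₀ i]
  · simp [hij, hoff j i (Ne.symm hij)]

theorem exists_ne_zero_dotProduct_pair_eq_zero (hn : 3 ≤ n) (a b : Fin n → F) :
    ∃ φ : Fin n → F, φ ≠ 0 ∧ φ ⬝ᵥ a = 0 ∧ φ ⬝ᵥ b = 0 := by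
  have h : LinearMap.ker (Matrix.mulVecLin (Matrix.of ![a, b])) ≠ ⊥ :=
    LinearMap.ker_ne_bot_of_finrank_lt (by simp; omega)
  obtain ⟨φ, hφ, h0⟩ := Submodule.exists_mem_ne_zero_of_ne_bot h
  have h1 := congrFun hφ 0
  have h2 := congrFun hφ 1
  exact ⟨φ, h0, by rw [dotProduct_comm]; exact h1, by rw [dotProduct_comm]; exact h2⟩

theorem exists_transvec_mem_conjQuot_sq (hn : 3 ≤ n) {g : GL (Fin n) F}
    (hg : g ∉ Subgroup.center (GL (Fin n) F)) :
    ∃ (v φ : Fin n → F) (h : φ ⬝ᵥ v = 0), v ≠ 0 ∧ φ ≠ 0 ∧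
      transvec v φ h ∈ conjQuot (SLsub n F) g ^ 2 := by
  obtain ⟨a, i, j, hij⟩ := exists_minor_ne_zero hg
  obtain ⟨φ, hφ, hφa, hφb⟩ := exists_ne_zero_dotProduct_pair_eq_zero hn a (g.val *ᵥ a)
  generalize hb : g.val *ᵥ a = b at *
  set m := a i * b j - a j * b i with hm
  refine ⟨b, -φ, by simp [hφb], ?_, by simpa using hφ, ?_⟩
  · rintro rfl
    simp [hm] at hij
  subst hb
  refine transvec_mem_conjQuot_sq g a φ
    (m⁻¹ • (Pi.single i ((g.val *ᵥ a) j) - Pi.single j ((g.val *ᵥ a) i))) hφa hφb ?_ ?_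
  · rw [smul_dotProduct, sub_dotProduct, single_dotProduct, single_dotProduct, smul_eq_mul,
      inv_mul_eq_one₀ hij, hm]
    ring
  · rw [smul_dotProduct, sub_dotProduct, single_dotProduct, single_dotProduct, mul_comm, sub_self,
      smul_zero]

theorem exists_dual_pair {v φ : Fin n → F} (h : φ ⬝ᵥ v = 0) (hv : v ≠ 0) (hφ : φ ≠ 0) :
    ∃ w χ : Fin n → F, φ ⬝ᵥ w = 1 ∧ χ ⬝ᵥ v = 1 ∧ χ ⬝ᵥ w = 0 := by
  obtain ⟨i, hi⟩ := Function.ne_iff.1 hv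
  obtain ⟨j, hj⟩ := Function.ne_iff.1 hφ
  have hi : v i ≠ 0 := hi
  have hj : φ j ≠ 0 := hj
  set w : Fin n → F := Pi.single j (φ j)⁻¹
  set χ : Fin n → F := Pi.single i (v i)⁻¹
  have hw : φ ⬝ᵥ w = 1 := by simp [w, hj]
  refine ⟨w, χ - (χ ⬝ᵥ w) • φ, hw, ?_, ?_⟩
  · rw [sub_dotProduct, smul_dotProduct, h]
    simp [χ, hi]
  · rw [sub_dotProduct, smul_dotProduct, hw]
    simp

/-- In characteristic two a nontrivial transvection is a noncentral involution. -/
theorem exists_involution_of_transvec_of_two_eq_zero (h2 : (2 : F) = 0) {v φ : Fin n → F}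
    (h : φ ⬝ᵥ v = 0) (hv : v ≠ 0) (hφ : φ ≠ 0) :
    transvec v φ h ^ 2 = 1 ∧ ∃ s ∈ SLsub n F, transvec v φ h * s ≠ s * transvec v φ h := by
  constructor
  · refine Units.ext ?_
    change (1 + vecMulVec v φ) ^ 2 = 1
    have : vecMulVec v φ + vecMulVec v φ = 0 := by
      rw [← two_smul F, h2, zero_smul]
    simp [pow_two, mul_add, add_mul, vecMulVec_mul_vecMulVec, h, add_assoc, this]
  obtain ⟨w, χ, hφw, hχv, hχw⟩ := exists_dual_pair h hv hφ
  refine ⟨transvec w χ hχw, transvec_mem_SLsub _ _ _, fun H => ?_⟩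
  have H1 : (1 + vecMulVec v φ) * (1 + vecMulVec w χ) = (1 + vecMulVec w χ) * (1 + vecMulVec v φ) :=
    congrArg Units.val H
  have H2 := congrArg (fun M => χ ⬝ᵥ (M *ᵥ v)) H1
  simp [mul_add, add_mul, vecMulVec_mul_vecMulVec, add_mulVec, vecMulVec_mulVec, h, hφw, hχv,
    hχw] at H2

theorem exists_involution_of_transvec_of_two_ne_zero (hn : 3 ≤ n) (h2 : (2 : F) ≠ 0)
    {g : GL (Fin n) F} {v φ : Fin n → F} (h : φ ⬝ᵥ v = 0) (hv : v ≠ 0) (hφ : φ ≠ 0)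
    (hmem : transvec v φ h ∈ conjQuot (SLsub n F) g ^ 2) :
    ∃ t ∈ conjQuot (SLsub n F) g ^ 6, t ^ 2 = 1 ∧ ∃ s ∈ SLsub n F, t * s ≠ s * t := by
  obtain ⟨w, χ, hφw, hχv, hχw⟩ := exists_dual_pair h hv hφ
  obtain ⟨e, he0, hφe, hχe⟩ := exists_ne_zero_dotProduct_pair_eq_zero hn φ χ
  rw [dotProduct_comm] at hφe hχe
  have hconj : ∀ {v φ w ψ : Fin n → F} (h : φ ⬝ᵥ v = 0) (h' : ψ ⬝ᵥ w = 0),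
      transvec v φ h ∈ conjQuot (SLsub n F) g ^ 2 →
      transvec (v + (ψ ⬝ᵥ v) • w) (φ - (φ ⬝ᵥ w) • ψ)
        (by simp [h, h', sub_dotProduct, dotProduct_add]; ring) ∈ conjQuot (SLsub n F) g ^ 2 := by
    intro v φ w ψ h h' hm
    rw [← transvec_conj_transvec v φ w ψ h h']
    exact conj_mem_conjQuot_pow (transvec_mem_SLsub _ _ _) hm
  have m3 : transvec (v + (2 : F) • w) (φ - (2 : F) • χ)
      (by simp [h, hφw, hχv, hχw, sub_dotProduct, dotProduct_add]) ∈
        conjQuot (SLsub n F) g ^ 2 := by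
    convert hconj (w := w) (ψ := (2 : F) • χ) h (by simp [hχw]) hmem using 2 <;>
      simp [hφw, hχv]
  have m2 : transvec ((2 : F) • w) (-((2 : F) • χ)) (by simp [hχw]) ∈
        conjQuot (SLsub n F) g ^ 2 := by
    convert hconj (w := v) (ψ := -((2 : F)⁻¹ • φ)) _ (by simp [h]) m3 using 2 <;>
      simp [hφw, hχv, h, h2, sub_dotProduct]
  obtain ⟨t, ht, htval⟩ : ∃ t ∈ conjQuot (SLsub n F) g ^ 6,
      t.val = 1 - (2 : F) • (vecMulVec v χ + vecMulVec w φ) := by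
    have hm := Set.mul_mem_mul (Set.mul_mem_mul hmem m2) m3
    rw [← pow_add, ← pow_add] at hm
    refine ⟨_, hm, ?_⟩
    change (1 + vecMulVec _ _) * (1 + vecMulVec _ _) * (1 + vecMulVec _ _) = _
    simp only [mul_add, add_mul, mul_sub, mul_neg, neg_mul, one_mul, mul_one,
      Matrix.smul_mul, Matrix.mul_smul, vecMulVec_mul_vecMulVec, add_vecMulVec, vecMulVec_sub,
      vecMulVec_neg, vecMulVec_smul, smul_vecMulVec, h, hφw, hχv, hχw]
    module
  have htv : t.val *ᵥ v = -v := by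
    rw [htval]
    simp [sub_mulVec, add_mulVec, smul_mulVec, vecMulVec_mulVec, h, hχv]
    module
  have hte : t.val *ᵥ e = e := by
    rw [htval]
    simp [sub_mulVec, add_mulVec, smul_mulVec, vecMulVec_mulVec, hφe, hχe]
  refine ⟨t, ht, Units.ext ?_, transvec e χ hχe, transvec_mem_SLsub _ _ _, fun H => he0 ?_⟩
  · rw [Units.val_pow_eq_pow_val, htval, Units.val_one, pow_two]
    simp only [mul_add, sub_mul, mul_sub, add_mul, one_mul, mul_one, vecMulVec_mul_vecMulVec,
      Matrix.smul_mul, Matrix.mul_smul, h, hφw, hχv, hχw, one_smul, zero_smul, vecMulVec_zero]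
    module
  · have H1 : t.val * (1 + vecMulVec e χ) = (1 + vecMulVec e χ) * t.val := congrArg Units.val H
    have H2 := congrArg (fun M => M *ᵥ v) H1
    simp only [← mulVec_mulVec, htv, add_mulVec, one_mulVec, vecMulVec_mulVec, hχv, mulVec_add,
      dotProduct_neg, MulOpposite.op_one, MulOpposite.op_neg, one_smul, neg_smul, hte] at H2
    have H3 : (2 : F) • e = 0 := by
      rw [two_smul]
      exact eq_neg_iff_add_eq_zero.1 (add_left_cancel H2)
    exact (smul_eq_zero.1 H3).resolve_left h2

theorem exists_noncentral_involution (hn : 3 ≤ n) {g : GL (Fin n) F}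
    (hg : g ∉ Subgroup.center (GL (Fin n) F)) :
    ∃ t ∈ conjQuot (SLsub n F) g ^ 6, t ^ 2 = 1 ∧ ∃ s ∈ SLsub n F, t * s ≠ s * t := by
  obtain ⟨v, φ, h, hv, hφ, hmem⟩ := exists_transvec_mem_conjQuot_sq hn hg
  by_cases h2 : (2 : F) = 0
  · exact ⟨_, conjQuot_pow_subset (by norm_num) hmem,
      exists_involution_of_transvec_of_two_eq_zero h2 h hv hφ⟩
  · exact exists_involution_of_transvec_of_two_ne_zero hn h2 h hv hφ hmem

end GeneralRank

section RankTwo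

variable {F : Type*} [Field F]

theorem exists_conj_companion {g : GL (Fin 2) F} (hg : g ∉ Subgroup.center (GL (Fin 2) F)) :
    ∃ (p h : GL (Fin 2) F) (δ τ : F), δ ≠ 0 ∧ h.val = !![0, -δ; 1, τ] ∧ g = p * h * p⁻¹ := by
  obtain ⟨v, hv⟩ : ∃ v : Fin 2 → F, v 0 * (g.val *ᵥ v) 1 - v 1 * (g.val *ᵥ v) 0 ≠ 0 := by
    obtain ⟨v, i, j, hij⟩ := exists_minor_ne_zero hg
    refine ⟨v, fun h0 => hij ?_⟩
    fin_cases i <;> fin_cases j <;> simp only [Fin.zero_eta, Fin.mk_one, Fin.isValue, sub_self]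
    · exact h0
    · linear_combination -h0
  have hδ : g.val.det ≠ 0 := g.det_ne_zero
  set P : Matrix (Fin 2) (Fin 2) F :=
    !![v 0, (g.val *ᵥ v) 0; v 1, (g.val *ᵥ v) 1] with hP
  have hPdet : P.det ≠ 0 := by
    rw [hP, det_fin_two_of]
    convert hv using 1
    ring
  refine ⟨GeneralLinearGroup.mkOfDetNeZero P hPdet,
    GeneralLinearGroup.mkOfDetNeZero !![0, -g.val.det; 1, g.val.trace] (by simpa using hδ),
    g.val.det, g.val.trace, hδ, rfl, ?_⟩
  rw [eq_mul_inv_iff_mul_eq]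
  refine Units.ext ?_
  change g.val * P = P * !![0, -g.val.det; 1, g.val.trace]
  rw [hP, det_fin_two, trace_fin_two, eta_fin_two g.val]
  ext i j
  fin_cases i <;> fin_cases j <;> simp [mul_apply, Fin.sum_univ_two, mulVec, dotProduct] <;> ring

/-- The upper unitriangular matrix with corner `z`. -/
def upperUni (z : F) : GL (Fin 2) F :=
  GeneralLinearGroup.mkOfDetNeZero !![1, z; 0, 1] (by simp)

/-- The lower unitriangular matrix with corner `z`. -/
def lowerUni (z : F) : GL (Fin 2) F :=
  GeneralLinearGroup.mkOfDetNeZero !![1, 0; z, 1] (by simp)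

theorem upperUni_val (z : F) : (upperUni z).val = !![1, z; 0, 1] := rfl

theorem lowerUni_val (z : F) : (lowerUni z).val = !![1, 0; z, 1] := rfl

theorem upperUni_mem_SLsub (z : F) : upperUni z ∈ SLsub 2 F :=
  mem_SLsub.2 (by simp [upperUni_val])

theorem upperUni_mul_lowerUni_mem_conjQuot {h : GL (Fin 2) F} {δ τ : F} (hδ : δ ≠ 0)
    (hh : h.val = !![0, -δ; 1, τ]) (z : F) :
    upperUni z * lowerUni (z / δ) ∈ conjQuot (SLsub 2 F) h := by
  have : upperUni z * lowerUni (z / δ) = upperUni z * h * (upperUni z)⁻¹ * h⁻¹ := by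
    rw [eq_mul_inv_iff_mul_eq, eq_mul_inv_iff_mul_eq]
    simp only [mul_assoc]
    congr 1
    refine Units.ext ?_
    simp only [Units.val_mul, hh, upperUni_val, lowerUni_val]
    ext i j
    fin_cases i <;> fin_cases j <;> simp [mul_apply, Fin.sum_univ_two]; field_simp
    ring
  rw [this]
  exact commutator_mem_conjQuot (upperUni_mem_SLsub z)

theorem lowerUni_mul_upperUni_mem_conjQuot {h : GL (Fin 2) F} {δ τ : F} (hδ : δ ≠ 0)
    (hh : h.val = !![0, -δ; 1, τ]) (y : F) {c : F} (hc : c ≠ 0) :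
    lowerUni (y / (c ^ 2 * δ)) * upperUni (c ^ 2 * y) ∈ conjQuot (SLsub 2 F) h := by
  let d : GL (Fin 2) F := GeneralLinearGroup.mkOfDetNeZero !![c, 0; 0, c⁻¹] (by simp [hc])
  have hd : d ∈ SLsub 2 F := mem_SLsub.2 (by
    change det !![c, 0; 0, c⁻¹] = 1
    simp [hc])
  have hLU : lowerUni (y / δ) * upperUni y ∈ conjQuot (SLsub 2 F) h := by
    simpa using conj_mem_conjQuot (inv_mem (upperUni_mem_SLsub y))
      (upperUni_mul_lowerUni_mem_conjQuot hδ hh y)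
  have key : lowerUni (y / (c ^ 2 * δ)) * upperUni (c ^ 2 * y) =
      d * (lowerUni (y / δ) * upperUni y) * d⁻¹ := by
    rw [eq_mul_inv_iff_mul_eq]
    refine Units.ext ?_
    simp only [Units.val_mul, upperUni_val, lowerUni_val]
    change _ * !![c, 0; 0, c⁻¹] = !![c, 0; 0, c⁻¹] * _
    ext i j
    fin_cases i <;> fin_cases j <;> simp [mul_apply, Fin.sum_univ_two] <;> field_simp
  rw [key]
  exact conj_mem_conjQuot hd hLU

theorem two_ne_zero_and_exists_of_pow_four_eq_one [Fintype F] (hF : Fintype.card F ≠ 2)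
    (H : ∀ c : F, c ≠ 0 → c ^ 4 = 1) {δ : F} (hδ : δ ≠ 0) :
    (2 : F) ≠ 0 ∧ ∃ x y : F, 2 * δ ^ 2 + (x + y) ^ 2 * δ + (x * y) ^ 2 = 0 := by
  have h2 : (2 : F) ≠ 0 := by
    intro h2
    apply hF
    have h1 : ∀ c : F, c = 0 ∨ c = 1 := by
      intro c
      by_cases hc : c = 0
      · exact Or.inl hc
      · right
        have : (c - 1) ^ 4 = 0 := by
          linear_combination H c hc + (-2 * c ^ 3 + 3 * c ^ 2 - 2 * c + 1) * h2
        exact sub_eq_zero.1 (pow_eq_zero_iff (by norm_num) |>.1 this)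
    classical
    have : (Finset.univ : Finset F) = {0, 1} := by
      ext c
      simpa using h1 c
    rw [← Finset.card_univ, this, Finset.card_pair zero_ne_one]
  refine ⟨h2, ?_⟩
  have h15 : (3 : F) * 5 = 0 := by linear_combination H 2 h2
  have hδ4 : (δ - 1) * ((δ + 1) * (δ ^ 2 + 1)) = 0 := by linear_combination H δ hδ
  rcases mul_eq_zero.1 h15 with h3 | h5
  · rcases mul_eq_zero.1 hδ4 with h | h
    · exact ⟨1, 0, by rw [sub_eq_zero.1 h]; linear_combination h3⟩
    rcases mul_eq_zero.1 h with h | h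
    · exact ⟨1, -1, by rw [eq_neg_of_add_eq_zero_left h]; linear_combination h3⟩
    · exfalso
      have h1 : δ + 1 ≠ 0 := by
        intro h1
        apply h2
        linear_combination h - (δ - 1) * h1
      apply h2
      linear_combination -H _ h1 + (δ ^ 2 + 4 * δ + 5) * h - h3
  · rcases mul_eq_zero.1 hδ4 with h | h
    · exact ⟨1, 2, by rw [sub_eq_zero.1 h]; linear_combination 3 * h5⟩
    rcases mul_eq_zero.1 h with h | h
    · exact ⟨2, -1, by rw [eq_neg_of_add_eq_zero_left h]; linear_combination h5⟩
    have h' : (δ - 2) * (δ + 2) = 0 := by linear_combination h - h5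
    rcases mul_eq_zero.1 h' with h | h
    · exact ⟨1, 0, by rw [sub_eq_zero.1 h]; linear_combination 2 * h5⟩
    · exact ⟨2, 0, by rw [eq_neg_of_add_eq_zero_left h]; ring⟩

/-- For a noncentral `g` in `GL_2(F)`, the square of `C * C⁻¹` contains a nontrivial
element of trace zero. -/
theorem exists_trace_eq_zero_mem_conjQuot_sq [Fintype F] (hF : Fintype.card F ≠ 2)
    {g : GL (Fin 2) F} (hg : g ∉ Subgroup.center (GL (Fin 2) F)) :
    ∃ w ∈ conjQuot (SLsub 2 F) g ^ 2, w.val.trace = 0 ∧ w ≠ 1 := by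
  obtain ⟨p, h, δ, τ, hδ, hh, rfl⟩ := exists_conj_companion hg
  suffices ∃ w ∈ conjQuot (SLsub 2 F) h ^ 2, w.val.trace = 0 ∧ w ≠ 1 by
    obtain ⟨w, hw, hw0, hw1⟩ := this
    refine ⟨p * w * p⁻¹, ?_, ?_, fun hp => hw1 (conj_eq_one_iff.1 hp)⟩
    · rw [pow_two] at hw ⊢
      obtain ⟨a, ha, b, hb, rfl⟩ := hw
      exact ⟨_, conj_mem_conjQuot_conj p ha, _, conj_mem_conjQuot_conj p hb, by group⟩
    · rw [← hw0]
      exact trace_units_conj p w.val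
  by_cases H : ∀ c : F, c ≠ 0 → c ^ 4 = 1
  · obtain ⟨h2, x, y, hxy⟩ := two_ne_zero_and_exists_of_pow_four_eq_one hF H hδ
    have hw := Set.mul_mem_mul (upperUni_mul_lowerUni_mem_conjQuot hδ hh x)
      (upperUni_mul_lowerUni_mem_conjQuot hδ hh y)
    rw [← pow_two] at hw
    have htr : (upperUni x * lowerUni (x / δ) * (upperUni y * lowerUni (y / δ))).val.trace = 0 := by
      simp only [Units.val_mul, upperUni_val, lowerUni_val]
      simp [trace_fin_two]
      field_simp
      linear_combination hxy
    refine ⟨_, hw, htr, fun h1 => h2 ?_⟩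
    rw [h1] at htr
    simpa using htr
  · push Not at H
    obtain ⟨c, hc, hc4⟩ := H
    have hc4' : c ^ 4 - 1 ≠ 0 := sub_ne_zero.2 hc4
    obtain ⟨y, hy⟩ : ∃ y, y = (1 + 2 * δ) * c ^ 2 / (c ^ 4 - 1) := ⟨_, rfl⟩
    have hw := Set.mul_mem_mul (upperUni_mul_lowerUni_mem_conjQuot hδ hh (1 - c ^ 2 * y))
      (lowerUni_mul_upperUni_mem_conjQuot hδ hh y hc)
    rw [← pow_two] at hw
    refine ⟨_, hw, ?_⟩
    generalize hwval : upperUni (1 - c ^ 2 * y) * lowerUni ((1 - c ^ 2 * y) / δ) *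
      (lowerUni (y / (c ^ 2 * δ)) * upperUni (c ^ 2 * y)) = w
    replace hwval := congrArg Units.val hwval.symm
    simp only [Units.val_mul, upperUni_val, lowerUni_val] at hwval
    have hr : (1 - c ^ 2 * y) / δ + y / (c ^ 2 * δ) = -2 := by
      rw [hy]
      field_simp
      ring
    have hval : w.val = !![1, 1 - c ^ 2 * y; 0, 1] * !![1, 0; -2, 1] * !![1, c ^ 2 * y; 0, 1] := by
      rw [hwval, ← hr]
      ext i j
      fin_cases i <;> fin_cases j <;> simp [mul_apply, Fin.sum_univ_two] <;> ring
    refine ⟨?_, ?_⟩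
    · rw [hval]
      simp [trace_fin_two]
      ring
    · intro h1
      rw [h1] at hval
      have h10 := congrFun₂ hval 1 0
      have h01 := congrFun₂ hval 0 1
      simp at h10 h01
      exact one_ne_zero (α := F)
        (by linear_combination -h01 + (1 - c ^ 2 * y) * (c ^ 2 * y) * h10)

theorem sq_val_eq_neg_one {w : GL (Fin 2) F} (hdet : w.val.det = 1) (htr : w.val.trace = 0) :
    (w ^ 2).val = -1 := by
  rw [det_fin_two] at hdet
  rw [trace_fin_two] at htr
  rw [Units.val_pow_eq_pow_val, pow_two]
  ext i j
  fin_cases i <;> fin_cases j <;> simp [mul_apply, Fin.sum_univ_two]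
  · linear_combination w.val 0 0 * htr - hdet
  · linear_combination w.val 0 1 * htr
  · linear_combination w.val 1 0 * htr
  · linear_combination w.val 1 1 * htr - hdet

theorem exists_involution_rank_two [Fintype F] (hF : Fintype.card F ≠ 2)
    {g : GL (Fin 2) F} (hg : g ∉ Subgroup.center (GL (Fin 2) F)) :
    ∃ t ∈ conjQuot (SLsub 2 F) g ^ 6, t ^ 2 = 1 ∧ t ≠ 1 := by
  obtain ⟨w, hw, htr, hw1⟩ := exists_trace_eq_zero_mem_conjQuot_sq hF hg
  have hsq := sq_val_eq_neg_one (mem_SLsub.1 (conjQuot_pow_subset_SLsub hw)) htr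
  by_cases h2 : (2 : F) = 0
  · have : CharP F 2 := CharTwo.of_one_ne_zero_of_two_eq_zero one_ne_zero h2
    refine ⟨w, conjQuot_pow_subset (by norm_num) hw, Units.ext (hsq.trans ?_), hw1⟩
    rw [← one_smul F (1 : Matrix (Fin 2) (Fin 2) F), ← neg_smul, CharTwo.neg_eq, one_smul]
    rfl
  · refine ⟨w ^ 2, conjQuot_pow_subset (show 4 ≤ 6 by norm_num) ?_, Units.ext ?_, fun h1 => h2 ?_⟩
    · rw [pow_two, show 4 = 2 + 2 from rfl, pow_add]
      exact Set.mul_mem_mul hw hw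
    · rw [Units.val_pow_eq_pow_val, hsq]
      simp
    · rw [h1] at hsq
      have := congrFun₂ hsq 0 0
      simp at this
      linear_combination this

end RankTwo

theorem exists_involution_mem_conjQuot_pow_six {F : Type*} [Field F] [Fintype F] {n : ℕ}
    (hn : 2 ≤ n) (hnq : ¬(n = 2 ∧ Fintype.card F = 2)) {g : GL (Fin n) F}
    (hg : g ∉ Subgroup.center (GL (Fin n) F)) :
    ∃ t ∈ conjQuot (SLsub n F) g ^ 6, t ^ 2 = 1 ∧ t ≠ 1 ∧
      (n ≠ 2 → ∃ s ∈ SLsub n F, t * s ≠ s * t) := by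
  rcases hn.eq_or_lt with rfl | hn3
  · obtain ⟨t, ht, ht2, ht1⟩ := exists_involution_rank_two (fun h => hnq ⟨rfl, h⟩) hg
    exact ⟨t, ht, ht2, ht1, fun h => (h rfl).elim⟩
  · obtain ⟨t, ht, ht2, s, hs, hst⟩ := exists_noncentral_involution hn3 hg
    exact ⟨t, ht, ht2, fun h1 => hst (by simp [h1]), fun _ => ⟨s, hs, hst⟩⟩

end Involutions

theorem stmt_0 {F : Type*} [Field F] [Fintype F] {q n : ℕ} (hq : Fintype.card F = q)
    (hn : 2 ≤ n) (hnq : ¬(n = 2 ∧ q = 2))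
    (g : GL (Fin n) F) (hg : g ∉ Subgroup.center (GL (Fin n) F)) :
    ∃ t : GL (Fin n) F, t ∈ SLsub n F ∧ t ^ 2 = 1 ∧ t ≠ 1 ∧
      (n ≠ 2 → ∃ s ∈ SLsub n F, t * s ≠ s * t) ∧
      ∃ x y : Fin 6 → GL (Fin n) F,
        (∀ i, x i ∈ conjClassBy (SLsub n F) g) ∧
        (∀ i, y i ∈ (conjClassBy (SLsub n F) g)⁻¹) ∧
        x 0 * y 0 * (x 1 * y 1) * (x 2 * y 2) * (x 3 * y 3) * (x 4 * y 4) * (x 5 * y 5) = t := by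
  subst hq
  obtain ⟨t, ht, ht2, ht1, htc⟩ := exists_involution_mem_conjQuot_pow_six hn hnq hg
  exact ⟨t, conjQuot_pow_subset_SLsub ht, ht2, ht1, htc,
    exists_prod_eq_of_mem_conjQuot_pow_six ht⟩
end

section
/- Let F be a finite field with |F| = q², let σ : F → F be the field automorphism x ↦ x^q, and for an n×n matrix A over F let σ(A) denote the entrywise application of σ. Define GU_n(q) = {A ∈ GL_n(F) : A · σ(A)ᵀ = I} and SU_n(q) = GU_n(q) ∩ SL_n(F). Let n ≥ 2 with (n,q) ≠ (2,2) and (n,q) ≠ (3,2), let G = GU_n(q), S = SU_n(q), let g ∈ G \ Z(G) and set C = g^S. Then there exists t ∈ S with t² = 1 and t ≠ 1, with moreover t ∉ Z(S) whenever n ≠ 2, and there exist elements x₁,…,x₆ ∈ C and y₁,…,y₆ ∈ C⁻¹ such that x₁y₁x₂y₂x₃y₃x₄y₄x₅y₅x₆y₆ = t. -/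
/-- Membership in the general unitary group `GU_n(q)`: an invertible matrix `A` over the field
`F` (of order `q²`) with `A ⬝ σ(A)ᵀ = 1`, where `σ` is the entrywise map `x ↦ x^q`. -/
def memGU (n q : ℕ) {F : Type*} [Field F] (A : GL (Fin n) F) : Prop :=
  (A : Matrix (Fin n) (Fin n) F) * ((A : Matrix (Fin n) (Fin n) F).map (· ^ q)).transpose = 1

/-- Membership in the special unitary group `SU_n(q) = GU_n(q) ∩ SL_n(F)`. -/
def memSU (n q : ℕ) {F : Type*} [Field F] (A : GL (Fin n) F) : Prop :=
  memGU n q A ∧ (A : Matrix (Fin n) (Fin n) F).det = 1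

namespace UnitaryInvolution

open Matrix

section Group

variable {G : Type*} [Group G]

/-- The set `C C⁻¹`, where `C` is the orbit of `g` under conjugation by the subgroup `S`. -/
def commSet (S : Subgroup G) (g : G) : Set G :=
  {d | ∃ a ∈ S, ∃ b ∈ S, d = a * g * a⁻¹ * (b * g * b⁻¹)⁻¹}

theorem one_mem_commSet (S : Subgroup G) (g : G) : 1 ∈ commSet S g :=
  ⟨1, S.one_mem, 1, S.one_mem, by group⟩

theorem commSet_inv {S : Subgroup G} {g d : G} (hd : d ∈ commSet S g) : d⁻¹ ∈ commSet S g := by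
  obtain ⟨a, ha, b, hb, rfl⟩ := hd
  exact ⟨b, hb, a, ha, by group⟩

theorem commSet_conj {S : Subgroup G} {g d h : G} (hd : d ∈ commSet S g) (hh : h ∈ S) :
    h * d * h⁻¹ ∈ commSet S g := by
  obtain ⟨a, ha, b, hb, rfl⟩ := hd
  exact ⟨h * a, S.mul_mem hh ha, h * b, S.mul_mem hh hb, by group⟩

theorem commutator_mem_commSet {S : Subgroup G} {g s : G} (hs : s ∈ S) :
    g * s * g⁻¹ * s⁻¹ ∈ commSet S g :=
  ⟨1, S.one_mem, s, hs, by group⟩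

/-- Conjugation in the braid group of type `A₃`. -/
theorem conj_mul_of_braid {a b d : G} (hab : a * b * a = b * a * b)
    (hbd : b * d * b = d * b * d) (had : a * d = d * a) :
    (a * b * d) * (a * b) * (a * b * d)⁻¹ = b * d := by
  rw [mul_inv_eq_iff_eq_mul]
  calc a * b * d * (a * b) = a * b * (d * a) * b := by group
    _ = a * b * a * (d * b) := by rw [← had]; group
    _ = b * a * (b * d * b) := by rw [hab]; group
    _ = b * (a * d) * (b * d) := by rw [hbd]; group
    _ = b * d * (a * b * d) := by rw [had]; group

end Group

section FiniteField

variable {F : Type*} [Field F] [Fintype F] {q : ℕ}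

theorem two_le_of_card (hq : Fintype.card F = q ^ 2) : 2 ≤ q := by
  have h := Fintype.one_lt_card (α := F)
  by_contra! hlt
  interval_cases q <;> omega

theorem add_pow_of_card (hq : Fintype.card F = q ^ 2) (x y : F) :
    (x + y) ^ q = x ^ q + y ^ q := by
  obtain ⟨m, hp, hm⟩ := FiniteField.card F (ringChar F)
  have : Fact (ringChar F).Prime := ⟨hp⟩
  obtain ⟨k, -, hk⟩ := (Nat.dvd_prime_pow hp).1
    (show q ∣ ringChar F ^ (m : ℕ) from hm ▸ hq ▸ dvd_pow_self q two_ne_zero)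
  rw [hk, add_pow_char_pow]

/-- The star ring structure `x ↦ x ^ q` on a field of order `q ^ 2`. -/
abbrev powStarRing (hq : Fintype.card F = q ^ 2) : StarRing F where
  star x := x ^ q
  star_involutive x := by
    change (x ^ q) ^ q = x
    rw [← pow_mul, ← pow_two, ← hq, FiniteField.pow_card]
  star_mul x y := by
    change (x * y) ^ q = y ^ q * x ^ q
    rw [mul_pow, mul_comm]
  star_add := add_pow_of_card hq

theorem exists_generator (hq : Fintype.card F = q ^ 2) :
    ∃ γ : F, γ ≠ 0 ∧ (∀ y : F, y ≠ 0 → ∃ j : ℕ, γ ^ j = y) ∧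
      ∀ j : ℕ, γ ^ j = 1 → (q + 1) * (q - 1) ∣ j := by
  classical
  obtain ⟨γ, hγ⟩ := IsCyclic.exists_generator (α := Fˣ)
  refine ⟨γ, γ.ne_zero, fun y hy => ?_, fun j hj => ?_⟩
  · obtain ⟨j, hj⟩ := (mem_powers_iff_mem_zpowers (x := γ)).2 (hγ (Units.mk0 y hy))
    exact ⟨j, by simpa using congrArg Units.val hj⟩
  · have h := orderOf_dvd_of_pow_eq_one (x := γ) (n := j) (Units.ext (by simpa using hj))
    rwa [orderOf_eq_card_of_forall_mem_zpowers hγ, Nat.card_eq_fintype_card,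
      Fintype.card_units, hq, ← one_pow 2, Nat.sq_sub_sq] at h

section Star

variable [StarRing F]

theorem pow_sub_one_of_star_eq (hq : Fintype.card F = q ^ 2) (hs : ∀ x : F, star x = x ^ q)
    {y : F} (hy : y ≠ 0) (hy' : star y = y) : y ^ (q - 1) = 1 := by
  have h2 := two_le_of_card hq
  apply mul_right_cancel₀ hy
  rw [← pow_succ, Nat.sub_add_cancel (by omega), ← hs, hy', one_mul]

theorem exists_mul_star_eq (hq : Fintype.card F = q ^ 2) (hs : ∀ x : F, star x = x ^ q)
    {y : F} (hy : y ≠ 0) (hy' : star y = y) : ∃ x : F, x * star x = y := by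
  have h2 := two_le_of_card hq
  obtain ⟨γ, -, hγ, hγ'⟩ := exists_generator hq
  obtain ⟨j, rfl⟩ := hγ y hy
  have h := pow_sub_one_of_star_eq hq hs hy hy'
  rw [← pow_mul] at h
  obtain ⟨k, rfl⟩ := Nat.dvd_of_mul_dvd_mul_right (by omega) (hγ' _ h)
  exact ⟨γ ^ k, by rw [hs]; ring⟩

theorem exists_three_mul_star_eq_neg_one (hq : Fintype.card F = q ^ 2)
    (hs : ∀ x : F, star x = x ^ q) :
    ∃ a b c : F, a ≠ b ∧ a ≠ c ∧ b ≠ c ∧ a * star a = -1 ∧ b * star b = -1 ∧ c * star c = -1 := by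
  have h2 := two_le_of_card hq
  obtain ⟨a, ha⟩ := exists_mul_star_eq hq hs (y := -1) (by simp) (by simp)
  have ha0 : a ≠ 0 := by rintro rfl; simp at ha
  obtain ⟨γ, hγ0, -, hγ⟩ := exists_generator hq
  set ζ := γ ^ (q - 1) with hζ
  have hζ0 : ζ ≠ 0 := pow_ne_zero _ hγ0
  have hζs : ζ * star ζ = 1 := by
    have h := FiniteField.pow_card_sub_one_eq_one γ hγ0
    rw [hq, ← one_pow 2, Nat.sq_sub_sq] at h
    rw [hs, hζ, ← h]; ring
  have hζ2 : ζ ^ 2 ≠ 1 := fun h => by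
    rw [hζ, ← pow_mul, mul_comm] at h
    have := Nat.le_of_dvd (by omega) (Nat.dvd_of_mul_dvd_mul_right (by omega) (hγ _ h))
    omega
  have hζ1 : ζ ≠ 1 := fun h => hζ2 (by rw [h, one_pow])
  refine ⟨a, a * ζ, a * ζ ^ 2, fun h => hζ1 ?_, fun h => hζ2 ?_, fun h => hζ1 ?_, ha, ?_, ?_⟩
  · exact (mul_left_cancel₀ ha0 (by rw [mul_one, ← h])).symm
  · exact (mul_left_cancel₀ ha0 (by rw [mul_one, ← h])).symm
  · exact (mul_left_cancel₀ (mul_ne_zero ha0 hζ0) (by linear_combination h)).symm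
  · rw [star_mul']; linear_combination ha + a * star a * hζs
  · rw [star_mul', star_pow]; linear_combination ha + a * star a * (ζ * star ζ + 1) * hζs

theorem exists_star_eq_neg (hq : Fintype.card F = q ^ 2) (hs : ∀ x : F, star x = x ^ q) :
    ∃ c : F, c ≠ 0 ∧ star c = -c := by
  have h2 := two_le_of_card hq
  obtain ⟨γ, hγ0, -, hγ⟩ := exists_generator hq
  refine ⟨star γ - γ, fun h => ?_, by simp⟩
  have h1 := hγ _ (pow_sub_one_of_star_eq hq hs hγ0 (sub_eq_zero.1 h))
  have h3 := Nat.le_of_dvd (by omega) h1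
  nlinarith [Nat.sub_pos_of_lt h2]

theorem exists_pow_four_ne_one (hq : Fintype.card F = q ^ 2) (hs : ∀ x : F, star x = x ^ q)
    (hq2 : q ≠ 2) (hq3 : q ≠ 3) (hq5 : q ≠ 5) :
    ∃ s : F, s ≠ 0 ∧ star s = s ∧ s ^ 4 ≠ 1 := by
  have h2 := two_le_of_card hq
  obtain ⟨γ, hγ0, -, hγ⟩ := exists_generator hq
  refine ⟨γ * star γ, mul_ne_zero hγ0 (star_ne_zero.2 hγ0), by simp [mul_comm], fun h => ?_⟩
  have h1 := hγ ((q + 1) * 4) (by rw [← h, hs]; ring)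
  have h4 := Nat.dvd_of_mul_dvd_mul_left (by omega) h1
  have h5 := Nat.le_of_dvd (by omega) h4
  obtain ⟨r, rfl⟩ := Nat.exists_eq_add_of_le' h2
  have : r ≤ 3 := by omega
  interval_cases r <;> simp_all

theorem exists_mul_sq_eq (hq : Fintype.card F = q ^ 2) (hs : ∀ x : F, star x = x ^ q)
    (hq35 : q = 3 ∨ q = 5) {N : F} (hN : N ≠ 0) (hN' : star N = N) :
    ∃ c : F, star c = -c ∧ (N * c ^ 2 = 1 ∨ N * c ^ 2 = 2) := by
  obtain ⟨c, hc0, hc⟩ := exists_star_eq_neg hq hs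
  have hz := pow_sub_one_of_star_eq hq hs (mul_ne_zero hN (pow_ne_zero 2 hc0))
    (by simp [hN', hc])
  have hcard := FiniteField.cast_card_eq_zero F
  rw [hq, Nat.cast_pow, sq_eq_zero_iff] at hcard
  rcases hq35 with rfl | rfl
  · refine ⟨c, hc, (sq_eq_sq_iff_eq_or_eq_neg.1 (hz.trans (one_pow 2).symm)).imp_right fun h => ?_⟩
    push_cast at hcard
    rw [h]
    linear_combination -hcard
  · push_cast at hcard
    generalize hzz : N * c ^ 2 = z at hz
    have h4 : (z - 1) * (z - 2) * ((z - 3) * (z - 4)) = 0 := by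
      simp at hz
      linear_combination hz + (-2 * z ^ 3 + 7 * z ^ 2 - 10 * z + 5) * hcard
    have hc' : star (2 * c) = -(2 * c) := by simp [hc]
    rcases mul_eq_zero.1 h4 with h | h <;> rcases mul_eq_zero.1 h with h | h
    · exact ⟨c, hc, .inl (by linear_combination hzz + h)⟩
    · exact ⟨c, hc, .inr (by linear_combination hzz + h)⟩
    · exact ⟨2 * c, hc', .inr (by linear_combination 4 * hzz + 4 * h + 2 * hcard)⟩
    · exact ⟨2 * c, hc', .inl (by linear_combination 4 * hzz + 4 * h + 3 * hcard)⟩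

end Star

end FiniteField

section Matrices

variable {F : Type*} [Field F] [StarRing F] {n : Type*} [Fintype n] [DecidableEq n]

variable (F n) in
/-- The special unitary group of the standard hermitian form, as a subgroup of `GL n F`. -/
def suSubgroup : Subgroup (GL n F) where
  carrier := {A | (A : Matrix n n F) * (A : Matrix n n F)ᴴ = 1 ∧ (A : Matrix n n F).det = 1}
  one_mem' := by simp
  mul_mem' := by
    rintro a b ⟨ha, ha'⟩ ⟨hb, hb'⟩
    refine ⟨?_, by simp [ha', hb']⟩
    rw [Units.val_mul, conjTranspose_mul]
    calc (a : Matrix n n F) * b * ((b : Matrix n n F)ᴴ * (a : Matrix n n F)ᴴ)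
        = a * ((b : Matrix n n F) * (b : Matrix n n F)ᴴ) * (a : Matrix n n F)ᴴ := by
          simp only [Matrix.mul_assoc]
      _ = 1 := by rw [hb, Matrix.mul_one, ha]
  inv_mem' := by
    rintro a ⟨ha, ha'⟩
    have h : ((a⁻¹ : GL n F) : Matrix n n F) = (a : Matrix n n F)ᴴ :=
      Units.inv_eq_of_mul_eq_one_right ha
    refine ⟨?_, ?_⟩
    · rw [h, conjTranspose_conjTranspose]
      exact mul_eq_one_comm.1 ha
    · rw [h, det_conjTranspose, ha', star_one]

theorem exists_isotropic {g : Matrix n n F} (hg : ∀ c : F, g ≠ c • 1) [Nonempty n]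
    (ha : ∃ a b c : F, a ≠ b ∧ a ≠ c ∧ b ≠ c ∧ a * star a = -1 ∧ b * star b = -1 ∧
      c * star c = -1) :
    ∃ v : n → F, star v ⬝ᵥ v = 0 ∧ star v ⬝ᵥ (g *ᵥ v) ≠ 0 := by
  by_contra! H
  obtain ⟨a, b, c, hab, hac, hbc, ha, hb, hc⟩ := ha
  have key : ∀ i j, i ≠ j → ∀ a : F, a * star a = -1 →
      (g i i - g j j) * a + a ^ 2 * g i j - g j i = 0 := by
    intro i j hij a ha
    have h1 := H (Pi.single i 1 + Pi.single j a) (by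
      rw [star_add, Pi.star_single, Pi.star_single]
      simp [dotProduct_add, hij, hij.symm, mul_comm, ha])
    rw [star_add, Pi.star_single, Pi.star_single] at h1
    simp [add_dotProduct, dotProduct_add, mulVec_add] at h1
    linear_combination a * h1 + (-g j i - a * g j j) * ha
  have key2 : ∀ i j, i ≠ j → g i j = 0 ∧ g i i = g j j := by
    intro i j hij
    have h1 := key i j hij a ha
    have h2 := key i j hij b hb
    have h3 := key i j hij c hc
    have h4 : (g i i - g j j) + (a + b) * g i j = 0 :=
      mul_left_cancel₀ (sub_ne_zero.2 hab) (by linear_combination h1 - h2)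
    have h5 : (g i i - g j j) + (a + c) * g i j = 0 :=
      mul_left_cancel₀ (sub_ne_zero.2 hac) (by linear_combination h1 - h3)
    have h6 : g i j = 0 :=
      mul_left_cancel₀ (sub_ne_zero.2 hbc) (by linear_combination h4 - h5)
    exact ⟨h6, by linear_combination h4 - (a + b) * h6⟩
  obtain ⟨i₀⟩ := ‹Nonempty n›
  refine hg (g i₀ i₀) ?_
  ext i j
  by_cases hij : i = j
  · subst hij
    by_cases h : i = i₀
    · simp [h]
    · simpa using (key2 i i₀ h).2
  · simpa [hij] using (key2 i j hij).1

omit [DecidableEq n] in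
theorem isotropic_rankOne_mul_self {v : n → F} (hv : star v ⬝ᵥ v = 0) :
    vecMulVec v (star v) * vecMulVec v (star v) = 0 := by
  rw [vecMulVec_mul_vecMulVec, hv, zero_smul, vecMulVec_zero]

/-- The unitary transvection `x ↦ x + c ⟨v, x⟩ v` for an isotropic vector `v`. -/
def transv (v : n → F) (hv : star v ⬝ᵥ v = 0) (c : F) : GL n F where
  val := 1 + c • vecMulVec v (star v)
  inv := 1 - c • vecMulVec v (star v)
  val_inv := by
    simp [mul_sub, add_mul, isotropic_rankOne_mul_self hv]
  inv_val := by
    simp [mul_add, sub_mul, isotropic_rankOne_mul_self hv]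

theorem transv_mem {v : n → F} (hv : star v ⬝ᵥ v = 0) {c : F} (hc : star c = -c) :
    transv v hv c ∈ suSubgroup F n := by
  constructor
  · simp [transv, conjTranspose_add, conjTranspose_smul, conjTranspose_vecMulVec, hc, mul_add,
      add_mul, isotropic_rankOne_mul_self hv]
  · change (1 + c • vecMulVec v (star v)).det = 1
    rw [← smul_vecMulVec, vecMulVec_eq Unit,
      det_one_add_replicateCol_mul_replicateRow]
    simp [hv]

theorem exists_not_commute {t : GL n F} (ht : ∀ c : F, (t : Matrix n n F) ≠ c • 1) [Nonempty n]
    (ha : ∃ a b c : F, a ≠ b ∧ a ≠ c ∧ b ≠ c ∧ a * star a = -1 ∧ b * star b = -1 ∧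
      c * star c = -1) (hc : ∃ c : F, c ≠ 0 ∧ star c = -c) :
    ∃ s ∈ suSubgroup F n, t * s ≠ s * t := by
  obtain ⟨v, hv, hv'⟩ := exists_isotropic ht ha
  obtain ⟨c, hc0, hc⟩ := hc
  refine ⟨transv v hv c, transv_mem hv hc, fun h => ?_⟩
  have h1 := congrArg (fun A : GL n F => (A : Matrix n n F) *ᵥ v) h
  simp [transv, mul_add, add_mul, ← mulVec_mulVec, add_mulVec, smul_mulVec, vecMulVec_mulVec, hv,
    hc0, hv'] at h1
  simp [h1] at hv'

variable (F) in
/-- The Gram matrix of a hyperbolic pair. -/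
def gram : Matrix (Fin 2) (Fin 2) F := !![0, 1; 1, 0]

/-- The action of `SL₂` on the plane spanned by the columns of `P`, which form a hyperbolic pair,
extended by the identity on the orthogonal complement. -/
def planeHom (P : Matrix n (Fin 2) F) (hP : gram F * Pᴴ * P = 1) :
    GL (Fin 2) F →* GL n F :=
  Units.map
    { toFun := fun M : Matrix (Fin 2) (Fin 2) F => 1 + P * (M - 1) * (gram F * Pᴴ)
      map_one' := by simp
      map_mul' := fun M N => by
        have h : P * (M - 1) * (gram F * Pᴴ) * (P * (N - 1) * (gram F * Pᴴ)) =
            P * ((M - 1) * (N - 1)) * (gram F * Pᴴ) := by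
          calc _ = P * (M - 1) * (gram F * Pᴴ * P) * (N - 1) * (gram F * Pᴴ) := by
                simp only [Matrix.mul_assoc]
            _ = _ := by rw [hP, Matrix.mul_one, Matrix.mul_assoc P]
        rw [mul_add, add_mul, add_mul, h]
        have h2 : M * N - 1 = (M - 1) + (N - 1) + (M - 1) * (N - 1) := by noncomm_ring
        rw [h2, Matrix.mul_add, Matrix.mul_add, Matrix.add_mul, Matrix.add_mul]
        simp only [one_mul, mul_one]
        abel }

theorem planeHom_apply (P : Matrix n (Fin 2) F) (hP : gram F * Pᴴ * P = 1)
    (M : GL (Fin 2) F) :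
    (planeHom P hP M : Matrix n n F) =
      1 + P * ((M : Matrix (Fin 2) (Fin 2) F) - 1) * (gram F * Pᴴ) :=
  rfl

theorem planeHom_mul_frame (P : Matrix n (Fin 2) F) (hP : gram F * Pᴴ * P = 1)
    (M : GL (Fin 2) F) :
    gram F * Pᴴ * (planeHom P hP M : Matrix n n F) * P = M := by
  rw [planeHom_apply, Matrix.mul_add, Matrix.add_mul, Matrix.mul_one, hP]
  calc 1 + gram F * Pᴴ * (P * ((M : Matrix (Fin 2) (Fin 2) F) - 1) * (gram F * Pᴴ)) * P
      = 1 + (gram F * Pᴴ * P) * ((M : Matrix (Fin 2) (Fin 2) F) - 1) * (gram F * Pᴴ * P) := by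
        simp only [Matrix.mul_assoc]
    _ = _ := by rw [hP]; simp

theorem planeHom_mem {P : Matrix n (Fin 2) F} {hP : gram F * Pᴴ * P = 1}
    {M : GL (Fin 2) F}
    (hM : (M : Matrix (Fin 2) (Fin 2) F) * gram F * (M : Matrix (Fin 2) (Fin 2) F)ᴴ = gram F)
    (hdet : (M : Matrix (Fin 2) (Fin 2) F).det = 1) :
    planeHom P hP M ∈ suSubgroup F n := by
  have hJ : (gram F)ᴴ = gram F := by
    ext i j; fin_cases i <;> fin_cases j <;> simp [gram]
  constructor
  · have h1 : ((M⁻¹ : GL (Fin 2) F) : Matrix (Fin 2) (Fin 2) F) * M = 1 :=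
      M.inv_mul
    have h2 : gram F * (M : Matrix (Fin 2) (Fin 2) F)ᴴ =
        ((M⁻¹ : GL (Fin 2) F) : Matrix (Fin 2) (Fin 2) F) * gram F := by
      nth_rw 2 [← hM]
      rw [Matrix.mul_assoc, ← Matrix.mul_assoc _ (M : Matrix (Fin 2) (Fin 2) F), h1,
        Matrix.one_mul]
    have h3 : (planeHom P hP M : Matrix n n F)ᴴ = planeHom P hP M⁻¹ := by
      rw [planeHom_apply, planeHom_apply, conjTranspose_add, conjTranspose_mul, conjTranspose_mul,
        conjTranspose_mul, hJ, conjTranspose_conjTranspose, conjTranspose_sub, conjTranspose_one,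
        conjTranspose_one]
      congr 1
      calc P * gram F * (((M : Matrix (Fin 2) (Fin 2) F)ᴴ - 1) * Pᴴ)
          = P * (gram F * (M : Matrix (Fin 2) (Fin 2) F)ᴴ - gram F) * Pᴴ := by
            simp only [Matrix.mul_assoc, Matrix.mul_sub, Matrix.sub_mul, Matrix.one_mul]
        _ = _ := by
            rw [h2]
            simp only [Matrix.mul_assoc, Matrix.mul_sub, Matrix.sub_mul, Matrix.one_mul]
    rw [h3, ← Units.val_mul, ← map_mul, mul_inv_cancel, map_one, Units.val_one]
  · rw [planeHom_apply, Matrix.mul_assoc, det_one_add_mul_comm, Matrix.mul_assoc, hP,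
      Matrix.mul_one, add_sub_cancel, hdet]

theorem planeHom_ne_smul_one {P : Matrix n (Fin 2) F} {hP : gram F * Pᴴ * P = 1}
    {M : GL (Fin 2) F}
    (hM : ∀ c : F, (M : Matrix (Fin 2) (Fin 2) F) ≠ c • 1) (c : F) :
    (planeHom P hP M : Matrix n n F) ≠ c • 1 := fun h => hM c <| by
  rw [← planeHom_mul_frame P hP M, h]
  simp [hP]

theorem planeHom_neg_one_ne_smul_one {P : Matrix n (Fin 2) F} {hP : gram F * Pᴴ * P = 1}
    {M : GL (Fin 2) F} (hM : (M : Matrix (Fin 2) (Fin 2) F) = -1)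
    (h2 : (2 : F) ≠ 0) (hn : 2 < Fintype.card n) (c : F) :
    (planeHom P hP M : Matrix n n F) ≠ c • 1 := fun h => by
  have h1 := planeHom_mul_frame P hP M
  rw [h] at h1
  have h3 : c = -1 := by
    simpa [hP, hM] using congrFun (congrFun h1 0) 0
  rw [planeHom_apply, hM, h3] at h
  have h4 : (1 : Matrix n n F) = P * ((gram F * Pᴴ)) := by
    have h5 : (2 : F) • (1 : Matrix n n F) = (2 : F) • (P * (gram F * Pᴴ)) := by
      have h6 : (-1 - 1 : Matrix (Fin 2) (Fin 2) F) = (-2 : F) • 1 := by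
        ext i j; fin_cases i <;> fin_cases j <;> simp <;> norm_num
      rw [h6] at h
      simp only [Matrix.mul_smul, Matrix.smul_mul, Matrix.mul_one] at h
      rw [neg_smul, neg_smul, one_smul, ← sub_eq_add_neg, sub_eq_iff_eq_add] at h
      rw [two_smul]
      nth_rw 2 [h]
      abel
    exact smul_right_injective _ h2 h5
  have h7 := congrArg Matrix.rank h4
  rw [rank_one] at h7
  have h8 := Matrix.rank_mul_le_left P (gram F * Pᴴ)
  have h9 := Matrix.rank_le_card_width P
  rw [Fintype.card_fin] at h9
  omega

/-- Upper unitriangular matrices. -/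
def upper (c : F) : GL (Fin 2) F :=
  ⟨!![1, c; 0, 1], !![1, -c; 0, 1], by simp [one_fin_two], by simp [one_fin_two]⟩

/-- Lower unitriangular matrices. -/
def lower (c : F) : GL (Fin 2) F :=
  ⟨!![1, 0; c, 1], !![1, 0; -c, 1], by simp [one_fin_two], by simp [one_fin_two]⟩

/-- Diagonal matrices of determinant one. -/
def torus (s : F) (hs : s ≠ 0) : GL (Fin 2) F :=
  ⟨!![s, 0; 0, s⁻¹], !![s⁻¹, 0; 0, s], by simp [one_fin_two, hs], by simp [one_fin_two, hs]⟩

variable {P : Matrix n (Fin 2) F} {hP : gram F * Pᴴ * P = 1}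

theorem planeHom_upper_mem {c : F} (hc : star c = -c) :
    planeHom P hP (upper c) ∈ suSubgroup F n := planeHom_mem
  (by ext i j; fin_cases i <;> fin_cases j <;>
    simp [upper, gram, Matrix.mul_apply, hc])
  (by simp [upper])

theorem planeHom_lower_mem {c : F} (hc : star c = -c) :
    planeHom P hP (lower c) ∈ suSubgroup F n := planeHom_mem
  (by ext i j; fin_cases i <;> fin_cases j <;>
    simp [lower, gram, Matrix.mul_apply, hc])
  (by simp [lower])

theorem planeHom_torus_mem {s : F} (hs : s ≠ 0) (hs' : star s = s) :
    planeHom P hP (torus s hs) ∈ suSubgroup F n := planeHom_mem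
  (by ext i j; fin_cases i <;> fin_cases j <;>
    simp [torus, gram, Matrix.mul_apply, hs, hs'])
  (by simp [torus, hs])

/-- A nonisotropic displacement of an isotropic vector yields a hyperbolic plane on which
commutators of `g` with transvections are products of two root elements. -/
theorem exists_plane {g : GL n F} (hg : (g : Matrix n n F) * (g : Matrix n n F)ᴴ = 1) {v : n → F}
    (hv : star v ⬝ᵥ v = 0) (hv' : star v ⬝ᵥ ((g : Matrix n n F) *ᵥ v) ≠ 0) :
    ∃ (P : Matrix n (Fin 2) F) (hP : gram F * Pᴴ * P = 1) (N : F), N ≠ 0 ∧ star N = N ∧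
      ∀ c : F, star c = -c →
        planeHom P hP (lower (N * c) * upper (-c)) ∈ commSet (suSubgroup F n) g := by
  set l := star v ⬝ᵥ ((g : Matrix n n F) *ᵥ v) with hl
  have hg' : (g : Matrix n n F)ᴴ * (g : Matrix n n F) = 1 := mul_eq_one_comm.1 hg
  set f : n → F := l⁻¹ • ((g : Matrix n n F) *ᵥ v) with hf
  have hvf : star v ⬝ᵥ f = 1 := by
    rw [hf, dotProduct_smul, ← hl, smul_eq_mul, inv_mul_cancel₀ hv']
  have hfv : star f ⬝ᵥ v = 1 := by
    rw [← star_star (star f ⬝ᵥ v), ← Matrix.star_dotProduct, hvf, star_one]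
  have hff : star f ⬝ᵥ f = 0 := by
    rw [hf, star_smul, smul_dotProduct, dotProduct_smul, star_mulVec, ← dotProduct_mulVec,
      mulVec_mulVec, hg', one_mulVec, hv]
    simp
  set P : Matrix n (Fin 2) F := (Matrix.of ![v, f])ᵀ with hPdef
  have hQ : gram F * Pᴴ = Matrix.of ![star f, star v] := by
    ext i j; fin_cases i <;> simp [hPdef, gram, Matrix.mul_apply]
  have hP : gram F * Pᴴ * P = 1 := by
    rw [hQ]
    ext i j
    fin_cases i <;> fin_cases j
    · exact hfv
    · exact hff
    · exact hv
    · exact hvf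
  refine ⟨P, hP, l * star l, by simpa using hv', by simp [mul_comm], fun c hc => ?_⟩
  have hu : ∀ c, (planeHom P hP (upper c) : Matrix n n F) = 1 + c • vecMulVec v (star v) := by
    intro c
    rw [planeHom_apply, hQ]
    congr 1
    ext i j
    simp [hPdef, upper, Matrix.mul_apply, vecMulVec_apply]
    ring
  have hlow : ∀ c, (planeHom P hP (lower c) : Matrix n n F) = 1 + c • vecMulVec f (star f) := by
    intro c
    rw [planeHom_apply, hQ]
    congr 1
    ext i j
    simp [hPdef, lower, Matrix.mul_apply, vecMulVec_apply]
    ring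
  have h1 : g * planeHom P hP (upper c) = planeHom P hP (lower (l * star l * c)) * g := by
    apply Units.ext
    rw [Units.val_mul, Units.val_mul, hu, hlow, mul_add, add_mul, one_mul, mul_one,
      Matrix.mul_smul, Matrix.smul_mul, mul_vecMulVec, vecMulVec_mul]
    have h2 : star f ᵥ* (g : Matrix n n F) = (star l)⁻¹ • star v := by
      rw [hf, star_smul, smul_vecMul, star_mulVec, vecMul_vecMul, hg', vecMul_one, star_inv₀]
    have h3 : (g : Matrix n n F) *ᵥ v = l • f := by
      rw [hf, smul_smul, mul_inv_cancel₀ hv', one_smul]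
    have h4 : star l ≠ 0 := by simpa using hv'
    rw [h2, h3, smul_vecMulVec, vecMulVec_smul]
    simp only [smul_smul]
    congr 2
    field_simp
  have h2 : planeHom P hP (lower (l * star l * c) * upper (-c)) =
      g * planeHom P hP (upper c) * g⁻¹ * (planeHom P hP (upper c))⁻¹ := by
    rw [h1, mul_inv_cancel_right, map_mul, ← map_inv]
    congr 2
    rw [eq_inv_iff_mul_eq_one]
    ext i j; fin_cases i <;> fin_cases j <;> simp [upper]
  rw [h2]
  exact commutator_mem_commSet (planeHom_upper_mem hc)

theorem exists_mul_eq_lower {g : GL n F} {N : F} (hN : N ≠ 0) (hN' : star N = N)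
    (hD : ∀ c : F, star c = -c →
      planeHom P hP (lower (N * c) * upper (-c)) ∈ commSet (suSubgroup F n) g)
    {s : F} (hs : s ≠ 0) (hs' : star s = s) (hs4 : s ^ 4 ≠ 1) {x : F} (hx : star x = -x) :
    ∃ d₁ ∈ commSet (suSubgroup F n) g, ∃ d₂ ∈ commSet (suSubgroup F n) g,
      d₁ * d₂ = planeHom P hP (lower x) := by
  have hr : 1 - s ^ 4 ≠ 0 := sub_ne_zero.2 (Ne.symm hs4)
  set c' : F := x * s ^ 2 / (N * (1 - s ^ 4)) with hc'
  have hsc' : star c' = -c' := by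
    simp [hc', star_div₀, hN', hs', hx, neg_div]
  have hsc : star (-(c' * s ^ 2)) = -(-(c' * s ^ 2)) := by
    simp [hsc', hs', mul_comm]
  refine ⟨_, hD _ hsc, _, commSet_conj (hD _ hsc') (Subgroup.mul_mem _
    (planeHom_upper_mem (P := P) (hP := hP) hsc)
    (planeHom_torus_mem (P := P) (hP := hP) hs hs')), ?_⟩
  rw [← map_mul, ← map_mul, ← map_inv, ← map_mul, ← map_mul]
  congr 1
  rw [← mul_assoc, mul_inv_eq_iff_eq_mul]
  have hx' : x = N * c' * (1 - s ^ 4) / s ^ 2 := by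
    rw [hc']; field_simp
  rw [hx']
  clear_value c'
  ext i j
  fin_cases i <;> fin_cases j <;> simp [upper, lower, torus] <;> field_simp <;> ring

theorem exists_involution_of_char_two {g : GL n F} {N : F} (hN : N ≠ 0) (hN' : star N = N)
    (hD : ∀ c : F, star c = -c →
      planeHom P hP (lower (N * c) * upper (-c)) ∈ commSet (suSubgroup F n) g)
    {s : F} (hs : s ≠ 0) (hs' : star s = s) (hs4 : s ^ 4 ≠ 1) (h2 : (2 : F) = 0) :
    ∃ t ∈ suSubgroup F n, t ^ 2 = 1 ∧ t ≠ 1 ∧ (∀ c : F, (t : Matrix n n F) ≠ c • 1) ∧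
      ∃ d : Fin 6 → GL n F, (∀ i, d i ∈ commSet (suSubgroup F n) g) ∧
        d 0 * d 1 * d 2 * d 3 * d 4 * d 5 = t := by
  have h1 : star (1 : F) = -1 := by rw [star_one]; linear_combination h2
  obtain ⟨d₁, hd₁, d₂, hd₂, h⟩ := exists_mul_eq_lower hN hN' hD hs hs' hs4 h1
  have hns : ∀ c : F, (planeHom P hP (lower 1) : Matrix n n F) ≠ c • 1 :=
    planeHom_ne_smul_one fun c hc => by
      simpa [lower] using congrFun (congrFun hc 1) 0
  refine ⟨planeHom P hP (lower 1), planeHom_lower_mem h1, ?_, fun h => hns 1 (by simp [h]), hns,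
    ![d₁, d₂, 1, 1, 1, 1], ?_, by simpa using h⟩
  · rw [← map_pow]
    convert map_one (planeHom P hP)
    ext i j
    fin_cases i <;> fin_cases j <;> simp [lower, pow_two]
    linear_combination h2
  · simp [Fin.forall_fin_succ, hd₁, hd₂, one_mem_commSet]

theorem exists_involution_of_neg_one {g : GL n F} (h2 : (2 : F) ≠ 0)
    (hd : ∃ d : Fin 6 → GL n F, (∀ i, d i ∈ commSet (suSubgroup F n) g) ∧
      d 0 * d 1 * d 2 * d 3 * d 4 * d 5 = planeHom P hP (-1)) :
    ∃ t ∈ suSubgroup F n, t ^ 2 = 1 ∧ t ≠ 1 ∧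
      (2 < Fintype.card n → ∀ c : F, (t : Matrix n n F) ≠ c • 1) ∧
      ∃ d : Fin 6 → GL n F, (∀ i, d i ∈ commSet (suSubgroup F n) g) ∧
        d 0 * d 1 * d 2 * d 3 * d 4 * d 5 = t := by
  refine ⟨planeHom P hP (-1), planeHom_mem ?_ ?_, ?_, fun h => h2 ?_, fun hn c =>
    planeHom_neg_one_ne_smul_one ?_ h2 hn c, hd⟩
  · simp
  · simp [det_fin_two]
  · rw [← map_pow]; simp
  · have h1 := planeHom_mul_frame P hP (-1)
    rw [h] at h1
    simp [hP] at h1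
    have h3 := congrFun (congrFun h1 0) 0
    simp at h3
    linear_combination h3
  · simp

theorem exists_involution_of_odd {g : GL n F} {N : F} (hN : N ≠ 0) (hN' : star N = N)
    (hD : ∀ c : F, star c = -c →
      planeHom P hP (lower (N * c) * upper (-c)) ∈ commSet (suSubgroup F n) g)
    {s : F} (hs : s ≠ 0) (hs' : star s = s) (hs4 : s ^ 4 ≠ 1)
    {c : F} (hc0 : c ≠ 0) (hc : star c = -c) :
    ∃ d : Fin 6 → GL n F, (∀ i, d i ∈ commSet (suSubgroup F n) g) ∧
      d 0 * d 1 * d 2 * d 3 * d 4 * d 5 = planeHom P hP (-1) := by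
  have hx : star (2 / c - N * c) = -(2 / c - N * c) := by
    simp [star_div₀, hN', hc, div_neg]
    ring
  obtain ⟨d₁, hd₁, d₂, hd₂, h⟩ := exists_mul_eq_lower hN hN' hD hs hs' hs4 hx
  set a := planeHom P hP (lower (N * c) * upper (-c)) with ha
  have hm : a ∈ commSet (suSubgroup F n) g := hD c hc
  refine ⟨![d₁, d₂, a, d₁, d₂, a], ?_, ?_⟩
  · simp [Fin.forall_fin_succ, hd₁, hd₂, hm]
  · change d₁ * d₂ * a * d₁ * d₂ * a = _
    rw [mul_assoc (d₁ * d₂ * a), h, ha, ← map_mul, ← map_mul, ← map_mul]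
    congr 1
    ext i j
    fin_cases i <;> fin_cases j <;> simp [upper, lower] <;> field_simp <;> ring

theorem exists_involution_of_trace {g : GL n F} {N : F}
    (hD : ∀ c : F, star c = -c →
      planeHom P hP (lower (N * c) * upper (-c)) ∈ commSet (suSubgroup F n) g)
    {c : F} (hc : star c = -c) (hNc : N * c ^ 2 = 1 ∨ N * c ^ 2 = 2) :
    ∃ d : Fin 6 → GL n F, (∀ i, d i ∈ commSet (suSubgroup F n) g) ∧
      d 0 * d 1 * d 2 * d 3 * d 4 * d 5 = planeHom P hP (-1) := by
  set a := planeHom P hP (lower (N * c) * upper (-c)) with ha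
  have hm : a ∈ commSet (suSubgroup F n) g := hD c hc
  rcases hNc with h | h
  · refine ⟨![a, a, a, 1, 1, 1], ?_, ?_⟩
    · simp [Fin.forall_fin_succ, hm, one_mem_commSet]
    · change a * a * a * 1 * 1 * 1 = _
      rw [mul_one, mul_one, mul_one, ha, ← map_mul, ← map_mul]
      congr 1
      ext i j
      fin_cases i <;> fin_cases j <;> simp [upper, lower]
      · linear_combination (N * c ^ 2 - 2) * h
      · linear_combination (-c ^ 3 * N + 3 * c) * h
      · linear_combination (N ^ 2 * c ^ 3 - 3 * N * c) * h
      · linear_combination (-N ^ 2 * c ^ 4 + 4 * N * c ^ 2 - 2) * h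
  · refine ⟨![a, a, 1, 1, 1, 1], ?_, ?_⟩
    · simp [Fin.forall_fin_succ, hm, one_mem_commSet]
    · change a * a * 1 * 1 * 1 * 1 = _
      rw [mul_one, mul_one, mul_one, mul_one, ha, ← map_mul]
      congr 1
      ext i j
      fin_cases i <;> fin_cases j <;> simp [upper, lower]
      · linear_combination - h
      · linear_combination c * h
      · linear_combination - N * c * h
      · linear_combination (N * c ^ 2 - 1) * h

omit [StarRing F] [DecidableEq n] in
theorem exists_ne_zero_orthogonal {k : ℕ} (hk : k < Fintype.card n) (u : Fin k → n → F) :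
    ∃ w : n → F, w ≠ 0 ∧ ∀ i, u i ⬝ᵥ w = 0 := by
  classical
  have h : LinearMap.ker (Matrix.of u).mulVecLin ≠ ⊥ :=
    LinearMap.ker_ne_bot_of_finrank_lt (by simpa using hk)
  obtain ⟨w, hw, hw0⟩ := Submodule.exists_mem_ne_zero_of_ne_bot h
  exact ⟨w, hw0, fun i => congrFun (LinearMap.mem_ker.1 hw) i⟩

omit [DecidableEq n] in
theorem exists_isotropic_orthogonal (h2 : (2 : F) = 0) (hF : ∀ z : F, star z = z → z = 0 ∨ z = 1)
    (hn : 4 ≤ Fintype.card n) (e f : n → F) :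
    ∃ w : n → F, w ≠ 0 ∧ star e ⬝ᵥ w = 0 ∧ star f ⬝ᵥ w = 0 ∧ star w ⬝ᵥ w = 0 := by
  have hnorm : ∀ z : n → F, star z ⬝ᵥ z = 0 ∨ star z ⬝ᵥ z = 1 := fun z =>
    hF _ (Matrix.star_dotProduct _ _).symm
  obtain ⟨x, hx0, hx⟩ := exists_ne_zero_orthogonal (by omega) ![star e, star f]
  obtain ⟨y, hy0, hy⟩ := exists_ne_zero_orthogonal (by omega) ![star e, star f, star x]
  simp [Fin.forall_fin_succ] at hx hy
  rcases hnorm x with hxx | hxx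
  · exact ⟨x, hx0, hx.1, hx.2, hxx⟩
  rcases hnorm y with hyy | hyy
  · exact ⟨y, hy0, hy.1, hy.2.1, hyy⟩
  have hyx : star y ⬝ᵥ x = 0 := by
    rw [Matrix.star_dotProduct, hy.2.2, star_zero]
  refine ⟨x + y, fun h => ?_, by simp [hx, hy], by simp [hx, hy], ?_⟩
  · have h1 := congrArg (star x ⬝ᵥ ·) h
    simp [hxx, hy] at h1
  · simp [star_add, hxx, hyy, hyx, hy]
    linear_combination h2

theorem transv_mul_self (h2 : (2 : F) = 0) {x : n → F} (hx : star x ⬝ᵥ x = 0) :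
    transv x hx 1 * transv x hx 1 = 1 := by
  apply Units.ext
  simp only [transv, Units.val_mul, one_smul, mul_add, add_mul, isotropic_rankOne_mul_self hx,
    mul_one, one_mul, Units.val_one, add_zero, add_assoc]
  rw [← two_smul F (vecMulVec x (star x)), h2, zero_smul, add_zero]

theorem transv_comm {x y : n → F} (hx : star x ⬝ᵥ x = 0) (hy : star y ⬝ᵥ y = 0)
    (hxy : star x ⬝ᵥ y = 0) (c d : F) :
    transv x hx c * transv y hy d = transv y hy d * transv x hx c := by
  have hyx : star y ⬝ᵥ x = 0 := by rw [Matrix.star_dotProduct, hxy, star_zero]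
  apply Units.ext
  simp [transv, mul_add, add_mul, vecMulVec_mul_vecMulVec, hxy, hyx]
  abel

theorem transv_braid (h2 : (2 : F) = 0) {x y : n → F} (hx : star x ⬝ᵥ x = 0)
    (hy : star y ⬝ᵥ y = 0) (hxy : (star x ⬝ᵥ y) * (star y ⬝ᵥ x) = 1) :
    transv x hx 1 * transv y hy 1 * transv x hx 1 =
      transv y hy 1 * transv x hx 1 * transv y hy 1 := by
  apply Units.ext
  have hX := isotropic_rankOne_mul_self hx
  have hY := isotropic_rankOne_mul_self hy
  have hXYX : vecMulVec x (star x) * vecMulVec y (star y) * vecMulVec x (star x) =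
      vecMulVec x (star x) := by
    simp [vecMulVec_mul_vecMulVec, smul_smul, hxy]
  have hYXY : vecMulVec y (star y) * vecMulVec x (star x) * vecMulVec y (star y) =
      vecMulVec y (star y) := by
    simp [vecMulVec_mul_vecMulVec, smul_smul, mul_comm, hxy]
  have htwo : ∀ M : Matrix n n F, M + M = 0 := fun M => by
    rw [← two_smul F M, h2, zero_smul]
  simp only [transv, Units.val_mul, one_smul]
  generalize vecMulVec x (star x) = X at *
  generalize vecMulVec y (star y) = Y at *
  have h3 : (1 + X) * (1 + Y) * (1 + X) = 1 + X + Y + X * Y + Y * X + (X + X) + X * X +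
    (X * Y * X - X) := by noncomm_ring
  have h4 : (1 + Y) * (1 + X) * (1 + Y) = 1 + X + Y + X * Y + Y * X + (Y + Y) + Y * Y +
    (Y * X * Y - Y) := by noncomm_ring
  rw [h3, h4, htwo, htwo, hX, hY, hXYX, hYXY, sub_self, sub_self]

theorem transv_conj {g : GL n F} (hg : (g : Matrix n n F) * (g : Matrix n n F)ᴴ = 1) {v : n → F}
    (hv : star v ⬝ᵥ v = 0)
    (hgv : star ((g : Matrix n n F) *ᵥ v) ⬝ᵥ ((g : Matrix n n F) *ᵥ v) = 0) (c : F) :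
    g * transv v hv c * g⁻¹ = transv ((g : Matrix n n F) *ᵥ v) hgv c := by
  rw [mul_inv_eq_iff_eq_mul]
  apply Units.ext
  simp [transv, mul_add, add_mul, mul_vecMulVec, vecMulVec_mul, star_mulVec, vecMul_vecMul,
    mul_eq_one_comm.1 hg]

theorem exists_involution_of_two {g : GL n F}
    (hg : (g : Matrix n n F) * (g : Matrix n n F)ᴴ = 1) (h2 : (2 : F) = 0)
    (hF : ∀ z : F, star z = z → z = 0 ∨ z = 1) (hn : 4 ≤ Fintype.card n) {v : n → F}
    (hv : star v ⬝ᵥ v = 0) (hv' : star v ⬝ᵥ ((g : Matrix n n F) *ᵥ v) ≠ 0) :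
    ∃ t ∈ suSubgroup F n, t ^ 2 = 1 ∧ t ≠ 1 ∧ (∀ c : F, (t : Matrix n n F) ≠ c • 1) ∧
      ∃ d : Fin 6 → GL n F, (∀ i, d i ∈ commSet (suSubgroup F n) g) ∧
        d 0 * d 1 * d 2 * d 3 * d 4 * d 5 = t := by
  have h1 : star (1 : F) = -1 := by rw [star_one]; linear_combination h2
  have hg' : (g : Matrix n n F)ᴴ * (g : Matrix n n F) = 1 := mul_eq_one_comm.1 hg
  have hgv : star ((g : Matrix n n F) *ᵥ v) ⬝ᵥ ((g : Matrix n n F) *ᵥ v) = 0 := by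
    rw [star_mulVec, ← dotProduct_mulVec, mulVec_mulVec, hg', one_mulVec, hv]
  have hcomm := commutator_mem_commSet (g := g) (transv_mem hv h1)
  rw [transv_conj hg hv hgv, inv_eq_of_mul_eq_one_right (transv_mul_self h2 hv)] at hcomm
  generalize (g : Matrix n n F) *ᵥ v = f at *
  have hvf : (star v ⬝ᵥ f) * (star f ⬝ᵥ v) = 1 := by
    have h3 : star f ⬝ᵥ v = star (star v ⬝ᵥ f) := Matrix.star_dotProduct _ _
    rw [h3]
    refine (hF _ (by simp [mul_comm])).resolve_left ?_
    simpa using hv'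
  obtain ⟨w, hw0, hvw, hfw, hww⟩ := exists_isotropic_orthogonal h2 hF hn v f
  have hwv : star w ⬝ᵥ v = 0 := by rw [Matrix.star_dotProduct, hvw, star_zero]
  have hwf : star w ⬝ᵥ f = 0 := by rw [Matrix.star_dotProduct, hfw, star_zero]
  have hd : star (v + w) ⬝ᵥ (v + w) = 0 := by simp [star_add, hv, hvw, hwv, hww]
  have hvd : star v ⬝ᵥ (v + w) = 0 := by simp [hv, hvw]
  have hfd : (star f ⬝ᵥ (v + w)) * (star (v + w) ⬝ᵥ f) = 1 := by
    simp [star_add, hfw, hwf, mul_comm, hvf]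
  have hvv := transv_mul_self h2 hv
  have hff := transv_mul_self h2 hgv
  have hdd := transv_mul_self h2 hd
  have hvdc := transv_comm hv hd hvd 1 1
  have hconj := conj_mul_of_braid (transv_braid h2 hv hgv hvf) (transv_braid h2 hgv hd hfd) hvdc
  have hvS : transv v hv 1 ∈ suSubgroup F n := transv_mem hv h1
  have hfS : transv f hgv 1 ∈ suSubgroup F n := transv_mem hgv h1
  have hdS : transv (v + w) hd 1 ∈ suSubgroup F n := transv_mem hd h1
  have hm₁ : transv v hv 1 * transv f hgv 1 ∈ commSet (suSubgroup F n) g := by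
    have := commSet_inv hcomm
    rwa [_root_.mul_inv_rev, inv_eq_of_mul_eq_one_right hvv, inv_eq_of_mul_eq_one_right hff] at this
  have hm₂ : transv f hgv 1 * transv (v + w) hd 1 ∈ commSet (suSubgroup F n) g := by
    rw [← hconj]
    exact commSet_conj hm₁ (mul_mem (mul_mem hvS hfS) hdS)
  have hns : ∀ c : F,
      ((transv v hv 1 * transv (v + w) hd 1 : GL n F) : Matrix n n F) ≠ c • 1 := by
    intro c hc
    have hdv : star (v + w) ⬝ᵥ v = 0 := by simp [star_add, hv, hwv]
    have hdf : star (v + w) ⬝ᵥ f = star v ⬝ᵥ f := by simp [star_add, hwf]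
    have hv0 : v ≠ 0 := by rintro rfl; simp at hv'
    have hcv := congrArg (· *ᵥ v) hc
    simp only [transv, Units.val_mul, one_smul, ← mulVec_mulVec, add_mulVec, one_mulVec,
      vecMulVec_mulVec, hdv, smul_mulVec] at hcv
    have hcf := congrArg (· *ᵥ f) hc
    simp only [transv, Units.val_mul, one_smul, ← mulVec_mulVec, add_mulVec, one_mulVec,
      vecMulVec_mulVec, hdf, hv, smul_mulVec, mulVec_add, mulVec_smul, hvw] at hcf
    have hc1 : c = 1 := by
      by_contra hne
      have : (c - 1) • v = 0 := by
        rw [sub_smul, one_smul, sub_eq_zero]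
        simpa [hv] using hcv.symm
      exact (smul_eq_zero.1 this).elim (fun h => hne (sub_eq_zero.1 h)) hv0
    subst hc1
    refine hw0 (funext fun i => (mul_eq_zero.1 ?_).resolve_left hv')
    have h := congrFun hcf i
    simp only [Pi.add_apply, Pi.smul_apply, MulOpposite.smul_eq_mul_unop, MulOpposite.unop_op,
      MulOpposite.op_zero, zero_smul, add_zero, one_smul] at h
    linear_combination h - v i * (star v ⬝ᵥ f) * h2
  refine ⟨transv v hv 1 * transv (v + w) hd 1, mul_mem hvS hdS, ?_,
    fun h => hns 1 (by rw [h]; simp), hns,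
    ![transv v hv 1 * transv f hgv 1, transv f hgv 1 * transv (v + w) hd 1, 1, 1, 1, 1], ?_, ?_⟩
  · rw [pow_two, mul_assoc, ← mul_assoc (transv (v + w) hd 1), ← hvdc, mul_assoc, hdd, mul_one,
      hvv]
  · simp [Fin.forall_fin_succ, hm₁, hm₂, one_mem_commSet]
  · simp only [cons_val, mul_one]
    rw [mul_assoc, ← mul_assoc (transv f hgv 1), hff, one_mul]

theorem exists_involution [Fintype F] {q : ℕ} (hq : Fintype.card F = q ^ 2)
    (hs : ∀ x : F, star x = x ^ q) (hn : q = 2 → 4 ≤ Fintype.card n) [Nonempty n] {g : GL n F}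
    (hg : (g : Matrix n n F) * (g : Matrix n n F)ᴴ = 1)
    (hg' : ∀ c : F, (g : Matrix n n F) ≠ c • 1) :
    ∃ t ∈ suSubgroup F n, t ^ 2 = 1 ∧ t ≠ 1 ∧
      (2 < Fintype.card n → ∀ c : F, (t : Matrix n n F) ≠ c • 1) ∧
      ∃ d : Fin 6 → GL n F, (∀ i, d i ∈ commSet (suSubgroup F n) g) ∧
        d 0 * d 1 * d 2 * d 3 * d 4 * d 5 = t := by
  obtain ⟨v, hv, hv'⟩ := exists_isotropic hg' (exists_three_mul_star_eq_neg_one hq hs)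
  have hcard := FiniteField.cast_card_eq_zero F
  rw [hq, Nat.cast_pow, sq_eq_zero_iff] at hcard
  by_cases hq2 : q = 2
  · have hF : ∀ z : F, star z = z → z = 0 ∨ z = 1 := fun z hz => by
      refine or_iff_not_imp_left.2 fun hz0 => ?_
      simpa [hq2] using pow_sub_one_of_star_eq hq hs hz0 hz
    obtain ⟨t, ht, ht2, ht1, hts, hd⟩ :=
      exists_involution_of_two hg (by simpa [hq2] using hcard) hF (hn hq2) hv hv'
    exact ⟨t, ht, ht2, ht1, fun _ => hts, hd⟩
  obtain ⟨P, hP, N, hN, hN', hD⟩ := exists_plane hg hv hv'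
  by_cases hq35 : q = 3 ∨ q = 5
  · obtain ⟨c, hc, hNc⟩ := exists_mul_sq_eq hq hs hq35 hN hN'
    refine exists_involution_of_neg_one (fun h2 => one_ne_zero (α := F) ?_)
      (exists_involution_of_trace hD hc hNc)
    rcases hq35 with rfl | rfl <;> push_cast at hcard
    · linear_combination hcard - h2
    · linear_combination hcard - 2 * h2
  · obtain ⟨s, hs0, hs', hs4⟩ := exists_pow_four_ne_one hq hs hq2
      (fun h => hq35 (.inl h)) (fun h => hq35 (.inr h))
    by_cases h2 : (2 : F) = 0
    · obtain ⟨t, ht, ht2, ht1, hts, hd⟩ := exists_involution_of_char_two hN hN' hD hs0 hs' hs4 h2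
      exact ⟨t, ht, ht2, ht1, fun _ => hts, hd⟩
    · obtain ⟨c, hc0, hc⟩ := exists_star_eq_neg hq hs
      exact exists_involution_of_neg_one h2 (exists_involution_of_odd hN hN' hD hs0 hs' hs4 hc0 hc)

end Matrices

end UnitaryInvolution

theorem stmt_1 {F : Type*} [Field F] [Fintype F] {q n : ℕ} (hq : Fintype.card F = q ^ 2)
    (hn : 2 ≤ n) (h22 : ¬(n = 2 ∧ q = 2)) (h32 : ¬(n = 3 ∧ q = 2))
    (g : GL (Fin n) F) (hgGU : memGU n q g)
    (hg : ∃ a : GL (Fin n) F, memGU n q a ∧ g * a ≠ a * g) :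
    ∃ t : GL (Fin n) F, memSU n q t ∧ t ^ 2 = 1 ∧ t ≠ 1 ∧
      (n ≠ 2 → ∃ s : GL (Fin n) F, memSU n q s ∧ t * s ≠ s * t) ∧
      ∃ x y : Fin 6 → GL (Fin n) F,
        (∀ i, x i ∈ {c : GL (Fin n) F | ∃ s : GL (Fin n) F, memSU n q s ∧ c = s * g * s⁻¹}) ∧
        (∀ i, y i ∈ {c : GL (Fin n) F | ∃ s : GL (Fin n) F, memSU n q s ∧ c = s * g * s⁻¹}⁻¹) ∧
        x 0 * y 0 * (x 1 * y 1) * (x 2 * y 2) * (x 3 * y 3) * (x 4 * y 4) * (x 5 * y 5) = t := by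
  let : StarRing F := UnitaryInvolution.powStarRing hq
  have hSU : ∀ A : GL (Fin n) F, A ∈ UnitaryInvolution.suSubgroup F (Fin n) ↔ memSU n q A :=
    fun A => Iff.rfl
  have : Nonempty (Fin n) := ⟨⟨0, by omega⟩⟩
  have hg' : ∀ c : F, (g : Matrix (Fin n) (Fin n) F) ≠ c • 1 := by
    rintro c hc
    obtain ⟨a, -, ha⟩ := hg
    exact ha (Units.ext (by simp [hc]))
  obtain ⟨t, ht, ht2, ht1, hts, d, hd, hdt⟩ := UnitaryInvolution.exists_involution hq
    (fun _ => rfl) (fun h => by rw [Fintype.card_fin]; omega) hgGU hg'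
  refine ⟨t, (hSU t).1 ht, ht2, ht1, fun hn2 => ?_, ?_⟩
  · obtain ⟨s, hs, hts'⟩ := UnitaryInvolution.exists_not_commute
      (hts (by rw [Fintype.card_fin]; omega))
      (UnitaryInvolution.exists_three_mul_star_eq_neg_one hq fun _ => rfl)
      (UnitaryInvolution.exists_star_eq_neg hq fun _ => rfl)
    exact ⟨s, (hSU s).1 hs, hts'⟩
  · choose a ha b hb hab using hd
    refine ⟨fun i => a i * g * (a i)⁻¹, fun i => (b i * g * (b i)⁻¹)⁻¹,
      fun i => ⟨a i, (hSU _).1 (ha i), rfl⟩,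
      fun i => Set.inv_mem_inv.2 ⟨b i, (hSU _).1 (hb i), rfl⟩, ?_⟩
    simp only [← hab, hdt]
end

section
/- Let F be a finite field, m ≥ 2, and let G = Sp_{2m}(F) be the symplectic group, i.e. the group of 2m×2m matrices M over F with M·J·Mᵀ = J, where J is the standard alternating form matrix J = [[0, I_m],[−I_m, 0]]. Let g ∈ G \ Z(G) and set C = g^G. Then there exists an element t ∈ G \ Z(G) with t² = 1, and elements x₁,…,x₆ ∈ C and y₁,…,y₆ ∈ C⁻¹ such that x₁y₁x₂y₂x₃y₃x₄y₄x₅y₅x₆y₆ = t. -/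
namespace SymplecticGroup

open Matrix
open scoped Pointwise

variable {l F : Type*} [Fintype l] [Field F]

/-- The standard alternating form on `l ⊕ l → F`. -/
def form (x y : l ⊕ l → F) : F :=
  ∑ i, (x (Sum.inr i) * y (Sum.inl i) - x (Sum.inl i) * y (Sum.inr i))

@[simp] lemma form_self (x : l ⊕ l → F) : form x x = 0 := by simp [form, mul_comm]

lemma form_swap (x y : l ⊕ l → F) : form x y = -form y x := by
  rw [form, form, ← Finset.sum_neg_distrib]
  exact Finset.sum_congr rfl fun i _ => by ring

@[simp] lemma form_add_left (x y z : l ⊕ l → F) : form (x + y) z = form x z + form y z := by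
  rw [form, form, form, ← Finset.sum_add_distrib]
  exact Finset.sum_congr rfl fun i _ => by simp only [Pi.add_apply]; ring

@[simp] lemma form_smul_left (a : F) (x z : l ⊕ l → F) : form (a • x) z = a * form x z := by
  rw [form, form, Finset.mul_sum]
  exact Finset.sum_congr rfl fun i _ => by simp only [Pi.smul_apply, smul_eq_mul]; ring

@[simp] lemma form_neg_left (x z : l ⊕ l → F) : form (-x) z = -form x z := by
  simpa using form_smul_left (-1) x z

@[simp] lemma form_sub_left (x y z : l ⊕ l → F) : form (x - y) z = form x z - form y z := by
  simp [sub_eq_add_neg]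

@[simp] lemma form_add_right (x y z : l ⊕ l → F) : form x (y + z) = form x y + form x z := by
  rw [form_swap, form_add_left, form_swap x y, form_swap x z]; ring

@[simp] lemma form_smul_right (a : F) (x z : l ⊕ l → F) : form x (a • z) = a * form x z := by
  rw [form_swap, form_smul_left, form_swap x z]; ring

@[simp] lemma form_neg_right (x z : l ⊕ l → F) : form x (-z) = -form x z := by
  simpa using form_smul_right (-1) x z

@[simp] lemma form_sub_right (x y z : l ⊕ l → F) : form x (y - z) = form x y - form x z := by
  simp [sub_eq_add_neg]

lemma exists_ne_zero_form_eq_zero (hl : 2 ≤ Fintype.card l) (v w : l ⊕ l → F) :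
    ∃ y : l ⊕ l → F, y ≠ 0 ∧ form y v = 0 ∧ form y w = 0 := by
  let f : (l ⊕ l → F) →ₗ[F] F × F :=
    { toFun := fun y => (form y v, form y w)
      map_add' := by simp
      map_smul' := by simp }
  have hf : LinearMap.ker f ≠ ⊥ := by
    apply LinearMap.ker_ne_bot_of_finrank_lt
    simp
    omega
  obtain ⟨y, hy, hy0⟩ := Submodule.exists_mem_ne_zero_of_ne_bot hf
  have := LinearMap.mem_ker.1 hy
  simp only [f, LinearMap.coe_mk, AddHom.coe_mk, Prod.mk_eq_zero] at this
  exact ⟨y, hy0, this.1, this.2⟩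

variable [DecidableEq l]

lemma form_eq (x y : l ⊕ l → F) : form x y = x ⬝ᵥ (J l F *ᵥ y) := by
  simp [form, J, dotProduct, Matrix.mulVec, Fintype.sum_sum_type, Matrix.fromBlocks,
    Matrix.one_apply, Finset.sum_sub_distrib, neg_add_eq_sub]

lemma eq_zero_of_form {v : l ⊕ l → F} (h : ∀ z, form v z = 0) : v = 0 := by
  funext i
  rcases i with i | i
  · simpa [form, Pi.single_apply] using h (Pi.single (Sum.inr i) 1)
  · simpa [form, Pi.single_apply] using h (Pi.single (Sum.inl i) 1)

lemma exists_form_eq_one {v : l ⊕ l → F} (hv : v ≠ 0) : ∃ z, form v z = 1 := by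
  obtain ⟨z, hz⟩ : ∃ z, form v z ≠ 0 := by
    by_contra! h
    exact hv (eq_zero_of_form h)
  exact ⟨(form v z)⁻¹ • z, by simp [hz]⟩

lemma exists_form_eq_zero_one {v w : l ⊕ l → F} (hv : v ≠ 0) (hw : ∀ k : F, w ≠ k • v) :
    ∃ u, form v u = 0 ∧ form w u = 1 := by
  obtain ⟨z, hz⟩ := exists_form_eq_one hv
  have hne : w - form w z • v ≠ 0 := sub_ne_zero.2 (hw _)
  obtain ⟨u, hu⟩ := exists_form_eq_one hne
  refine ⟨u - form v u • z, by simp [hz], ?_⟩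
  simp only [form_sub_left, form_smul_left, form_sub_right, form_smul_right] at hu ⊢
  linear_combination hu

lemma mem_iff_form {A : Matrix (l ⊕ l) (l ⊕ l) F} :
    A ∈ symplecticGroup l F ↔ ∀ x y, form (A *ᵥ x) (A *ᵥ y) = form x y := by
  have key (x y : l ⊕ l → F) :
      form (A *ᵥ x) (A *ᵥ y) = x ⬝ᵥ ((Aᵀ * J l F * A) *ᵥ y) := by
    rw [form_eq, ← Matrix.mulVec_mulVec, ← Matrix.mulVec_mulVec, Matrix.dotProduct_mulVec x,
      Matrix.vecMul_transpose]
  rw [mem_iff']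
  refine ⟨fun h x y => by rw [key, h, form_eq], fun h => ?_⟩
  refine Matrix.ext_of_mulVec_single fun j => ?_
  funext i
  have := h (Pi.single i 1) (Pi.single j 1)
  rw [key, form_eq, single_one_dotProduct, single_one_dotProduct] at this
  exact this

@[simp] lemma form_mulVec (g : symplecticGroup l F) (x y : l ⊕ l → F) :
    form (g.1 *ᵥ x) (g.1 *ᵥ y) = form x y :=
  mem_iff_form.1 g.2 x y

lemma ext_mulVec {g h : symplecticGroup l F} (H : ∀ x, g.1 *ᵥ x = h.1 *ᵥ x) : g = h :=
  Subtype.ext (Matrix.ext_of_mulVec_single fun _ => H _)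

lemma coe_mul_mulVec (g h : symplecticGroup l F) (x : l ⊕ l → F) :
    (g * h).1 *ᵥ x = g.1 *ᵥ (h.1 *ᵥ x) := by
  simp [Matrix.mulVec_mulVec]

lemma transvection_mulVec (v : l ⊕ l → F) (a : F) (x : l ⊕ l → F) :
    (1 + a • vecMulVec v (J l F *ᵥ v)) *ᵥ x = x + (a * form x v) • v := by
  rw [form_eq, Matrix.add_mulVec, Matrix.one_mulVec, Matrix.smul_mulVec, vecMulVec_mulVec,
    dotProduct_comm x]
  simp [mul_smul]

/-- The symplectic transvection `x ↦ x + a * form x v • v`. -/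
def transvection (v : l ⊕ l → F) (a : F) : symplecticGroup l F :=
  ⟨1 + a • vecMulVec v (J l F *ᵥ v), mem_iff_form.2 fun x y => by
    rw [transvection_mulVec, transvection_mulVec]
    simp only [form_add_left, form_add_right, form_smul_left, form_smul_right, form_self]
    rw [form_swap v y]
    ring⟩

@[simp] lemma coe_transvection_mulVec (v : l ⊕ l → F) (a : F) (x : l ⊕ l → F) :
    (transvection v a).1 *ᵥ x = x + (a * form x v) • v :=
  transvection_mulVec v a x

lemma transvection_mul_self (v : l ⊕ l → F) (a b : F) :
    transvection v a * transvection v b = transvection v (a + b) := by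
  refine ext_mulVec fun x => ?_
  simp only [coe_mul_mulVec, coe_transvection_mulVec, form_add_left, form_smul_left, form_self]
  module

lemma transvection_zero (v : l ⊕ l → F) : transvection v 0 = 1 :=
  ext_mulVec fun x => by simp

lemma transvection_inv (v : l ⊕ l → F) (a : F) :
    (transvection v a)⁻¹ = transvection v (-a) := by
  rw [inv_eq_iff_mul_eq_one, transvection_mul_self, add_neg_cancel, transvection_zero]

lemma transvection_smul (k : F) (v : l ⊕ l → F) (a : F) :
    transvection (k • v) a = transvection v (a * k ^ 2) := by
  refine ext_mulVec fun x => ?_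
  simp
  module

lemma conj_transvection (g : symplecticGroup l F) (v : l ⊕ l → F) (a : F) :
    g * transvection v a * g⁻¹ = transvection (g.1 *ᵥ v) a := by
  rw [mul_inv_eq_iff_eq_mul]
  refine ext_mulVec fun x => ?_
  simp only [coe_mul_mulVec, coe_transvection_mulVec, Matrix.mulVec_add, Matrix.mulVec_smul,
    form_mulVec]

lemma exists_mulVec_eq_smul_of_mem_center {t : symplecticGroup l F}
    (ht : t ∈ Subgroup.center (symplecticGroup l F)) (z : l ⊕ l → F) :
    ∃ k : F, t.1 *ᵥ z = k • z := by
  rcases eq_or_ne z 0 with rfl | hz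
  · exact ⟨0, by simp⟩
  obtain ⟨x, hx⟩ := exists_form_eq_one hz
  have h := congrArg (fun s => s.1 *ᵥ x) (Subgroup.mem_center_iff.1 ht (transvection z 1))
  simp only [coe_mul_mulVec, coe_transvection_mulVec, Matrix.mulVec_add, Matrix.mulVec_smul,
    form_swap x z, hx] at h
  exact ⟨-form (t.1 *ᵥ x) z, by
    linear_combination (norm := module) h⟩

lemma exists_mulVec_ne_smul {g : symplecticGroup l F}
    (hg : g ∉ Subgroup.center (symplecticGroup l F)) :
    ∃ v : l ⊕ l → F, ∀ k : F, g.1 *ᵥ v ≠ k • v := by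
  by_contra! h
  obtain ⟨a, ha⟩ := LinearMap.exists_eq_smul_id_of_forall_notLinearIndependent
    (f := Matrix.mulVecLin g.1) fun v hv => by
      obtain ⟨k, hk⟩ := h v
      have := LinearIndependent.pair_iff.1 hv k (-1) (by simp [hk])
      simp at this
  have ha' (x : l ⊕ l → F) : g.1 *ᵥ x = a • x := congrArg (fun f => f x) ha
  refine hg (Subgroup.mem_center_iff.2 fun s => ext_mulVec fun x => ?_)
  simp only [coe_mul_mulVec, ha', Matrix.mulVec_smul]

/-- If `s` fixes `w` and shifts `z` by `y`, it is a product of two transvections. -/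
lemma exists_shift {w z y p : l ⊕ l → F} (hwp : form w p = 0) (hzp : form z p = 1)
    (hyw : form y w = 0) (hyz : form y z = 0) (hyp : form y p = 0) :
    ∃ s : symplecticGroup l F, s.1 *ᵥ w = w ∧ s.1 *ᵥ z = z + y := by
  have hpy : form p y = 0 := by rw [form_swap, hyp, neg_zero]
  have hwy : form w y = 0 := by rw [form_swap, hyw, neg_zero]
  have hzy : form z y = 0 := by rw [form_swap, hyz, neg_zero]
  refine ⟨transvection p (-1) * transvection (p + y) 1, ?_, ?_⟩
  · simp only [coe_mul_mulVec, coe_transvection_mulVec, form_add_right, hwp, hwy]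
    simp [hwp]
  · simp only [coe_mul_mulVec, coe_transvection_mulVec, form_add_left, form_add_right,
      form_smul_left, form_self, hzp, hzy, hyp]
    module

lemma exists_swap {v w : l ⊕ l → F} (hvw : form v w ≠ 0) {k : F} (hk : k ≠ 0) :
    ∃ s : symplecticGroup l F, s.1 *ᵥ v = -(k⁻¹ • w) ∧ s.1 *ᵥ w = k • v := by
  have hwv : form w v = -form v w := form_swap w v
  obtain ⟨c, hc⟩ : ∃ c, form v w = c := ⟨_, rfl⟩
  rw [hc] at hvw hwv
  refine ⟨transvection v (-k / c) * transvection w (-1 / (k * c)) * transvection v (-k / c), ?_, ?_⟩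
  all_goals
    simp only [coe_mul_mulVec, coe_transvection_mulVec, form_add_left, form_smul_left, form_self, hwv,
      hc]
    match_scalars <;> field_simp <;> ring

/-- A symplectic map carrying `e` to `f` when `form e f ≠ 0`. -/
lemma exists_mulVec_eq {e f : l ⊕ l → F} (h : form e f ≠ 0) :
    ∃ s : symplecticGroup l F, s.1 *ᵥ e = f := by
  refine ⟨transvection (f - e) (form e f)⁻¹, ?_⟩
  simp [h]

lemma not_mem_center_of_orthogonal {v w : l ⊕ l → F} (hv : v ≠ 0) (hw : ∀ k : F, w ≠ k • v)
    (hvw : form v w = 0) :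
    transvection v 1 * transvection w (-1) ∉ Subgroup.center (symplecticGroup l F) := by
  intro h
  have hwv : form w v = 0 := by rw [form_swap, hvw, neg_zero]
  obtain ⟨z, hz, hz'⟩ := exists_form_eq_zero_one hv hw
  obtain ⟨k, hk⟩ := exists_mulVec_eq_smul_of_mem_center h z
  simp only [coe_mul_mulVec, coe_transvection_mulVec, form_add_left, form_smul_left, hwv,
    form_swap z v, form_swap z w, hz, hz'] at hk
  have hk1 := congrArg (form w) hk
  simp [hz'] at hk1
  refine hw 0 ?_
  rw [← hk1] at hk
  linear_combination (norm := module) hk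

/-- The map equal to `-1` on the hyperbolic plane spanned by `e, f` and to the identity on its
orthogonal complement is not central. -/
lemma not_mem_center_of_reflection (hl : 2 ≤ Fintype.card l) (h2 : (2 : F) ≠ 0)
    {e f : l ⊕ l → F} (hef : form e f = 1) {t : symplecticGroup l F}
    (ht : ∀ x, t.1 *ᵥ x = x - (2 * form x f) • e + (2 * form x e) • f) :
    t ∉ Subgroup.center (symplecticGroup l F) := by
  intro h
  obtain ⟨y, hy, hye, hyf⟩ := exists_ne_zero_form_eq_zero hl e f
  obtain ⟨k, hk⟩ := exists_mulVec_eq_smul_of_mem_center h (e + y)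
  simp only [ht, form_add_left, hef, hye, hyf, form_self] at hk
  have hk1 := congrArg (fun u => form u f) hk
  simp only [form_add_left, form_sub_left, form_smul_left, hef, hyf, form_self] at hk1
  have hk' : k = -1 := by linear_combination -hk1
  subst hk'
  have : (2 : F) • y = 0 := by linear_combination (norm := module) hk
  exact hy ((smul_eq_zero.1 this).resolve_left h2)

lemma sq_eq_one_of_reflection {e f : l ⊕ l → F} (hef : form e f = 1) {t : symplecticGroup l F}
    (ht : ∀ x, t.1 *ᵥ x = x - (2 * form x f) • e + (2 * form x e) • f) : t ^ 2 = 1 := by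
  refine ext_mulVec fun x => ?_
  have hfe : form f e = -1 := by rw [form_swap, hef]
  rw [sq, coe_mul_mulVec]
  simp only [ht, form_add_left, form_sub_left, form_smul_left, hef, hfe, form_self,
    OneMemClass.coe_one, Matrix.one_mulVec]
  module

/-- The products `x * y` of a conjugate `x` of `g` and the inverse `y` of a conjugate of `g`. -/
def conjQuotients (g : symplecticGroup l F) : Set (symplecticGroup l F) :=
  conjugatesOf g * (conjugatesOf g)⁻¹

lemma one_mem_conjQuotients (g : symplecticGroup l F) : 1 ∈ conjQuotients g :=
  Set.mem_mul.2 ⟨g, mem_conjugatesOf_self, g⁻¹, Set.inv_mem_inv.2 mem_conjugatesOf_self,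
    mul_inv_cancel g⟩

lemma conj_mem_conjQuotients {g t : symplecticGroup l F} (s : symplecticGroup l F)
    (ht : t ∈ conjQuotients g) : s * t * s⁻¹ ∈ conjQuotients g := by
  obtain ⟨x, hx, y, hy, rfl⟩ := Set.mem_mul.1 ht
  refine Set.mem_mul.2 ⟨s * x * s⁻¹, hx.trans (isConj_iff.2 ⟨s, rfl⟩), s * y * s⁻¹, ?_, by group⟩
  rw [Set.mem_inv] at hy ⊢
  exact IsConj.trans hy (isConj_iff.2 ⟨s, by group⟩)

lemma transvection_mem_conjQuotients (g : symplecticGroup l F) (v : l ⊕ l → F) (a : F) :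
    transvection v a * transvection (g.1 *ᵥ v) (-a) ∈ conjQuotients g := by
  refine Set.mem_mul.2 ⟨transvection v a * g * (transvection v a)⁻¹, isConj_iff.2 ⟨_, rfl⟩, g⁻¹,
    Set.inv_mem_inv.2 mem_conjugatesOf_self, ?_⟩
  rw [← conj_transvection, ← transvection_inv]
  group

lemma conj_transvection_mem_conjQuotients {g : symplecticGroup l F} {v w : l ⊕ l → F}
    (h : ∀ a, transvection v a * transvection w (-a) ∈ conjQuotients g)
    (s : symplecticGroup l F) (a : F) :
    transvection (s.1 *ᵥ v) a * transvection (s.1 *ᵥ w) (-a) ∈ conjQuotients g := by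
  rw [← conj_transvection, ← conj_transvection]
  convert conj_mem_conjQuotients s (h a) using 1
  group

/-- Some noncentral element squaring to `1` is a product of six conjugate quotients of `g`. -/
def HasInvolution (g : symplecticGroup l F) : Prop :=
  ∃ t ∉ Subgroup.center (symplecticGroup l F), t ^ 2 = 1 ∧ t ∈ conjQuotients g ^ 6

lemma mem_pow_six {g t : symplecticGroup l F} {n : ℕ} (hn : n ≤ 6) (ht : t ∈ conjQuotients g ^ n) :
    t ∈ conjQuotients g ^ 6 :=
  Set.pow_subset_pow_right (one_mem_conjQuotients g) hn ht

lemma hasInvolution_of_orthogonal {g : symplecticGroup l F} (h2 : (2 : F) = 0)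
    {v w : l ⊕ l → F} (hv : v ≠ 0) (hw : ∀ k : F, w ≠ k • v) (hvw : form v w = 0)
    {n : ℕ} (hn : n ≤ 6) (ht : transvection v 1 * transvection w (-1) ∈ conjQuotients g ^ n) :
    HasInvolution g := by
  refine ⟨_, not_mem_center_of_orthogonal hv hw hvw, ?_, mem_pow_six hn ht⟩
  have hwv : form w v = 0 := by rw [form_swap, hvw, neg_zero]
  refine ext_mulVec fun x => ?_
  rw [sq, coe_mul_mulVec]
  simp only [coe_mul_mulVec, coe_transvection_mulVec, form_add_left, form_smul_left, form_self,
    hvw, hwv, OneMemClass.coe_one, Matrix.one_mulVec]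
  have h2' (u : l ⊕ l → F) : (2 : F) • u = 0 := by rw [h2, zero_smul]
  linear_combination (norm := module) form x v • h2' v - form x w • h2' w

lemma hasInvolution_of_transvection (hl : 2 ≤ Fintype.card l) {g : symplecticGroup l F}
    (h2 : (2 : F) ≠ 0) {e : l ⊕ l → F} (he : e ≠ 0)
    (h : ∀ a, transvection e a ∈ conjQuotients g ^ 2) : HasInvolution g := by
  obtain ⟨f, hef⟩ := exists_form_eq_one he
  have hfe : form f e = -1 := by rw [form_swap, hef]
  have key (u : l ⊕ l → F) (hu : form e u ≠ 0) (a : F) :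
      transvection u a ∈ conjQuotients g ^ 2 := by
    obtain ⟨s, rfl⟩ := exists_mulVec_eq hu
    rw [← conj_transvection]
    have := h a
    rw [sq] at this ⊢
    obtain ⟨x, hx, y, hy, hxy⟩ := Set.mem_mul.1 this
    exact Set.mem_mul.2 ⟨_, conj_mem_conjQuotients s hx, _, conj_mem_conjQuotients s hy,
      by rw [← hxy]; group⟩
  have ht (x) : (transvection e 2 * transvection f 2 * transvection (e - f) 2).1 *ᵥ x =
      x - (2 * form x f) • e + (2 * form x e) • f := by
    simp only [coe_mul_mulVec, coe_transvection_mulVec, form_add_left, form_sub_left,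
      form_sub_right, form_smul_left, hef, hfe, form_self]
    module
  refine ⟨_, not_mem_center_of_reflection hl h2 hef ht, sq_eq_one_of_reflection hef ht, ?_⟩
  rw [show 6 = 2 + 2 + 2 from rfl, pow_add, pow_add]
  exact Set.mul_mem_mul (Set.mul_mem_mul (h 2) (key f (by simp [hef]) 2))
    (key (e - f) (by simp [hef]) 2)

theorem hasInvolution (hl : 2 ≤ Fintype.card l) {g : symplecticGroup l F}
    (hg : g ∉ Subgroup.center (symplecticGroup l F)) : HasInvolution g := by
  obtain ⟨v, hw⟩ := exists_mulVec_ne_smul hg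
  have hP := transvection_mem_conjQuotients g v
  have hv : v ≠ 0 := by
    rintro rfl
    exact hw 0 (by simp)
  generalize g.1 *ᵥ v = w at hw hP
  have hwv := form_swap w v
  by_cases hvw : form v w = 0
  · rw [hvw, neg_zero] at hwv
    by_cases h2 : (2 : F) = 0
    · exact hasInvolution_of_orthogonal h2 hv hw hvw (n := 1) (by norm_num) (by simpa using hP 1)
    · refine hasInvolution_of_transvection hl h2 (e := v + w) ?_ fun a => ?_
      · intro h
        exact hw (-1) (by linear_combination (norm := module) h)
      obtain ⟨p, hvp, hwp⟩ := exists_form_eq_zero_one hv hw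
      obtain ⟨s, hs, hs'⟩ := exists_shift (y := (2 : F) • v) hvp hwp (by simp) (by simp [hvw])
        (by simp [hvp])
      have := Set.mul_mem_mul (hP (-a / 2)) (conj_transvection_mem_conjQuotients hP s (-a / 2))
      rw [hs, hs', ← sq] at this
      convert this using 1
      refine ext_mulVec fun x => ?_
      simp only [coe_mul_mulVec, coe_transvection_mulVec, form_add_left, form_add_right,
        form_smul_left, form_smul_right, form_self, hvw, hwv]
      match_scalars <;> field_simp <;> ring
  by_cases h2 : (2 : F) = 0
  · obtain ⟨y, hy, hyv, hyw⟩ := exists_ne_zero_form_eq_zero hl v w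
    obtain ⟨r, hr, hr'⟩ := exists_swap hvw one_ne_zero
    obtain ⟨s, hs, hs'⟩ := exists_shift (w := w) (z := v) (y := y) (p := (form v w)⁻¹ • w)
      (by simp) (by simp [hvw]) hyw hyv (by simp [hyw])
    have hQ := conj_transvection_mem_conjQuotients (conj_transvection_mem_conjQuotients hP r) s 1
    rw [hr, hr', Matrix.mulVec_neg, inv_one, one_smul, one_smul, hs, hs', ← neg_one_smul F w,
      transvection_smul, neg_one_sq, mul_one] at hQ
    have hvy : form v y = 0 := by rw [form_swap, hyv, neg_zero]
    have hwy : form w y = 0 := by rw [form_swap, hyw, neg_zero]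
    refine hasInvolution_of_orthogonal h2 (w := v + y) hv (fun k hk => hy ?_) (by simp [hvy])
      (n := 2) (by norm_num) ?_
    · have hk1 := congrArg (form w) hk
      rw [form_add_right, form_smul_right, hwy, add_zero] at hk1
      have hwv' : form w v ≠ 0 := by rw [hwv]; exact neg_ne_zero.2 hvw
      have : k = 1 := mul_right_cancel₀ hwv' (by rw [one_mul, ← hk1])
      subst this
      linear_combination (norm := module) hk
    · have := Set.mul_mem_mul (hP 1) hQ
      rw [← sq] at this
      convert this using 1
      rw [mul_assoc, ← mul_assoc _ (transvection w 1), transvection_mul_self, neg_add_cancel,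
        transvection_zero, one_mul]
  set c := form v w with hc
  have hef : form v (c⁻¹ • w) = 1 := by simp [← hc, hvw]
  by_cases h3 : (3 : F) = 0
  · have ht (x) : ((transvection v c⁻¹ * transvection w (-c⁻¹)) ^ 2).1 *ᵥ x =
        x - (2 * form x (c⁻¹ • w)) • v + (2 * form x v) • (c⁻¹ • w) := by
      simp only [pow_succ, pow_zero, one_mul, coe_mul_mulVec, coe_transvection_mulVec,
        form_add_left, form_smul_left, form_smul_right, form_self, ← hc, hwv]
      match_scalars <;> field_simp
      · linear_combination -(c * (form x v + form x w)) * h3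
      · linear_combination c * (form x v + 2 * form x w) * h3
    refine ⟨_, not_mem_center_of_reflection hl h2 hef ht, sq_eq_one_of_reflection hef ht,
      mem_pow_six (n := 2) (by norm_num) (Set.pow_mem_pow (hP _))⟩
  by_cases h5 : (5 : F) = 0
  · have ht (x) : ((transvection v (2 * c⁻¹) * transvection w (-(2 * c⁻¹))) ^ 3).1 *ᵥ x =
        x - (2 * form x (c⁻¹ • w)) • v + (2 * form x v) • (c⁻¹ • w) := by
      simp only [pow_succ, pow_zero, one_mul, coe_mul_mulVec, coe_transvection_mulVec,
        form_add_left, form_smul_left, form_smul_right, form_self, ← hc, hwv]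
      match_scalars <;> field_simp
      · linear_combination -(c ^ 2 * (3 * form x v + 7 * form x w)) * h5
      · linear_combination c ^ 2 * (7 * form x v + 17 * form x w) * h5
    refine ⟨_, not_mem_center_of_reflection hl h2 hef ht, sq_eq_one_of_reflection hef ht,
      mem_pow_six (n := 3) (by norm_num) (Set.pow_mem_pow (hP _))⟩
  refine hasInvolution_of_transvection hl h2 hv fun b => ?_
  obtain ⟨s, hs, hs'⟩ := exists_swap hvw h2
  have := Set.mul_mem_mul (hP (-b / 15))
    (conj_transvection_mem_conjQuotients hP s (4 * (-b / 15)))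
  rw [hs, hs', ← neg_smul, transvection_smul, transvection_smul, ← sq] at this
  convert this using 1
  have h15 : (15 : F) ≠ 0 := by
    rw [show (15 : F) = 3 * 5 by norm_num]
    exact mul_ne_zero h3 h5
  rw [mul_assoc, ← mul_assoc (transvection w _), transvection_mul_self]
  rw [show -(-b / 15) + 4 * (-b / 15) * (-2⁻¹) ^ 2 = 0 by field_simp; ring, transvection_zero,
    one_mul, transvection_mul_self]
  congr 1
  field_simp
  ring

end SymplecticGroup

theorem stmt_2 {F : Type*} [Field F] [Fintype F] {m : ℕ} (hm : 2 ≤ m)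
    (g : ↥(Matrix.symplecticGroup (Fin m) F))
    (hg : g ∉ Subgroup.center ↥(Matrix.symplecticGroup (Fin m) F)) :
    ∃ t : ↥(Matrix.symplecticGroup (Fin m) F),
      t ∉ Subgroup.center ↥(Matrix.symplecticGroup (Fin m) F) ∧ t ^ 2 = 1 ∧
      ∃ x y : Fin 6 → ↥(Matrix.symplecticGroup (Fin m) F),
        (∀ i, x i ∈ {c : ↥(Matrix.symplecticGroup (Fin m) F) | IsConj g c}) ∧
        (∀ i, y i ∈ {c : ↥(Matrix.symplecticGroup (Fin m) F) | IsConj g c}⁻¹) ∧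
        x 0 * y 0 * (x 1 * y 1) * (x 2 * y 2) * (x 3 * y 3) * (x 4 * y 4) * (x 5 * y 5) = t := by
  obtain ⟨t, htc, ht2, ht⟩ := SymplecticGroup.hasInvolution (by simpa using hm) hg
  obtain ⟨f, hf⟩ := Set.mem_pow.1 ht
  choose x hx y hy hxy using fun i => Set.mem_mul.1 (f i).2
  refine ⟨t, htc, ht2, x, y, hx, hy, ?_⟩
  simp only [hxy, ← hf]
  simp [List.ofFn_succ, mul_assoc]
end

section
/- Let F be a finite field with |F| = q, let n ≥ 7, with q odd if n is odd, and let Q be a quadratic form on V = Fⁿ whose associated polar bilinear form B(v,w) = Q(v+w) − Q(v) − Q(w) is nondegenerate. Let G = O(Q) = {g ∈ GL(V) : Q(g v) = Q(v) for all v ∈ V} be the orthogonal group of Q, and let S = [G,G] be the derived subgroup of G (for n ≥ 7 this is the group Ω_n^ε(q)). Let g ∈ G \ Z(G) and set C = g^S. Then there exists t ∈ S \ Z(S) with t² = 1, and elements x₁,…,x₆ ∈ C and y₁,…,y₆ ∈ C⁻¹ such that x₁y₁x₂y₂x₃y₃x₄y₄x₅y₅x₆y₆ = t. -/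
/-- The orthogonal group `O(Q)` of a quadratic form, as a subgroup of the group of linear
automorphisms of `V`. -/
def orthGroup {F V : Type*} [Field F] [AddCommGroup V] [Module F V]
    (Q : QuadraticForm F V) : Subgroup (V ≃ₗ[F] V) where
  carrier := {g | ∀ v, Q (g v) = Q v}
  one_mem' := fun _ => rfl
  mul_mem' := by
    intro a b ha hb v
    have h : (a * b) v = a (b v) := rfl
    rw [h, ha, hb]
  inv_mem' := by
    intro a ha v
    have h : a (a⁻¹ v) = v := a.apply_symm_apply v
    exact (ha (a⁻¹ v)).symm.trans (congrArg Q h)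

section

open QuadraticMap
open scoped commutatorElement

variable {F V : Type*} [Field F] [AddCommGroup V] [Module F V] (Q : QuadraticForm F V)

theorem exists_isotropic_combination [Fintype F] (e : Fin 3 → V) :
    ∃ x : Fin 3 → F, x ≠ 0 ∧ Q (∑ i, x i • e i) = 0 := by
  classical
  obtain ⟨p, hp⟩ := CharP.exists F
  have hpp : p.Prime := CharP.char_is_prime F p
  let f : MvPolynomial (Fin 3) F :=
    ∑ i, ∑ j, MvPolynomial.C (if i = j then Q (e i) else if i < j then polar Q (e i) (e j) else 0) *
      (MvPolynomial.X i * MvPolynomial.X j)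
  have hf : ∀ x : Fin 3 → F, MvPolynomial.eval x f = Q (∑ i, x i • e i) := by
    intro x
    rw [Fin.sum_univ_three, QuadraticMap.map_add Q, QuadraticMap.map_add Q]
    simp [f, Fin.sum_univ_three, QuadraticMap.map_smul, polar_add_left, polar_smul_left,
      polar_smul_right]
    ring
  have hdeg : f.totalDegree < Fintype.card (Fin 3) := by
    refine lt_of_le_of_lt (b := 2) ?_ (by simp)
    refine MvPolynomial.totalDegree_finsetSum_le fun i _ =>
      MvPolynomial.totalDegree_finsetSum_le fun j _ => ?_
    refine (MvPolynomial.totalDegree_mul _ _).trans ?_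
    have := MvPolynomial.totalDegree_mul (MvPolynomial.X (R := F) i) (MvPolynomial.X j)
    simp only [MvPolynomial.totalDegree_C, MvPolynomial.totalDegree_X] at this ⊢
    omega
  have hdvd := char_dvd_card_solutions p hdeg
  have h0 : MvPolynomial.eval (0 : Fin 3 → F) f = 0 := by rw [hf]; simp
  have hcard : 1 < Fintype.card {x : Fin 3 → F // MvPolynomial.eval x f = 0} :=
    hpp.one_lt.trans_le (Nat.le_of_dvd (Fintype.card_pos_iff.2 ⟨⟨0, h0⟩⟩) hdvd)
  obtain ⟨y, hy⟩ := Fintype.exists_ne_of_one_lt_card hcard ⟨0, h0⟩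
  exact ⟨y.1, fun h => hy (Subtype.ext h), by rw [← hf]; exact y.2⟩

theorem exists_singular_orthogonal [Fintype F] [FiniteDimensional F V] {k : ℕ} (v : Fin k → V)
    (hk : k + 3 ≤ Module.finrank F V) :
    ∃ w : V, w ≠ 0 ∧ Q w = 0 ∧ ∀ i, polar Q w (v i) = 0 := by
  let L : V →ₗ[F] (Fin k → F) := LinearMap.pi fun i => Q.polarBilin.flip (v i)
  have h1 := L.finrank_range_add_finrank_ker
  have h2 : Module.finrank F (LinearMap.range L) ≤ k := by
    simpa using Submodule.finrank_le (LinearMap.range L)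
  obtain ⟨e, he⟩ := exists_linearIndependent_of_le_finrank
    (show 3 ≤ Module.finrank F (LinearMap.ker L) by omega)
  have he' : LinearIndependent F (fun i => (e i : V)) :=
    he.map' (LinearMap.ker L).subtype (Submodule.ker_subtype _)
  obtain ⟨x, hx, hQ⟩ := exists_isotropic_combination Q fun i => (e i : V)
  refine ⟨∑ i, x i • (e i : V), fun h => hx ?_, hQ, fun i => ?_⟩
  · exact funext (Fintype.linearIndependent_iff.1 he' x h)
  · have : (∑ i, x i • e i : LinearMap.ker L).1 ∈ LinearMap.ker L := Subtype.prop _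
    exact (congrArg (fun w => polar Q w (v i)) (by simp)).trans
      (congrFun (LinearMap.mem_ker.1 this) i)

/-- `a` and `b` span a totally singular subspace. -/
structure IsSingularPair (a b : V) : Prop where
  left : Q a = 0
  right : Q b = 0
  polar_eq : polar Q a b = 0

variable {Q}

theorem IsSingularPair.symm {a b : V} (h : IsSingularPair Q a b) : IsSingularPair Q b a :=
  ⟨h.right, h.left, by rw [polar_comm, h.polar_eq]⟩

theorem IsSingularPair.smul_right {a b : V} (h : IsSingularPair Q a b) (r : F) :
    IsSingularPair Q a (r • b) :=
  ⟨h.left, by simp [QuadraticMap.map_smul, h.right], by simp [polar_smul_right, h.polar_eq]⟩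

theorem IsSingularPair.neg_right {a b : V} (h : IsSingularPair Q a b) :
    IsSingularPair Q a (-b) :=
  ⟨h.left, by simp [h.right], by simp [polar_neg_right, h.polar_eq]⟩

theorem polar_apply_apply (f : orthGroup Q) (v w : V) :
    polar Q (f.1 v) (f.1 w) = polar Q v w := by
  have hf : ∀ v, Q (f.1 v) = Q v := f.2
  simp only [polar, ← _root_.map_add, hf]

theorem IsSingularPair.map {a b : V} (h : IsSingularPair Q a b) (f : orthGroup Q) :
    IsSingularPair Q (f.1 a) (f.1 b) :=
  ⟨(f.2 a).trans h.left, (f.2 b).trans h.right, by rw [polar_apply_apply, h.polar_eq]⟩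

theorem polar_self_eq_zero {a : V} (h : Q a = 0) : polar Q a a = 0 := by
  rw [polar_self, h, smul_zero]

variable (Q) in
/-- The linear map `v ↦ v + B(v, a) b - B(v, b) a`. -/
def siegelMap (a b : V) : V →ₗ[F] V :=
  LinearMap.id + (Q.polarBilin.flip a).smulRight b - (Q.polarBilin.flip b).smulRight a

theorem siegelMap_apply (a b v : V) :
    siegelMap Q a b v = v + polar Q v a • b - polar Q v b • a := rfl

theorem siegelMap_comp_neg {a b : V} (h : IsSingularPair Q a b) (v : V) :
    siegelMap Q a b (siegelMap Q a (-b) v) = v := by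
  simp only [siegelMap_apply, polar_add_left, polar_sub_left, polar_smul_left, polar_neg_left,
    polar_neg_right, h.polar_eq, h.symm.polar_eq, polar_self_eq_zero h.left,
    polar_self_eq_zero h.right, smul_eq_mul]
  module

/-- The Siegel transformation (long root element) `v ↦ v + B(v, a) b - B(v, b) a` attached to
a totally singular pair. -/
def siegel {a b : V} (h : IsSingularPair Q a b) : orthGroup Q :=
  ⟨LinearEquiv.ofLinearMap (siegelMap Q a b) (siegelMap Q a (-b))
      (LinearMap.ext fun v => siegelMap_comp_neg h v)
      (LinearMap.ext fun v => by simpa using siegelMap_comp_neg h.neg_right v), fun v => by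
    change Q (v + polar Q v a • b - polar Q v b • a) = Q v
    rw [sub_eq_add_neg, QuadraticMap.map_add Q, QuadraticMap.map_add Q]
    simp only [QuadraticMap.map_neg, QuadraticMap.map_smul, polar_add_left, polar_neg_right,
      polar_smul_left, polar_smul_right, h.left, h.right, h.symm.polar_eq, smul_eq_mul]
    ring⟩

theorem siegel_apply {a b : V} (h : IsSingularPair Q a b) (v : V) :
    (siegel h).1 v = v + polar Q v a • b - polar Q v b • a := rfl

theorem orthGroup_ext {f g : orthGroup Q} (h : ∀ v, f.1 v = g.1 v) : f = g :=
  Subtype.ext (LinearEquiv.ext h)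

theorem orthGroup_mul_apply (f g : orthGroup Q) (v : V) : (f * g).1 v = f.1 (g.1 v) := rfl

theorem siegel_inv {a b : V} (h : IsSingularPair Q a b) : (siegel h)⁻¹ = siegel h.neg_right :=
  inv_eq_of_mul_eq_one_right (orthGroup_ext fun v => siegelMap_comp_neg h v)

theorem siegel_swap {a b : V} (h : IsSingularPair Q a b) : siegel h.symm.neg_right = siegel h :=
  orthGroup_ext fun v => by
    simp only [siegel_apply, polar_neg_right]
    module

theorem siegel_congr {a b a' b' : V} (h : IsSingularPair Q a b) (ha : a = a') (hb : b = b') :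
    siegel h = siegel (ha ▸ hb ▸ h : IsSingularPair Q a' b') := by
  subst ha hb; rfl

theorem siegel_conj {a b : V} (h : IsSingularPair Q a b) (f : orthGroup Q) :
    f * siegel h * f⁻¹ = siegel (h.map f) := by
  rw [mul_inv_eq_iff_eq_mul]
  refine orthGroup_ext fun v => ?_
  simp only [orthGroup_mul_apply, siegel_apply, polar_apply_apply, _root_.map_add,
    _root_.map_sub, _root_.map_smul]

theorem siegel_commute {a b c : V} (h : IsSingularPair Q a b) (h' : IsSingularPair Q a c) :
    siegel h * siegel h' = siegel h' * siegel h := by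
  refine orthGroup_ext fun v => ?_
  simp only [orthGroup_mul_apply, siegel_apply, polar_add_left, polar_sub_left, polar_smul_left,
    h.polar_eq, h.symm.polar_eq, h'.polar_eq, h'.symm.polar_eq, polar_self_eq_zero h.left,
    smul_eq_mul, polar_comm Q c b]
  module

theorem siegel_commutator {a b x y : V} (hax : IsSingularPair Q a x) (hby : IsSingularPair Q b y)
    (hxy : IsSingularPair Q x y) (hay : polar Q a y = 0) (hbx : polar Q b x = 0) :
    ⁅siegel hax, siegel hby⁆ = siegel (hxy.smul_right (polar Q a b)) := by
  rw [commutatorElement_def, mul_inv_eq_iff_eq_mul, mul_inv_eq_iff_eq_mul]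
  refine orthGroup_ext fun v => ?_
  simp only [orthGroup_mul_apply, siegel_apply, polar_add_left, polar_sub_left, polar_smul_left,
    polar_smul_right, hay, hbx, hxy.polar_eq, hxy.symm.polar_eq, hax.polar_eq,
    hby.polar_eq, polar_self_eq_zero hax.right, polar_self_eq_zero hby.right, smul_eq_mul,
    polar_comm Q b a, (polar_comm Q x b).trans hbx, (polar_comm Q y a).trans hay]
  module

variable (Q) in
/-- `a, a'`, `b, b'`, `c, c'` are three mutually orthogonal hyperbolic pairs. -/
structure HyperbolicFrame (a a' b b' c c' : V) : Prop where
  qa : Q a = 0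
  qa' : Q a' = 0
  qb : Q b = 0
  qb' : Q b' = 0
  qc : Q c = 0
  qc' : Q c' = 0
  aa' : polar Q a a' = 1
  bb' : polar Q b b' = 1
  cc' : polar Q c c' = 1
  ab : polar Q a b = 0
  ab' : polar Q a b' = 0
  a'b : polar Q a' b = 0
  a'b' : polar Q a' b' = 0
  ca : polar Q c a = 0
  ca' : polar Q c a' = 0
  cb : polar Q c b = 0
  cb' : polar Q c b' = 0
  c'a : polar Q c' a = 0
  c'a' : polar Q c' a' = 0
  c'b : polar Q c' b = 0
  c'b' : polar Q c' b' = 0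


theorem exists_polar_eq_one (hQ : ∀ v, (∀ w, polar Q v w = 0) → v = 0) {x : V}
    (hx : x ≠ 0) : ∃ y, polar Q x y = 1 := by
  have : ∃ y, polar Q x y ≠ 0 := by
    by_contra! h
    exact hx (hQ x h)
  obtain ⟨y, hy⟩ := this
  exact ⟨(polar Q x y)⁻¹ • y, by rw [polar_smul_right, smul_eq_mul, inv_mul_cancel₀ hy]⟩

theorem map_sub_smul_self {x y : V} (hx : Q x = 0) (hxy : polar Q x y = 1) :
    Q (y - Q y • x) = 0 := by
  rw [sub_eq_add_neg, QuadraticMap.map_add Q]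
  simp [QuadraticMap.map_smul, hx, polar_neg_right, polar_smul_right, polar_comm Q y x, hxy]

/-- A nonzero singular vector orthogonal to a hyperbolic pair has a singular dual vector
orthogonal to that pair. -/
theorem exists_dual_orthogonal_pair (hQ : ∀ v, (∀ w, polar Q v w = 0) → v = 0) {u u' x : V}
    (hu : Q u = 0) (hu' : Q u' = 0) (huu' : polar Q u u' = 1) (hx0 : x ≠ 0) (hx : Q x = 0)
    (hxu : polar Q x u = 0) (hxu' : polar Q x u' = 0) :
    ∃ x', Q x' = 0 ∧ polar Q x x' = 1 ∧ polar Q x' u = 0 ∧ polar Q x' u' = 0 := by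
  obtain ⟨y, hy⟩ := exists_polar_eq_one hQ hx0
  have hu'u : polar Q u' u = 1 := by rw [polar_comm, huu']
  set z := y - polar Q y u' • u - polar Q y u • u' with hz
  have hxz : polar Q x z = 1 := by
    simp [hz, polar_sub_right, polar_smul_right, hxu, hxu', hy]
  refine ⟨z - Q z • x, map_sub_smul_self hx hxz, ?_, ?_, ?_⟩
  · simp [polar_sub_right, polar_smul_right, hxz, polar_self_eq_zero hx]
  · simp [hz, polar_sub_left, polar_smul_left, hxu, hu'u, polar_self_eq_zero hu]
  · simp [hz, polar_sub_left, polar_smul_left, hxu', polar_self_eq_zero hu', huu',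
      smul_eq_mul]

/-- A nonzero singular vector orthogonal to two orthogonal hyperbolic pairs has a singular dual
vector orthogonal to both pairs. -/
theorem exists_dual_orthogonal_pairs (hQ : ∀ v, (∀ w, polar Q v w = 0) → v = 0)
    {a a' b b' x : V} (ha : Q a = 0) (ha' : Q a' = 0) (hb : Q b = 0) (hb' : Q b' = 0)
    (haa' : polar Q a a' = 1) (hbb' : polar Q b b' = 1) (hab : polar Q a b = 0)
    (hab' : polar Q a b' = 0) (ha'b : polar Q a' b = 0) (ha'b' : polar Q a' b' = 0)
    (hx0 : x ≠ 0) (hx : Q x = 0) (hxa : polar Q x a = 0) (hxa' : polar Q x a' = 0)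
    (hxb : polar Q x b = 0) (hxb' : polar Q x b' = 0) :
    ∃ x', Q x' = 0 ∧ polar Q x x' = 1 ∧ polar Q x' a = 0 ∧ polar Q x' a' = 0 ∧
      polar Q x' b = 0 ∧ polar Q x' b' = 0 := by
  obtain ⟨y, hy⟩ := exists_polar_eq_one hQ hx0
  set z := y - polar Q y a' • a - polar Q y a • a' - polar Q y b' • b - polar Q y b • b' with hz
  have hxz : polar Q x z = 1 := by
    simp [hz, polar_sub_right, polar_smul_right, hxa, hxa', hxb, hxb', hy]
  refine ⟨z - Q z • x, map_sub_smul_self hx hxz, ?_, ?_, ?_, ?_, ?_⟩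
  · simp [polar_sub_right, polar_smul_right, hxz, polar_self_eq_zero hx]
  · simp [hz, polar_sub_left, polar_smul_left, hxa, polar_self_eq_zero ha,
      polar_comm Q a' a, haa', polar_comm Q b a, hab, polar_comm Q b' a, hab']
  · simp [hz, polar_sub_left, polar_smul_left, hxa', polar_self_eq_zero ha',
      haa', polar_comm Q b a', ha'b, polar_comm Q b' a', ha'b']
  · simp [hz, polar_sub_left, polar_smul_left, hxb, polar_self_eq_zero hb,
      hab, ha'b, polar_comm Q b' b, hbb']
  · simp [hz, polar_sub_left, polar_smul_left, hxb', polar_self_eq_zero hb',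
      hab', ha'b', hbb']

theorem exists_polar_eq_one_of_ne_smul (hQ : ∀ v, (∀ w, polar Q v w = 0) → v = 0) {a b : V}
    (hb : b ≠ 0) (hab : ∀ r : F, a ≠ r • b) : ∃ y, polar Q a y = 1 ∧ polar Q b y = 0 := by
  obtain ⟨z, hz⟩ := exists_polar_eq_one hQ hb
  obtain ⟨w, hw⟩ := exists_polar_eq_one hQ (sub_ne_zero.2 (hab (polar Q a z)))
  refine ⟨w - polar Q b w • z, ?_, ?_⟩
  · simp only [polar_sub_left, polar_smul_left, polar_sub_right, polar_smul_right,
      smul_eq_mul] at hw ⊢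
    linear_combination hw
  · simp [polar_sub_right, polar_smul_right, hz]

theorem exists_hyperbolicFrame [Fintype F] [FiniteDimensional F V]
    (hV : 7 ≤ Module.finrank F V) (hQ : ∀ v, (∀ w, polar Q v w = 0) → v = 0) {a b y : V}
    (h : IsSingularPair Q a b) (hb : b ≠ 0) (hay : polar Q a y = 1) (hby : polar Q b y = 0) :
    ∃ a' b' c c', HyperbolicFrame Q a a' b b' c c' := by
  have ha'b : polar Q (y - Q y • a) b = 0 := by
    simp [polar_sub_left, polar_smul_left, polar_comm Q y b, hby, h.polar_eq]
  have haa' : polar Q a (y - Q y • a) = 1 := by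
    simp [polar_sub_right, polar_smul_right, hay, polar_self_eq_zero h.left]
  have ha' := map_sub_smul_self h.left hay
  generalize y - Q y • a = a' at *
  obtain ⟨b', hb', hbb', hb'a, hb'a'⟩ := exists_dual_orthogonal_pair hQ h.left ha' haa' hb h.right
    h.symm.polar_eq (by rw [polar_comm, ha'b])
  obtain ⟨c, hc0, hc, hci⟩ := exists_singular_orthogonal Q ![a, a', b, b'] hV
  have hca : polar Q c a = 0 := hci 0
  have hca' : polar Q c a' = 0 := hci 1
  have hcb : polar Q c b = 0 := hci 2
  have hcb' : polar Q c b' = 0 := hci 3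
  rw [polar_comm] at hb'a hb'a'
  obtain ⟨c', hc', hcc', hc'a, hc'a', hc'b, hc'b'⟩ := exists_dual_orthogonal_pairs hQ h.left ha'
    h.right hb' haa' hbb' h.polar_eq hb'a ha'b hb'a' hc0 hc hca hca' hcb hcb'
  exact ⟨a', b', c, c', h.left, ha', h.right, hb', hc, hc', haa', hbb', hcc', h.polar_eq, hb'a,
    ha'b, hb'a', hca, hca', hcb, hcb', hc'a, hc'a', hc'b, hc'b'⟩

theorem siegel_mem_commutator {x y c c' : V} (h : IsSingularPair Q x y) (hc : Q c = 0)
    (hc' : Q c' = 0) (hcc' : polar Q c c' = 1) (hcx : polar Q c x = 0) (hcy : polar Q c y = 0)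
    (hc'x : polar Q c' x = 0) (hc'y : polar Q c' y = 0) :
    siegel h ∈ commutator (orthGroup Q) := by
  have := siegel_commutator (a := c) (b := c') ⟨hc, h.left, hcx⟩ ⟨hc', h.right, hc'y⟩ h hcy hc'x
  rw [siegel_congr (h.smul_right (polar Q c c')) rfl (by rw [hcc', one_smul])] at this
  rw [← this]
  exact Subgroup.commutator_mem_commutator (Subgroup.mem_top _) (Subgroup.mem_top _)

theorem siegel_mem_commutator_of_dual [Fintype F] [FiniteDimensional F V]
    (hV : 7 ≤ Module.finrank F V) (hQ : ∀ v, (∀ w, polar Q v w = 0) → v = 0) {a b y : V}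
    (h : IsSingularPair Q a b) (hb : b ≠ 0) (hay : polar Q a y = 1) (hby : polar Q b y = 0) :
    siegel h ∈ commutator (orthGroup Q) := by
  obtain ⟨a', b', c, c', H⟩ := exists_hyperbolicFrame hV hQ h hb hay hby
  exact siegel_mem_commutator h (hcy := H.cb) (hc'y := H.c'b) H.qc H.qc' H.cc'
    (hc'x := H.c'a) (hcx := H.ca)

/-- If an isometry maps every singular vector to a multiple of itself then it is a scalar. -/
theorem exists_eq_smul_of_fixes_singular [Fintype F] [FiniteDimensional F V]
    (hV : 7 ≤ Module.finrank F V) (hQ : ∀ v, (∀ w, polar Q v w = 0) → v = 0) (g : orthGroup Q)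
    (hg : ∀ u, Q u = 0 → ∃ r : F, g.1 u = r • u) : ∃ r : F, ∀ v, g.1 v = r • v := by
  obtain ⟨u, hu0, hu, -⟩ := exists_singular_orthogonal Q ![] (by omega)
  obtain ⟨y, hy⟩ := exists_polar_eq_one hQ hu0
  have huu' : polar Q u (y - Q y • u) = 1 := by
    simp [polar_sub_right, polar_smul_right, hy, polar_self_eq_zero hu]
  have hu' := map_sub_smul_self hu hy
  generalize y - Q y • u = u' at huu' hu'
  have hu'u : polar Q u' u = 1 := by rw [polar_comm, huu']
  obtain ⟨x, hx0, hx, hxi⟩ := exists_singular_orthogonal Q ![u, u'] (by omega)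
  have hxu : polar Q x u = 0 := hxi 0
  have hxu' : polar Q x u' = 0 := hxi 1
  obtain ⟨r, hr⟩ := hg u hu
  obtain ⟨r', hr'⟩ := hg u' hu'
  obtain ⟨s, hs⟩ := hg x hx
  have key : ∀ w w', Q w = 0 → polar Q w w' = 1 → polar Q x w = 0 → polar Q x w' = 0 →
      ∀ t : F, g.1 w = t • w → t = s := by
    intro w w' hw hww' hxw hxw' t ht
    obtain ⟨m, hm⟩ := hg (w + x) (by rw [QuadraticMap.map_add Q, hw, hx, polar_comm, hxw]; simp)
    rw [_root_.map_add, ht, hs] at hm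
    have htm : t = m := by
      have := congrArg (fun v => polar Q v w') hm
      simpa [polar_add_left, polar_smul_left, hww', hxw'] using this
    subst htm
    rw [smul_add, add_right_inj] at hm
    exact (smul_left_injective F hx0 hm).symm
  have hrs := key u u' hu huu' hxu hxu' r hr
  have hr's := key u' u hu' hu'u hxu' hxu r' hr'
  subst hrs hr's
  have hr0 : r' ≠ 0 := by
    rintro rfl
    apply hu0
    rw [zero_smul] at hr
    exact (LinearEquiv.map_eq_zero_iff _).1 hr
  refine ⟨r', fun v => ?_⟩
  set w := v - polar Q v u' • u - polar Q v u • u' with hw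
  have hwu : polar Q w u = 0 := by
    simp [hw, polar_sub_left, polar_smul_left, hu'u, polar_self_eq_zero hu]
  have hwu' : polar Q w u' = 0 := by
    simp [hw, polar_sub_left, polar_smul_left, huu', polar_self_eq_zero hu']
  obtain ⟨m, hm⟩ := hg (u' + w + -(Q w • u)) (by
    rw [QuadraticMap.map_add Q, QuadraticMap.map_add Q, polar_comm Q u' w]
    simp [QuadraticMap.map_smul, hu, hu', hwu', hwu, polar_add_left, polar_smul_right,
      polar_neg_right, hu'u])
  have hgw : g.1 w = (m - r') • (u' - Q w • u) + m • w := by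
    rw [_root_.map_add, _root_.map_add, _root_.map_neg, _root_.map_smul, hr, hr'] at hm
    rw [← sub_eq_zero] at hm ⊢
    rw [← hm]
    module
  have hmr : m = r' := by
    have h0 : polar Q (g.1 w) (g.1 u) = 0 := by rw [polar_apply_apply, hwu]
    rw [hgw, hr] at h0
    simpa [polar_add_left, polar_sub_left, polar_smul_left, polar_smul_right, hwu, hu'u,
      polar_self_eq_zero hu, hr0, sub_eq_zero] using h0
  have hv : v = w + polar Q v u' • u + polar Q v u • u' := by rw [hw]; abel
  rw [hv, _root_.map_add, _root_.map_add, _root_.map_smul, _root_.map_smul, hgw, hr, hr', hmr]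
  module

/-- The set of products `x * y` with `x` in the `S`-conjugacy class of `g` and `y` in the inverse
of that class. -/
def conjQuotients {G : Type*} [Group G] (S : Subgroup G) (g : G) : Set G :=
  {d | ∃ x y : G, (∃ s ∈ S, x = s * g * s⁻¹) ∧ (∃ s ∈ S, y⁻¹ = s * g * s⁻¹) ∧ d = x * y}

theorem one_mem_conjQuotients {G : Type*} [Group G] (S : Subgroup G) (g : G) :
    1 ∈ conjQuotients S g :=
  ⟨g, g⁻¹, ⟨1, S.one_mem, by simp⟩, ⟨1, S.one_mem, by simp⟩, by simp⟩

theorem conj_mem_conjQuotients {G : Type*} [Group G] {S : Subgroup G} {g s d : G} (hs : s ∈ S)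
    (hd : d ∈ conjQuotients S g) : s * d * s⁻¹ ∈ conjQuotients S g := by
  obtain ⟨x, y, ⟨t, ht, rfl⟩, ⟨t', ht', hy⟩, rfl⟩ := hd
  refine ⟨s * (t * g * t⁻¹) * s⁻¹, s * y * s⁻¹, ⟨s * t, S.mul_mem hs ht, by group⟩,
    ⟨s * t', S.mul_mem hs ht', ?_⟩, by group⟩
  calc (s * y * s⁻¹)⁻¹ = s * y⁻¹ * s⁻¹ := by group
    _ = _ := by rw [hy]; group

theorem conj_mem_mul_conjQuotients {G : Type*} [Group G] {S : Subgroup G} {g s d : G}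
    (hs : s ∈ S) (hd : ∃ p ∈ conjQuotients S g, ∃ p' ∈ conjQuotients S g, d = p * p') :
    ∃ p ∈ conjQuotients S g, ∃ p' ∈ conjQuotients S g, s * d * s⁻¹ = p * p' := by
  obtain ⟨p, hp, p', hp', rfl⟩ := hd
  exact ⟨_, conj_mem_conjQuotients hs hp, _, conj_mem_conjQuotients hs hp', by group⟩

/-- If `m` commutes with `g⁻¹ * k * g` then `⁅m, k⁻¹⁆` is a product of two elements of
`conjQuotients S g`. -/
theorem commutator_mem_mul_conjQuotients {G : Type*} [Group G] {S : Subgroup G} [S.Normal]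
    {g m k : G} (hm : m ∈ S) (hk : k ∈ S) (hmk : m * (g⁻¹ * k * g) = g⁻¹ * k * g * m) :
    ∃ p ∈ conjQuotients S g, ∃ p' ∈ conjQuotients S g, ⁅m, k⁻¹⁆ = p * p' := by
  have hl : g⁻¹ * k * g ∈ S := by
    simpa using Subgroup.Normal.conj_mem ‹S.Normal› k hk g⁻¹
  obtain ⟨l, rfl⟩ : ∃ l, k = g * l * g⁻¹ := ⟨g⁻¹ * k * g, by group⟩
  have e : g⁻¹ * (g * l * g⁻¹) * g = l := by group
  rw [e] at hl hmk
  refine ⟨m * g * m⁻¹ * (l⁻¹ * m * g * (l⁻¹ * m)⁻¹)⁻¹,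
    ⟨_, _, ⟨m, hm, rfl⟩, ⟨l⁻¹ * m, S.mul_mem (S.inv_mem hl) hm, inv_inv _⟩, rfl⟩,
    l⁻¹ * g * l⁻¹⁻¹ * g⁻¹,
    ⟨_, _, ⟨l⁻¹, S.inv_mem hl, rfl⟩, ⟨1, S.one_mem, by simp⟩, rfl⟩, ?_⟩
  have h1 : m⁻¹ * l⁻¹ * m = l⁻¹ := by
    rw [← mul_inv_rev, ← hmk]
    group
  calc ⁅m, (g * l * g⁻¹)⁻¹⁆ = m * g * l⁻¹ * g⁻¹ * m⁻¹ * g * l * g⁻¹ := by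
        rw [commutatorElement_def]; group
    _ = m * g * (m⁻¹ * l⁻¹ * m) * g⁻¹ * m⁻¹ * g * l * g⁻¹ := by rw [h1]
    _ = _ := by group

/-- For noncentral `g`, some Siegel transformation is a product of two elements of
`conjQuotients S g`, where `S` is the derived subgroup. -/
theorem exists_siegel_mem_mul_conjQuotients [Fintype F] [FiniteDimensional F V]
    (hV : 7 ≤ Module.finrank F V) (hQ : ∀ v, (∀ w, polar Q v w = 0) → v = 0) (g : orthGroup Q)
    (hg : g ∉ Subgroup.center (orthGroup Q)) :
    ∃ a a' b b' c c' : V, HyperbolicFrame Q a a' b b' c c' ∧ ∃ h : IsSingularPair Q a b,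
      ∃ p ∈ conjQuotients (commutator (orthGroup Q)) g,
      ∃ p' ∈ conjQuotients (commutator (orthGroup Q)) g, siegel h = p * p' := by
  have hgi : ∀ v, g.1 (g⁻¹.1 v) = v := fun v => g.1.apply_symm_apply v
  have hgconj : ∀ {a b a' b' : V} (h : IsSingularPair Q a b) (h' : IsSingularPair Q a' b'),
      g.1 a' = a → g.1 b' = b → g⁻¹ * siegel h * g = siegel h' := by
    rintro a b a' b' h h' rfl rfl
    have := siegel_conj h' g
    rw [← this]
    group
  by_cases hA : ∃ u, Q u = 0 ∧ polar Q u (g.1 u) ≠ 0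
  · obtain ⟨u, hu, hc⟩ := hA
    have hgu : Q (g.1 u) = 0 := (g.2 u).trans hu
    have huu' : polar Q u ((polar Q u (g.1 u))⁻¹ • g.1 u) = 1 := by
      rw [polar_smul_right, smul_eq_mul, inv_mul_cancel₀ hc]
    have hu'u : polar Q (g.1 u) ((polar Q u (g.1 u))⁻¹ • u) = 1 := by
      rw [polar_smul_right, polar_comm Q (g.1 u), smul_eq_mul, inv_mul_cancel₀ hc]
    obtain ⟨x, hx0, hx, hxi⟩ := exists_singular_orthogonal Q ![u, g.1 u] (by omega)
    have hxu : polar Q x u = 0 := hxi 0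
    have hxgu : polar Q x (g.1 u) = 0 := hxi 1
    obtain ⟨x', -, hxx', -, -⟩ := exists_dual_orthogonal_pair hQ hu
      (by rw [QuadraticMap.map_smul, hgu, smul_zero]) huu' hx0 hx hxu
      (by rw [polar_smul_right, hxgu, smul_zero])
    obtain ⟨y, hy0, hy, hyi⟩ := exists_singular_orthogonal Q ![u, g.1 u, x, x'] hV
    have hyu : polar Q y u = 0 := hyi 0
    have hygu : polar Q y (g.1 u) = 0 := hyi 1
    have hyx : polar Q y x = 0 := hyi 2
    have hyx' : polar Q y x' = 0 := hyi 3
    have hux : IsSingularPair Q u x := ⟨hu, hx, by rw [polar_comm, hxu]⟩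
    have hguy : IsSingularPair Q (g.1 u) y := ⟨hgu, hy, by rw [polar_comm, hygu]⟩
    have hxy : IsSingularPair Q x y := ⟨hx, hy, by rw [polar_comm, hyx]⟩
    have huy : IsSingularPair Q u (g⁻¹.1 y) := by
      refine ⟨hu, (g⁻¹.2 y).trans hy, ?_⟩
      rw [← polar_apply_apply g, hgi, hguy.polar_eq]
    have hcomm := siegel_commutator hux hguy.neg_right hxy.neg_right
      (by rw [polar_neg_right, polar_comm, hyu, neg_zero]) (by rw [polar_comm, hxgu])
    rw [← siegel_inv hguy] at hcomm
    obtain ⟨a', b', c, c', H⟩ := exists_hyperbolicFrame hV hQ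
      (hxy.neg_right.smul_right (polar Q u (g.1 u))) (by simp [hc, hy0]) hxx'
      (by simp [polar_smul_left, polar_neg_left, hyx'])
    refine ⟨_, _, _, _, _, _, H, hxy.neg_right.smul_right _, ?_⟩
    rw [← hcomm]
    refine commutator_mem_mul_conjQuotients
      (siegel_mem_commutator_of_dual hV hQ hux hx0 huu' (by simp [polar_smul_right, hxgu]))
      (siegel_mem_commutator_of_dual hV hQ hguy hy0 hu'u (by simp [polar_smul_right, hyu])) ?_
    rw [hgconj hguy huy rfl (hgi y), siegel_commute]
  · push Not at hA
    by_cases hB : ∃ p, Q p = 0 ∧ ∀ r : F, g.1 p ≠ r • p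
    · obtain ⟨p, hp, hpr⟩ := hB
      have hgp : Q (g.1 p) = 0 := (g.2 p).trans hp
      have hpgp : IsSingularPair Q p (g.1 p) := ⟨hp, hgp, hA p hp⟩
      have hp0 : p ≠ 0 := fun h => hpr 0 (by simp [h])
      have hgp0 : g.1 p ≠ 0 := fun h => hp0 ((LinearEquiv.map_eq_zero_iff _).1 h)
      have hpr' : ∀ r : F, p ≠ r • g.1 p := by
        intro r hr
        have hr0 : r ≠ 0 := fun h => hp0 (by rw [hr, h, zero_smul])
        exact hpr r⁻¹ ((eq_inv_smul_iff₀ hr0).2 hr.symm)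
      obtain ⟨y, hpy, hgpy⟩ := exists_polar_eq_one_of_ne_smul hQ hgp0 hpr'
      obtain ⟨_, _, w, w', H⟩ := exists_hyperbolicFrame hV hQ hpgp hgp0 hpy hgpy
      have hwp : IsSingularPair Q w p := ⟨H.qc, hp, H.ca⟩
      have hw'p : IsSingularPair Q w' (g.1 p) := ⟨H.qc', hgp, H.c'b⟩
      have hw'p' : IsSingularPair Q (g⁻¹.1 w') p := by
        refine ⟨(g⁻¹.2 w').trans H.qc', hp, ?_⟩
        rw [← polar_apply_apply g, hgi, hw'p.polar_eq]
      have hcomm := siegel_commutator hwp hw'p.neg_right hpgp.neg_right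
        (by rw [polar_neg_right, H.cb, neg_zero]) H.c'a
      rw [← siegel_inv hw'p] at hcomm
      obtain ⟨a', b', c, c', H'⟩ := exists_hyperbolicFrame hV hQ
        (hpgp.neg_right.smul_right (polar Q w w')) (by simp [H.cc', hgp0]) hpy
        (by simp [polar_smul_left, polar_neg_left, hgpy])
      refine ⟨_, _, _, _, _, _, H', hpgp.neg_right.smul_right _, ?_⟩
      rw [← hcomm]
      refine commutator_mem_mul_conjQuotients
        (siegel_mem_commutator_of_dual hV hQ hwp hp0 H.cc' (by rw [polar_comm, H.c'a]))
        (siegel_mem_commutator_of_dual hV hQ hw'p hgp0 ((polar_comm Q w' w).trans H.cc')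
          (by rw [polar_comm, H.cb])) ?_
      rw [hgconj hw'p hw'p' (hgi w') rfl, ← siegel_swap hwp, ← siegel_swap hw'p', siegel_commute]
    · push Not at hB
      obtain ⟨r, hr⟩ := exists_eq_smul_of_fixes_singular hV hQ g hB
      refine absurd (Subgroup.mem_center_iff.2 fun f => orthGroup_ext fun v => ?_) hg
      rw [orthGroup_mul_apply, orthGroup_mul_apply, hr, hr, _root_.map_smul]

/-- In characteristic different from two, `-1` on a sum of two hyperbolic planes is a product of
three conjugates of a Siegel transformation. -/
theorem siegel_mul_siegel_mul_siegel_apply {a a' b b' c c' : V}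
    (H : HyperbolicFrame Q a a' b b' c c') (h : IsSingularPair Q a b)
    (h₂ : IsSingularPair Q (-(2 : F) • b') ((2 : F) • a'))
    (h₃ : IsSingularPair Q (a - (2 : F) • b') (b + (2 : F) • a')) (v : V) :
    (siegel h * siegel h₂ * siegel h₃).1 v = v - (2 : F) • (polar Q v a' • a + polar Q v a • a' +
      polar Q v b' • b + polar Q v b • b') := by
  simp only [orthGroup_mul_apply, siegel_apply, polar_add_left, polar_sub_left, polar_smul_left,
    polar_smul_right, polar_add_right, polar_sub_right, H.ab, H.ab', H.a'b, H.a'b', H.aa', H.bb',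
    polar_comm Q b a, polar_comm Q b a', polar_comm Q b' a, polar_comm Q b' a', polar_comm Q a' a,
    polar_comm Q b' b, polar_self_eq_zero H.qa, polar_self_eq_zero H.qa', polar_self_eq_zero H.qb,
    polar_self_eq_zero H.qb', smul_eq_mul]
  module

/-- A Siegel transformation in characteristic two, or a product of three of its conjugates in
other characteristics, is a noncentral involution of the derived subgroup. -/
theorem exists_involution_of_siegel [Fintype F] [FiniteDimensional F V]
    {a a' b b' c c' : V} (H : HyperbolicFrame Q a a' b b' c c') (h : IsSingularPair Q a b)
    {D : Set (orthGroup Q)} (h1 : 1 ∈ D) (hD : siegel h ∈ D)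
    (hconj : ∀ s ∈ commutator (orthGroup Q), ∀ d ∈ D, s * d * s⁻¹ ∈ D) :
    ∃ t ∈ commutator (orthGroup Q), t ^ 2 = 1 ∧ (∃ s ∈ commutator (orthGroup Q), t * s ≠ s * t) ∧
      ∃ d₁ ∈ D, ∃ d₂ ∈ D, ∃ d₃ ∈ D, d₁ * d₂ * d₃ = t := by
  have ha'0 : a' ≠ 0 := by
    rintro rfl
    simpa using H.aa'
  have hS : siegel h ∈ commutator (orthGroup Q) :=
    siegel_mem_commutator h H.qc H.qc' H.cc' H.ca H.cb H.c'a H.c'b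
  have ha'b' : IsSingularPair Q a' b' := ⟨H.qa', H.qb', H.a'b'⟩
  by_cases h2 : (2 : F) = 0
  · refine ⟨siegel h, hS, orthGroup_ext fun v => ?_, ⟨siegel ha'b',
      siegel_mem_commutator ha'b' H.qc H.qc' H.cc' H.ca' H.cb' H.c'a' H.c'b', fun hts => ?_⟩,
      _, hD, 1, h1, 1, h1, by group⟩
    · rw [pow_two, orthGroup_mul_apply]
      simp only [siegel_apply, polar_add_left, polar_sub_left, polar_smul_left,
        h.polar_eq, h.symm.polar_eq, polar_self_eq_zero H.qa, polar_self_eq_zero H.qb, smul_eq_mul]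
      trans v + (2 : F) • (polar Q v a • b - polar Q v b • a)
      · module
      · rw [h2, zero_smul, add_zero]
        rfl
    · have := congrArg (fun f : orthGroup Q => f.1 a') hts
      apply ha'0
      simp only [orthGroup_mul_apply, siegel_apply, polar_add_left, polar_sub_left,
        polar_smul_left, polar_comm Q a' a, H.aa', H.a'b, H.a'b', H.bb', polar_self_eq_zero H.qa',
        polar_comm Q b a', smul_eq_mul] at this
      rw [← sub_eq_zero] at this
      rw [← this]
      module
  · have ha'2b' : IsSingularPair Q a' (-(2 : F) • b') := ha'b'.smul_right _
    have s₁ := siegel_mem_commutator ha'2b' H.qc H.qc' H.cc' H.ca'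
      (by rw [polar_smul_right, H.cb', smul_zero]) H.c'a'
      (by rw [polar_smul_right, H.c'b', smul_zero])
    have s₂ := siegel_mem_commutator (h.smul_right (-(2 : F)⁻¹)) H.qc H.qc' H.cc' H.ca
      (by rw [polar_smul_right, H.cb, smul_zero]) H.c'a
      (by rw [polar_smul_right, H.c'b, smul_zero])
    have hD₃ := hconj _ s₁ _ hD
    have e₃a : (siegel ha'2b').1 a = a - (2 : F) • b' := by
      simp only [siegel_apply, polar_smul_right, H.aa', H.ab']
      module
    have e₃b : (siegel ha'2b').1 b = b + (2 : F) • a' := by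
      simp only [siegel_apply, polar_smul_right, H.bb', polar_comm Q b a', H.a'b, smul_eq_mul]
      module
    rw [siegel_conj, siegel_congr _ e₃a e₃b] at hD₃
    have hD₂ := hconj _ s₂ _ hD₃
    have e₂a : (siegel (h.smul_right (-(2 : F)⁻¹))).1 (a - (2 : F) • b') = -(2 : F) • b' := by
      simp only [siegel_apply, polar_smul_right, polar_sub_left, polar_smul_left,
        polar_self_eq_zero H.qa, H.ab, polar_comm Q b' a, H.ab', polar_comm Q b' b, H.bb',
        smul_eq_mul]
      match_scalars <;> field_simp <;> ring
    have e₂b : (siegel (h.smul_right (-(2 : F)⁻¹))).1 (b + (2 : F) • a') = (2 : F) • a' := by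
      simp only [siegel_apply, polar_smul_right, polar_add_left, polar_smul_left,
        polar_self_eq_zero H.qb, polar_comm Q b a, H.ab, polar_comm Q a' a, H.aa', H.a'b,
        smul_eq_mul]
      match_scalars <;> field_simp <;> ring
    rw [siegel_conj, siegel_congr _ e₂a e₂b] at hD₂
    have h₂ : IsSingularPair Q (-(2 : F) • b') ((2 : F) • a') :=
      ⟨by simp [QuadraticMap.map_smul, H.qb'], by simp [QuadraticMap.map_smul, H.qa'], by
        simp [polar_neg_left, polar_smul_left, polar_smul_right, polar_comm Q b' a', H.a'b']⟩
    have h₃ : IsSingularPair Q (a - (2 : F) • b') (b + (2 : F) • a') :=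
      e₃a ▸ e₃b ▸ h.map (siegel ha'2b')
    have hac : IsSingularPair Q a c := ⟨H.qa, H.qc, by rw [polar_comm, H.ca]⟩
    have ht := siegel_mul_siegel_mul_siegel_apply H h h₂ h₃
    refine ⟨siegel h * siegel h₂ * siegel h₃, mul_mem (mul_mem hS ?_) ?_,
      orthGroup_ext fun v => ?_, ⟨siegel hac, ?_, fun hts => ?_⟩,
      _, hD, _, hD₂, _, hD₃, rfl⟩
    · exact siegel_mem_commutator _ H.qc H.qc' H.cc' (by simp [polar_smul_right, H.cb'])
        (by simp [polar_smul_right, H.ca']) (by simp [polar_smul_right, H.c'b'])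
        (by simp [polar_smul_right, H.c'a'])
    · exact siegel_mem_commutator _ H.qc H.qc' H.cc'
        (by simp [polar_sub_right, polar_smul_right, H.ca, H.cb'])
        (by simp [polar_add_right, polar_smul_right, H.cb, H.ca'])
        (by simp [polar_sub_right, polar_smul_right, H.c'a, H.c'b'])
        (by simp [polar_add_right, polar_smul_right, H.c'b, H.c'a'])
    · rw [pow_two, orthGroup_mul_apply, ht, ht]
      simp only [polar_add_left, polar_sub_left, polar_smul_left, H.ab, H.ab', H.a'b, H.a'b',
        H.aa', H.bb', polar_comm Q b a, polar_comm Q b a', polar_comm Q b' a, polar_comm Q b' a',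
        polar_comm Q a' a, polar_comm Q b' b, polar_self_eq_zero H.qa, polar_self_eq_zero H.qa',
        polar_self_eq_zero H.qb, polar_self_eq_zero H.qb', smul_eq_mul]
      change _ = v
      module
    · exact siegel_mem_commutator _ H.qb H.qb' H.bb' (by rw [polar_comm, H.ab])
        (by rw [polar_comm, H.cb]) (by rw [polar_comm, H.ab']) (by rw [polar_comm, H.cb'])
    · have := congrArg (fun f : orthGroup Q => f.1 a') hts
      simp only [orthGroup_mul_apply _ (siegel hac), orthGroup_mul_apply (siegel hac), ht] at this
      simp only [siegel_apply, polar_add_left, polar_sub_left, polar_smul_left,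
        polar_comm Q a' a, polar_comm Q a' c, H.aa', H.ca', H.ca, H.cb, H.cb', H.a'b, H.a'b',
        polar_self_eq_zero H.qa', polar_self_eq_zero H.qa, H.ab, H.ab', smul_eq_mul] at this
      have hc : (2 : F) • c = 0 := by
        rw [← sub_eq_zero] at this
        rw [← this]
        module
      refine h2 ?_
      simpa [polar_smul_left, H.cc'] using congrArg (fun w => polar Q w c') hc

end

theorem stmt_3 {F : Type*} [Field F] [Fintype F] {q n : ℕ} (hq : Fintype.card F = q)
    (hn : 7 ≤ n) (hodd : Odd n → Odd q)
    (Q : QuadraticForm F (Fin n → F))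
    (hQ : (QuadraticMap.polarBilin Q).Nondegenerate)
    (g : ↥(orthGroup Q)) (hg : g ∉ Subgroup.center ↥(orthGroup Q)) :
    ∃ t : ↥(orthGroup Q), t ∈ commutator ↥(orthGroup Q) ∧ t ^ 2 = 1 ∧
      (∃ s ∈ commutator ↥(orthGroup Q), t * s ≠ s * t) ∧
      ∃ x y : Fin 6 → ↥(orthGroup Q),
        (∀ i, x i ∈ {c : ↥(orthGroup Q) | ∃ s ∈ commutator ↥(orthGroup Q), c = s * g * s⁻¹}) ∧
        (∀ i, y i ∈ {c : ↥(orthGroup Q) | ∃ s ∈ commutator ↥(orthGroup Q), c = s * g * s⁻¹}⁻¹) ∧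
        x 0 * y 0 * (x 1 * y 1) * (x 2 * y 2) * (x 3 * y 3) * (x 4 * y 4) * (x 5 * y 5) = t := by
  have hQ' : ∀ v, (∀ w, QuadraticMap.polar Q v w = 0) → v = 0 := hQ.1
  obtain ⟨a, a', b, b', c, c', H, h, hD⟩ :=
    exists_siegel_mem_mul_conjQuotients (by simpa using hn) hQ' g hg
  obtain ⟨t, htS, ht2, hts, d₁, ⟨p₁, hp₁, r₁, hr₁, e₁⟩, d₂, ⟨p₂, hp₂, r₂, hr₂, e₂⟩,
    d₃, ⟨p₃, hp₃, r₃, hr₃, e₃⟩, ht⟩ := exists_involution_of_siegel H h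
      (D := {d | ∃ p ∈ conjQuotients (commutator (orthGroup Q)) g,
        ∃ p' ∈ conjQuotients (commutator (orthGroup Q)) g, d = p * p'})
      ⟨1, one_mem_conjQuotients _ _, 1, one_mem_conjQuotients _ _, by simp⟩ hD
      fun s hs d hd => conj_mem_mul_conjQuotients hs hd
  have hmem : ∀ i : Fin 6, ![p₁, r₁, p₂, r₂, p₃, r₃] i ∈
      conjQuotients (commutator (orthGroup Q)) g := by
    intro i
    fin_cases i <;> assumption
  choose x y hx hy hxy using hmem
  refine ⟨t, htS, ht2, hts, x, y, hx, hy, ?_⟩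
  simp only [← hxy]
  rw [← ht, e₁, e₂, e₃]
  simp [mul_assoc]
end

section
/- Let F be a finite field with |F| = q, let n ≥ 2 with (n,q) ≠ (2,2) and (n,q) ≠ (2,3), and let PSL_n(q) = SL_n(F)/Z(SL_n(F)). Then for every g ∈ PSL_n(q) with g ≠ 1, there exist k ≤ 12 and elements z₁,…,z_k of PSL_n(q), each of which is conjugate in PSL_n(q) to g or to g⁻¹, such that the product z₁z₂⋯z_k has order exactly 2. -/
/-- The projective special linear group `PSL_n(F) = SL_n(F)/Z(SL_n(F))`. -/
abbrev PSL (n : ℕ) (F : Type*) [Field F] :=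
  Matrix.SpecialLinearGroup (Fin n) F ⧸ Subgroup.center (Matrix.SpecialLinearGroup (Fin n) F)

open Matrix

/-- `h` is a product of exactly `k` conjugates of `g` or `g⁻¹`. -/
def IsProdConj {G : Type*} [Group G] (g : G) (k : ℕ) (h : G) : Prop :=
  ∃ l : List G, l.length = k ∧ (∀ z ∈ l, IsConj g z ∨ IsConj g⁻¹ z) ∧ l.prod = h

namespace IsProdConj

variable {G H : Type*} [Group G] [Group H] {g a b : G} {k m : ℕ}

theorem mul (ha : IsProdConj g k a) (hb : IsProdConj g m b) : IsProdConj g (k + m) (a * b) := by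
  obtain ⟨l, rfl, hl, rfl⟩ := ha
  obtain ⟨l', rfl, hl', rfl⟩ := hb
  refine ⟨l ++ l', by simp, fun z hz => ?_, by simp⟩
  rcases List.mem_append.1 hz with h | h
  exacts [hl z h, hl' z h]

theorem conj (ha : IsProdConj g k a) (x : G) : IsProdConj g k (x * a * x⁻¹) := by
  obtain ⟨l, rfl, hl, rfl⟩ := ha
  refine ⟨l.map (MulAut.conj x), by simp, ?_, by rw [← map_list_prod, MulAut.conj_apply]⟩
  intro z hz
  obtain ⟨y, hy, rfl⟩ := List.mem_map.1 hz
  have hyz : IsConj y (MulAut.conj x y) := isConj_iff.2 ⟨x, rfl⟩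
  exact (hl y hy).imp (·.trans hyz) (·.trans hyz)

theorem map (ha : IsProdConj g k a) (φ : G →* H) : IsProdConj (φ g) k (φ a) := by
  obtain ⟨l, rfl, hl, rfl⟩ := ha
  refine ⟨l.map φ, by simp, ?_, by rw [map_list_prod]⟩
  intro z hz
  obtain ⟨y, hy, rfl⟩ := List.mem_map.1 hz
  refine (hl y hy).imp φ.map_isConj fun h => ?_
  simpa using φ.map_isConj h

theorem commutator (g x : G) : IsProdConj g 2 (g * x * g⁻¹ * x⁻¹) := by
  refine ⟨[g, x * g⁻¹ * x⁻¹], rfl, ?_, by simp [mul_assoc]⟩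
  intro z hz
  simp only [List.mem_cons, List.not_mem_nil, or_false] at hz
  rcases hz with rfl | rfl
  exacts [.inl (IsConj.refl _), .inr (isConj_iff.2 ⟨x, rfl⟩)]

theorem exists_fin (ha : IsProdConj g k a) :
    ∃ z : Fin k → G, (∀ i, IsConj g (z i) ∨ IsConj g⁻¹ (z i)) ∧ (List.ofFn z).prod = a := by
  obtain ⟨l, rfl, hl, rfl⟩ := ha
  exact ⟨l.get, fun i => hl _ (l.get_mem i), by rw [List.ofFn_get]⟩

/-- A noncentral element of order dividing `4` yields an involution modulo the center. -/
theorem exists_involution_mod_center (hk : k ≤ 6) (ha : IsProdConj g k a)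
    (hc : a ∉ Subgroup.center G) (h4 : a ^ 4 = 1) :
    ∃ k ≤ 12, ∃ h, IsProdConj g k h ∧ h ∉ Subgroup.center G ∧ h ^ 2 ∈ Subgroup.center G := by
  by_cases h2 : a ^ 2 ∈ Subgroup.center G
  · exact ⟨k, by omega, a, ha, hc, h2⟩
  · refine ⟨k + k, by omega, a ^ 2, by rw [pow_two]; exact ha.mul ha, h2, ?_⟩
    rw [← pow_mul, h4]
    exact one_mem _

end IsProdConj

namespace Matrix.SpecialLinearGroup

variable {F : Type*} [Field F]

/-- The upper unitriangular element of `SL₂`. -/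
def upper (t : F) : SpecialLinearGroup (Fin 2) F := ⟨!![1, t; 0, 1], by simp⟩

/-- The lower unitriangular element of `SL₂`. -/
def lower (t : F) : SpecialLinearGroup (Fin 2) F := ⟨!![1, 0; t, 1], by simp⟩

/-- The antidiagonal element of `SL₂` with entries `c` and `-c⁻¹`. -/
def weyl (c : F) (hc : c ≠ 0) : SpecialLinearGroup (Fin 2) F :=
  ⟨!![0, c; -c⁻¹, 0], by simp [hc]⟩

theorem lower_mul_upper_inv (s t : F) :
    ((lower s * (upper t)⁻¹ : SpecialLinearGroup (Fin 2) F) : Matrix (Fin 2) (Fin 2) F) =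
      !![1, -t; s, 1 - s * t] := by
  rw [coe_mul, coe_inv]
  simp [lower, upper, adjugate_fin_two, sub_eq_neg_add]

theorem weyl_conj (s t c : F) (hc : c ≠ 0) :
    ((weyl c hc * (lower s * (upper t)⁻¹) * (weyl c hc)⁻¹ : SpecialLinearGroup (Fin 2) F) :
      Matrix (Fin 2) (Fin 2) F) = !![1 - s * t, -(c ^ 2 * s); t / c ^ 2, 1] := by
  rw [coe_mul, coe_mul, lower_mul_upper_inv, coe_inv]
  ext i j
  fin_cases i <;> fin_cases j <;> simp [weyl, adjugate_fin_two] <;> field_simp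

theorem pow_four_of_trace_eq_zero (X : SpecialLinearGroup (Fin 2) F)
    (h : X.1.trace = 0) : X ^ 4 = 1 := by
  rw [trace_fin_two] at h
  have hd := X.2
  rw [det_fin_two] at hd
  have h2 : X.1 ^ 2 = -1 := by
    ext i j
    fin_cases i <;> fin_cases j <;> simp [pow_two, mul_apply, Fin.sum_univ_two]
    · linear_combination X.1 0 0 * h - hd
    · linear_combination X.1 0 1 * h
    · linear_combination X.1 1 0 * h
    · linear_combination X.1 1 1 * h - hd
  apply Subtype.ext
  rw [coe_pow, show 4 = 2 * 2 from rfl, pow_mul, h2]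
  simp

variable {n : Type*} [Fintype n] [DecidableEq n]

/-- The embedding of `SL₂` as a `2 × 2` block, relative to a pair of maps with `R * E = 1`. -/
def blockHom (E : Matrix n (Fin 2) F) (R : Matrix (Fin 2) n F) (h : R * E = 1) :
    SpecialLinearGroup (Fin 2) F →* SpecialLinearGroup n F where
  toFun X := ⟨1 + E * ((X.1 - 1) * R), by
    rw [det_one_add_mul_comm, Matrix.mul_assoc, h, Matrix.mul_one, add_sub_cancel, X.2]⟩
  map_one' := by
    apply Subtype.ext
    simp
  map_mul' X Y := by
    apply Subtype.ext
    have key : E * ((X.1 - 1) * R) * (E * ((Y.1 - 1) * R)) = E * ((X.1 - 1) * (Y.1 - 1) * R) := by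
      simp only [Matrix.mul_assoc]
      rw [← Matrix.mul_assoc R E, h, Matrix.one_mul]
    change 1 + E * ((X.1 * Y.1 - 1) * R) = (1 + E * ((X.1 - 1) * R)) * (1 + E * ((Y.1 - 1) * R))
    rw [Matrix.mul_add, Matrix.add_mul _ _ (E * ((Y.1 - 1) * R)), key]
    simp only [Matrix.mul_sub, Matrix.sub_mul, Matrix.mul_one, Matrix.one_mul]
    abel

theorem exists_scalar_of_blockHom_mem_center {E : Matrix n (Fin 2) F} {R : Matrix (Fin 2) n F}
    (h : R * E = 1) {X : SpecialLinearGroup (Fin 2) F}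
    (hX : blockHom E R h X ∈ Subgroup.center (SpecialLinearGroup n F)) :
    ∃ r : F, X.1 = r • 1 := by
  obtain ⟨r, -, hr⟩ := mem_center_iff.1 hX
  refine ⟨r, ?_⟩
  have h1 : R * (1 + E * ((X.1 - 1) * R)) * E = R * scalar n r * E := by
    rw [hr]; rfl
  rw [scalar_apply, ← smul_one_eq_diagonal] at h1
  have h2 : R * (1 + E * ((X.1 - 1) * R)) * E = X.1 := by
    rw [Matrix.mul_add, ← Matrix.mul_assoc, h, Matrix.one_mul, Matrix.mul_one, Matrix.add_mul,
      Matrix.mul_assoc, h, Matrix.mul_one, add_sub_cancel]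
  rw [← h2, h1, Matrix.mul_smul, Matrix.mul_one, Matrix.smul_mul, h]

theorem exists_hom_conj_upper (A : SpecialLinearGroup n F) {v w : n → F} {α β : F}
    (hα : α ≠ 0) (hβ : β ≠ 0) (h0 : w ⬝ᵥ v = 0) (h1 : w ⬝ᵥ (A.1 *ᵥ v) = α)
    (h2 : w ⬝ᵥ (A⁻¹.1 *ᵥ v) = β) :
    ∃ ι : SpecialLinearGroup (Fin 2) F →* SpecialLinearGroup n F,
      (∀ X, ι X ∈ Subgroup.center (SpecialLinearGroup n F) → ∃ r : F, X.1 = r • 1) ∧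
      ∀ t, A * ι (upper (t * α)) * A⁻¹ = ι (lower (t * β)) := by
  have hA : A⁻¹.1 * A.1 = 1 := by rw [← coe_mul, inv_mul_cancel, coe_one]
  let E : Matrix n (Fin 2) F := (of ![v, A.1 *ᵥ v])ᵀ
  let R : Matrix (Fin 2) n F := of ![β⁻¹ • (w ᵥ* A⁻¹.1), α⁻¹ • w]
  have h : R * E = 1 := by
    ext i j
    fin_cases i <;> fin_cases j
    · change (β⁻¹ • (w ᵥ* A⁻¹.1)) ⬝ᵥ v = 1
      rw [smul_dotProduct, ← dotProduct_mulVec, h2, smul_eq_mul, inv_mul_cancel₀ hβ]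
    · change (β⁻¹ • (w ᵥ* A⁻¹.1)) ⬝ᵥ (A.1 *ᵥ v) = 0
      rw [smul_dotProduct, ← dotProduct_mulVec, mulVec_mulVec, hA, one_mulVec, h0, smul_zero]
    · change (α⁻¹ • w) ⬝ᵥ v = 0
      rw [smul_dotProduct, h0, smul_zero]
    · change (α⁻¹ • w) ⬝ᵥ (A.1 *ᵥ v) = 1
      rw [smul_dotProduct, h1, smul_eq_mul, inv_mul_cancel₀ hα]
  have hU (t : F) : (blockHom E R h (upper (t * α))).1 = 1 + t • vecMulVec v w := by
    change 1 + E * ((!![1, t * α; 0, 1] - 1) * R) = _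
    congr 1
    ext i j
    simp [E, R, mul_apply, Fin.sum_univ_two, vecMulVec_apply]
    field_simp
  have hL (t : F) : (blockHom E R h (lower (t * β))).1 =
      1 + t • vecMulVec (A.1 *ᵥ v) (w ᵥ* A⁻¹.1) := by
    change 1 + E * ((!![1, 0; t * β, 1] - 1) * R) = _
    congr 1
    ext i j
    simp [E, R, mul_apply, Fin.sum_univ_two, vecMulVec_apply]
    field_simp
  refine ⟨blockHom E R h, fun X => exists_scalar_of_blockHom_mem_center h, fun t => ?_⟩
  apply Subtype.ext
  rw [coe_mul, coe_mul, hU, hL, Matrix.mul_add, Matrix.mul_one, Matrix.add_mul, ← coe_mul,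
    mul_inv_cancel, coe_one, Matrix.mul_smul, Matrix.smul_mul, mul_vecMulVec, vecMulVec_mul]

theorem exists_linearIndependent_mulVec {A : SpecialLinearGroup n F}
    (hA : A ∉ Subgroup.center (SpecialLinearGroup n F)) :
    ∃ v, LinearIndependent F ![v, A.1 *ᵥ v] := by
  by_contra! hv
  obtain ⟨a, ha⟩ := LinearMap.exists_eq_smul_id_of_forall_notLinearIndependent
    (f := Matrix.mulVecLin A.1) hv
  have h1 : A.1 = scalar n a := by
    have : A.1 = LinearMap.toMatrix' (Matrix.mulVecLin A.1) := by
      rw [← toLin'_apply', LinearMap.toMatrix'_toLin']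
    rw [this, ha, map_smul, LinearMap.toMatrix'_one, scalar_apply, smul_one_eq_diagonal]
  refine hA (mem_center_iff.2 ⟨a, ?_, h1.symm⟩)
  have := A.2
  rwa [h1, scalar_apply, det_diagonal, Finset.prod_const, Finset.card_univ] at this

theorem exists_dotProduct_ne_zero_of_notMem {p : Submodule F (n → F)} {u : n → F} (hu : u ∉ p) :
    ∃ w : n → F, w ⬝ᵥ u ≠ 0 ∧ ∀ v ∈ p, w ⬝ᵥ v = 0 := by
  obtain ⟨f, hf, hp⟩ := Submodule.exists_le_ker_of_notMem hu
  obtain ⟨w, rfl⟩ := (dotProductEquiv F n).surjective f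
  exact ⟨w, hf, fun v hv => hp hv⟩

theorem exists_dotProduct_mulVec_ne_zero (A : SpecialLinearGroup n F) {v : n → F}
    (hv : LinearIndependent F ![v, A.1 *ᵥ v]) :
    ∃ w : n → F, w ⬝ᵥ v = 0 ∧ w ⬝ᵥ (A.1 *ᵥ v) ≠ 0 ∧ w ⬝ᵥ (A⁻¹.1 *ᵥ v) ≠ 0 := by
  have hA : A.1 * A⁻¹.1 = 1 := by rw [← coe_mul, mul_inv_cancel, coe_one]
  have hv0 : v ≠ 0 := by simpa using hv.ne_zero 0
  rw [LinearIndependent.pair_iff' hv0] at hv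
  have hm1 : A.1 *ᵥ v ∉ F ∙ v := fun h => by
    obtain ⟨a, ha⟩ := Submodule.mem_span_singleton.1 h
    exact hv a ha
  have hm2 : A⁻¹.1 *ᵥ v ∉ F ∙ v := fun h => by
    obtain ⟨a, ha⟩ := Submodule.mem_span_singleton.1 h
    have hav : a • A.1 *ᵥ v = v := by
      rw [← mulVec_smul, ha, mulVec_mulVec, hA, one_mulVec]
    have ha0 : a ≠ 0 := by
      rintro rfl
      exact hv0 (by rw [← hav, zero_smul])
    exact hv a⁻¹ (by rw [inv_smul_eq_iff₀ ha0, hav])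
  obtain ⟨w₁, h1, h1'⟩ := exists_dotProduct_ne_zero_of_notMem hm1
  obtain ⟨w₂, h2, h2'⟩ := exists_dotProduct_ne_zero_of_notMem hm2
  have hvv := Submodule.mem_span_singleton_self (R := F) v
  by_cases h3 : w₁ ⬝ᵥ (A⁻¹.1 *ᵥ v) = 0
  · by_cases h4 : w₂ ⬝ᵥ (A.1 *ᵥ v) = 0
    · refine ⟨w₁ + w₂, ?_, ?_, ?_⟩
      · rw [add_dotProduct, h1' v hvv, h2' v hvv, add_zero]
      · rwa [add_dotProduct, h4, add_zero]
      · rwa [add_dotProduct, h3, zero_add]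
    · exact ⟨w₂, h2' v hvv, h4, h2⟩
  · exact ⟨w₁, h1' v hvv, h1, h3⟩

/-- The product of a commutator of unitriangular type and a `P`-conjugate of another one. -/
def commutatorProduct (α β s t : F) (P : SpecialLinearGroup (Fin 2) F) :
    SpecialLinearGroup (Fin 2) F :=
  lower (s * β) * (upper (s * α))⁻¹ * (P * (lower (t * β) * (upper (t * α))⁻¹) * P⁻¹)

theorem isProdConj_commutatorProduct {G : Type*} [Group G] {A : G}
    {ι : SpecialLinearGroup (Fin 2) F →* G} {α β : F}
    (h : ∀ t, A * ι (upper (t * α)) * A⁻¹ = ι (lower (t * β))) (s t : F)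
    (P : SpecialLinearGroup (Fin 2) F) :
    IsProdConj A 4 (ι (commutatorProduct α β s t P)) := by
  have key (t : F) : IsProdConj A 2 (ι (lower (t * β) * (upper (t * α))⁻¹)) := by
    rw [map_mul, map_inv, ← h]
    exact IsProdConj.commutator _ _
  simpa [commutatorProduct] using (key s).mul ((key t).conj (ι P))

theorem commutatorProduct_weyl (α β s t c : F) (hc : c ≠ 0) :
    (commutatorProduct α β s t (weyl c hc)).1 = !![1, -(s * α); s * β, 1 - s * β * (s * α)] *
      !![1 - t * β * (t * α), -(c ^ 2 * (t * β)); t * α / c ^ 2, 1] := by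
  rw [commutatorProduct, coe_mul, lower_mul_upper_inv, weyl_conj]

theorem trace_commutatorProduct_weyl (α β s t c : F) (hc : c ≠ 0) :
    (commutatorProduct α β s t (weyl c hc)).1.trace =
      2 - (α * s / c + c * β * t) * (c * β * s + α * t / c) := by
  rw [commutatorProduct_weyl, trace_fin_two]
  simp
  field_simp
  ring

theorem trace_commutatorProduct_one (α β s t : F) :
    (commutatorProduct α β s t 1).1.trace =
      2 - α * β * (s + t) ^ 2 + (α * β) ^ 2 * (s * t) ^ 2 := by
  rw [commutatorProduct, one_mul, inv_one, mul_one, coe_mul, lower_mul_upper_inv,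
    lower_mul_upper_inv, trace_fin_two]
  simp
  ring

theorem exists_trace_eq_zero {α β : F} (h2 : (2 : F) ≠ 0) (hα : α ≠ 0) (hβ : β ≠ 0) :
    ∃ (s t : F) (P : SpecialLinearGroup (Fin 2) F),
      (commutatorProduct α β s t P).1.trace = 0 := by
  by_cases hc : ∃ c : F, c ≠ 0 ∧ c ^ 4 * β ^ 2 ≠ α ^ 2
  · obtain ⟨c, hc, hd⟩ := hc
    have hd' : α ^ 2 - c ^ 4 * β ^ 2 ≠ 0 := sub_ne_zero.2 hd.symm
    refine ⟨c * (α - 2 * c ^ 2 * β) / (α ^ 2 - c ^ 4 * β ^ 2),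
      c * (2 * α - c ^ 2 * β) / (α ^ 2 - c ^ 4 * β ^ 2), weyl c hc, ?_⟩
    rw [trace_commutatorProduct_weyl]
    have e1 : α * (c * (α - 2 * c ^ 2 * β) / (α ^ 2 - c ^ 4 * β ^ 2)) / c +
        c * β * (c * (2 * α - c ^ 2 * β) / (α ^ 2 - c ^ 4 * β ^ 2)) = 1 := by
      field_simp
      ring
    have e2 : c * β * (c * (α - 2 * c ^ 2 * β) / (α ^ 2 - c ^ 4 * β ^ 2)) +
        α * (c * (2 * α - c ^ 2 * β) / (α ^ 2 - c ^ 4 * β ^ 2)) / c = 2 := by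
      field_simp
      ring
    rw [e1, e2]
    ring
  · push Not at hc
    have e1 := hc 1 one_ne_zero
    have e2 := hc 2 h2
    have e15 : (15 : F) * β ^ 2 = 0 := by linear_combination e2 - e1
    have e15' : (3 : F) = 0 ∨ (5 : F) = 0 := by
      rw [← mul_eq_zero]
      have := (mul_eq_zero.1 e15).resolve_right (pow_ne_zero 2 hβ)
      linear_combination this
    have hab : α = β ∨ α = -β := sq_eq_sq_iff_eq_or_eq_neg.1 (by linear_combination -e1)
    rcases hab with rfl | rfl <;> rcases e15' with h3 | h5
    · refine ⟨1 / α, -1 / α, 1, ?_⟩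
      rw [trace_commutatorProduct_one]
      field_simp
      linear_combination h3
    · refine ⟨1 / α, -2 / α, 1, ?_⟩
      rw [trace_commutatorProduct_one]
      field_simp
      linear_combination h5
    · refine ⟨1 / β, 0, 1, ?_⟩
      rw [trace_commutatorProduct_one]
      field_simp
      linear_combination h3
    · refine ⟨1 / β, 2 / β, 1, ?_⟩
      rw [trace_commutatorProduct_one]
      field_simp
      linear_combination 3 * h5

theorem exists_involution_of_two_ne_zero (h2 : (2 : F) ≠ 0) {A : SpecialLinearGroup n F}
    (hA : A ∉ Subgroup.center (SpecialLinearGroup n F)) :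
    ∃ k ≤ 12, ∃ h, IsProdConj A k h ∧ h ∉ Subgroup.center (SpecialLinearGroup n F) ∧
      h ^ 2 ∈ Subgroup.center (SpecialLinearGroup n F) := by
  obtain ⟨v, hv⟩ := exists_linearIndependent_mulVec hA
  obtain ⟨w, h0, hα, hβ⟩ := exists_dotProduct_mulVec_ne_zero A hv
  obtain ⟨ι, hι, hc⟩ := exists_hom_conj_upper A hα hβ h0 rfl rfl
  obtain ⟨s, t, P, htr⟩ := exists_trace_eq_zero h2 hα hβ
  refine (isProdConj_commutatorProduct hc s t P).exists_involution_mod_center (by norm_num) ?_ ?_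
  · intro hX
    obtain ⟨r, hr⟩ := hι _ hX
    have hd := (commutatorProduct (w ⬝ᵥ (A.1 *ᵥ v)) (w ⬝ᵥ (A⁻¹.1 *ᵥ v)) s t P).2
    rw [hr] at htr hd
    have hr0 : r = 0 := by simpa [h2] using htr
    simp [hr0] at hd
  · rw [← map_pow, pow_four_of_trace_eq_zero _ htr, map_one]

theorem exists_involution_fin_two_of_two_eq_zero (h2 : (2 : F) = 0) {c : F} (hc : c ≠ 0)
    (hc1 : c ≠ 1) {A : SpecialLinearGroup (Fin 2) F}
    (hA : A ∉ Subgroup.center (SpecialLinearGroup (Fin 2) F)) :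
    ∃ k ≤ 12, ∃ h, IsProdConj A k h ∧ h ∉ Subgroup.center (SpecialLinearGroup (Fin 2) F) ∧
      h ^ 2 ∈ Subgroup.center (SpecialLinearGroup (Fin 2) F) := by
  obtain ⟨v, hv⟩ := exists_linearIndependent_mulVec hA
  obtain ⟨w, h0, hα, -⟩ := exists_dotProduct_mulVec_ne_zero A hv
  set α := w ⬝ᵥ (A.1 *ᵥ v) with hαdef
  have hβ : w ⬝ᵥ (A⁻¹.1 *ᵥ v) = α := by
    rw [hαdef, coe_inv, adjugate_fin_two]
    simp only [dotProduct, mulVec, Fin.sum_univ_two] at h0 ⊢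
    simp
    linear_combination (A.1 0 0 + A.1 1 1) * h0 - (w 0 * (A.1 0 0 * v 0 + A.1 0 1 * v 1) +
      w 1 * (A.1 1 0 * v 0 + A.1 1 1 * v 1)) * h2
  obtain ⟨ι, hι, hconj⟩ := exists_hom_conj_upper A hα hα h0 rfl hβ
  refine (isProdConj_commutatorProduct hconj (1 / α) (c ^ 2 / α)
    (weyl c hc)).exists_involution_mod_center (by norm_num) ?_ ?_
  · intro hX
    obtain ⟨r, hr⟩ := hι _ hX
    rw [commutatorProduct_weyl] at hr
    have h01 := congrFun (congrFun hr 0) 1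
    simp [hα] at h01
    have h4 : (c - 1) ^ 4 = 0 := by
      linear_combination (-1 : F) * h01 + (-2 * c ^ 3 + 3 * c ^ 2 - 2 * c) * h2
    exact hc1 (sub_eq_zero.1 (pow_eq_zero_iff (by norm_num) |>.1 h4))
  · rw [← map_pow, pow_four_of_trace_eq_zero, map_one]
    rw [trace_commutatorProduct_weyl]
    field_simp
    linear_combination (-c ^ 4) * h2

theorem exists_involution_of_two_eq_zero (h2 : (2 : F) = 0) (hn : 2 < Fintype.card n)
    {A : SpecialLinearGroup n F} (hA : A ∉ Subgroup.center (SpecialLinearGroup n F)) :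
    ∃ k ≤ 12, ∃ h, IsProdConj A k h ∧ h ∉ Subgroup.center (SpecialLinearGroup n F) ∧
      h ^ 2 ∈ Subgroup.center (SpecialLinearGroup n F) := by
  obtain ⟨v, hv⟩ := exists_linearIndependent_mulVec hA
  obtain ⟨u, hu⟩ : ∃ u, u ∉ Submodule.span F (Set.range ![v, A.1 *ᵥ v]) := by
    by_contra! h
    have h1 := finrank_range_le_card (R := F) ![v, A.1 *ᵥ v]
    rw [Set.finrank, (Submodule.eq_top_iff').2 h, finrank_top, Module.finrank_fintype_fun_eq_card,
      Fintype.card_fin] at h1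
    omega
  obtain ⟨w, hw, hw'⟩ := exists_dotProduct_ne_zero_of_notMem hu
  have h0 : w ⬝ᵥ v = 0 := hw' _ (Submodule.subset_span ⟨0, rfl⟩)
  have h1 : w ⬝ᵥ (A.1 *ᵥ v) = 0 := hw' _ (Submodule.subset_span ⟨1, rfl⟩)
  have hA' : A⁻¹.1 * A.1 = 1 := by rw [← coe_mul, inv_mul_cancel, coe_one]
  have hA'' : A.1 * A⁻¹.1 = 1 := by rw [← coe_mul, mul_inv_cancel, coe_one]
  set M := vecMulVec v w with hM
  set N := vecMulVec (A.1 *ᵥ v) (w ᵥ* A⁻¹.1) with hN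
  have h2m (B : Matrix n n F) : B + B = 0 := by rw [← two_smul F, h2, zero_smul]
  have hMM : M * M = 0 := by simp [hM, vecMulVec_mul_vecMulVec, h0]
  have hMN : M * N = 0 := by simp [hM, hN, vecMulVec_mul_vecMulVec, h1]
  have hNN : N * N = 0 := by
    rw [hN, vecMulVec_mul_vecMulVec, ← dotProduct_mulVec, mulVec_mulVec, hA', one_mulVec, h0,
      zero_smul, vecMulVec_zero]
  let x : SpecialLinearGroup n F := ⟨1 + M, by
    rw [hM, vecMulVec_eq Unit, det_one_add_replicateCol_mul_replicateRow, h0, add_zero]⟩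
  have hM1 : (1 + M) * (1 + M) = 1 := by
    rw [mul_add, add_mul _ _ M, mul_one, one_mul, hMM, add_zero, add_assoc, h2m, add_zero]
  have hx : x⁻¹ = x := inv_eq_iff_mul_eq_one.2 (Subtype.ext hM1)
  have hB : (A * x * A⁻¹ * x⁻¹).1 = (1 + N) * (1 + M) := by
    rw [hx, coe_mul, coe_mul, coe_mul]
    change A.1 * (1 + M) * A⁻¹.1 * (1 + M) = _
    rw [mul_add A.1, add_mul _ _ A⁻¹.1, mul_one, hA'', hM, mul_vecMulVec, vecMulVec_mul]
  refine (IsProdConj.commutator A x).exists_involution_mod_center (by norm_num) ?_ ?_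
  · intro hc
    obtain ⟨r, -, hr⟩ := mem_center_iff.1 hc
    rw [hB, scalar_apply, ← smul_one_eq_diagonal] at hr
    have hr' : r • (1 + M) = 1 + N := by
      have := congrArg (· * (1 + M)) hr
      simpa [Matrix.mul_assoc, hM1] using this
    have hNv (y : n → F) : N *ᵥ y = ((w ᵥ* A⁻¹.1) ⬝ᵥ y) • A.1 *ᵥ v := by
      rw [hN, vecMulVec_mulVec, op_smul_eq_smul]
    have hMv (y : n → F) : M *ᵥ y = (w ⬝ᵥ y) • v := by
      rw [hM, vecMulVec_mulVec, op_smul_eq_smul]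
    have hy (y : n → F) : r • (y + (w ⬝ᵥ y) • v) = y + ((w ᵥ* A⁻¹.1) ⬝ᵥ y) • A.1 *ᵥ v := by
      have := congrArg (· *ᵥ y) hr'
      simpa only [smul_mulVec, add_mulVec, one_mulVec, hNv, hMv] using this
    rw [LinearIndependent.pair_iff] at hv
    have hr1 : r = 1 := by
      have h3 := hy v
      rw [h0, zero_smul, add_zero] at h3
      have := hv (r - 1) (-((w ᵥ* A⁻¹.1) ⬝ᵥ v)) (by rw [sub_smul, h3]; module)
      exact sub_eq_zero.1 this.1
    have h3 := hy u
    rw [hr1, one_smul, add_right_inj] at h3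
    exact hw (hv (w ⬝ᵥ u) (-((w ᵥ* A⁻¹.1) ⬝ᵥ u)) (by rw [h3]; module)).1
  · apply Subtype.ext
    rw [coe_pow, hB, coe_one]
    have h3 : ((1 + N) * (1 + M)) ^ 2 = 1 + N * M := by
      have : ((1 + N) * (1 + M)) ^ 2 = 1 + N * M + (N + N) + (M + M) + (N * M + N * M) + N * N +
          M * M + M * N + N * N * M + N * (M * M) + N * (M * N) + M * N * M + N * (M * N) * M := by
        noncomm_ring
      rw [this]
      simp [h2m, hMM, hMN, hNN]
    have h4 : N * M * (N * M) = 0 := by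
      rw [Matrix.mul_assoc, ← Matrix.mul_assoc M, hMN, Matrix.zero_mul, Matrix.mul_zero]
    rw [show 4 = 2 * 2 from rfl, pow_mul, h3, pow_two, mul_add, add_mul _ _ (N * M), mul_one, one_mul, h4,
      add_zero, add_assoc, h2m, add_zero]

end Matrix.SpecialLinearGroup

theorem stmt_4 {F : Type*} [Field F] [Fintype F] {q n : ℕ} (hq : Fintype.card F = q)
    (hn : 2 ≤ n) (h22 : ¬(n = 2 ∧ q = 2)) (h23 : ¬(n = 2 ∧ q = 3))
    (g : PSL n F) (hg : g ≠ 1) :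
    ∃ k ≤ 12, ∃ z : Fin k → PSL n F,
      (∀ i, IsConj g (z i) ∨ IsConj g⁻¹ (z i)) ∧ orderOf (List.ofFn z).prod = 2 := by
  classical
  obtain ⟨A, rfl⟩ := QuotientGroup.mk_surjective g
  have hA : A ∉ Subgroup.center _ := fun h => hg ((QuotientGroup.eq_one_iff A).2 h)
  obtain ⟨k, hk, h, hprod, hc, hc2⟩ : ∃ k ≤ 12, ∃ h, IsProdConj A k h ∧
      h ∉ Subgroup.center (Matrix.SpecialLinearGroup (Fin n) F) ∧
      h ^ 2 ∈ Subgroup.center (Matrix.SpecialLinearGroup (Fin n) F) := by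
    by_cases h2 : (2 : F) = 0
    · rcases hn.eq_or_lt with rfl | hn'
      · obtain ⟨c, hc⟩ : ∃ c : F, c ∉ ({0, 1} : Finset F) := by
          by_contra! h
          have h1 := Finset.card_le_card (fun x _ => h x : Finset.univ ⊆ ({0, 1} : Finset F))
          have h3 : 2 ≤ Fintype.card F := Fintype.one_lt_card
          have h4 := h1.trans Finset.card_le_two
          rw [Finset.card_univ] at h4
          omega
        simp only [Finset.mem_insert, Finset.mem_singleton, not_or] at hc
        exact Matrix.SpecialLinearGroup.exists_involution_fin_two_of_two_eq_zero h2 hc.1 hc.2 hA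
      · exact Matrix.SpecialLinearGroup.exists_involution_of_two_eq_zero h2 (by simpa) hA
    · exact Matrix.SpecialLinearGroup.exists_involution_of_two_ne_zero h2 hA
  obtain ⟨z, hz, hz'⟩ := (hprod.map (QuotientGroup.mk' (Subgroup.center _))).exists_fin
  refine ⟨k, hk, z, hz, ?_⟩
  rw [hz']
  refine orderOf_eq_prime ?_ fun h1 => hc ((QuotientGroup.eq_one_iff h).1 h1)
  exact (QuotientGroup.eq_one_iff (h ^ 2)).2 hc2
end
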